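/- Let μ > 0 and λ ∈ (0,1]. There exist constants C > 0, δ > 0 and a nonnegative function A ∈ L¹((0,∞)) with ‖A‖_{L¹} independent of K, ε, t, such that: if ψ is a solution as in the context with E_N(ψ)(0) ≤ ε², satisfying the bootstrap bound E_N(ψ)(t) ≤ K²ε² for all t ≥ 0, and Kε ≤ δ, then for all t > 0, Σ_{|a|≤N} ∫_{ℝ³}((1+t)^{2λ}|∂Γ^aψ|² + |Γ^aψ|²) dx + C Σ_{|a|≤N} ∫₀^t ∫_{ℝ³} (1+τ)^λ |∂Γ^aψ|² dx dτ ≤ Cε² + C(1+Kε) ∫₀^t A(τ) Σ_{|a|≤N} ∫_{ℝ³}((1+τ)^{2λ}|∂Γ^aψ|² + ψ²) dx dτ. -/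

import Mathlib

noncomputable section
open MeasureTheory Real Set

/-- Euclidean space ℝ³. -/
abbrev E3 : Type := EuclideanSpace ℝ (Fin 3)
/-- A space-time point (t, x) ∈ ℝ × ℝ³. -/
abbrev Pt : Type := ℝ × E3

/-- Time derivative ∂ₜ. -/
def dt (f : Pt → ℝ) (p : Pt) : ℝ := fderiv ℝ f p (1, 0)
/-- Spatial derivative ∂ᵢ. -/
def dxi (i : Fin 3) (f : Pt → ℝ) (p : Pt) : ℝ := fderiv ℝ f p (0, EuclideanSpace.single i 1)

/-- The vector fields Γ = (∂ₜ, ∂₁, ∂₂, ∂₃, Ω₁, Ω₂, Ω₃, S), where Ω = x ∧ ∇ are the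
rotations and S = t∂ₜ + Σ xₖ∂ₖ is the scaling field. -/
def Gam : Fin 8 → (Pt → ℝ) → Pt → ℝ :=
  ![dt, dxi 0, dxi 1, dxi 2,
    fun f p => p.2 1 * dxi 2 f p - p.2 2 * dxi 1 f p,
    fun f p => p.2 2 * dxi 0 f p - p.2 0 * dxi 2 f p,
    fun f p => p.2 0 * dxi 1 f p - p.2 1 * dxi 0 f p,
    fun f p => p.1 * dt f p + ∑ k, p.2 k * dxi k f p]

/-- The composition Γ^a corresponding to a word `a` in the eight fields. -/
def GamWord : List (Fin 8) → (Pt → ℝ) → Pt → ℝ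
  | [], f => f
  | k :: l, f => Gam k (GamWord l f)

/-- The first-order derivatives ∂ = (∂ₜ, ∂₁, ∂₂, ∂₃). -/
def Dop : Fin 4 → (Pt → ℝ) → Pt → ℝ := ![dt, dxi 0, dxi 1, dxi 2]

/-- The composition ∂^a corresponding to a word `a` in the four derivatives. -/
def DWord : List (Fin 4) → (Pt → ℝ) → Pt → ℝ
  | [], f => f
  | k :: l, f => Dop k (DWord l f)

/-- L² norm in the space variable. -/
def L2norm (f : E3 → ℝ) : ℝ := Real.sqrt (∫ x : E3, (f x) ^ 2)

/-- The d'Alembertian □ = ∂ₜ² - Δ. -/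
def box (f : Pt → ℝ) (p : Pt) : ℝ :=
  dt (fun q => dt f q) p - ∑ i, dxi i (fun q => dxi i f q) p

/-- The square of the sound speed, expressed through ψ:
`c²(ρ) = 1 - (γ-1)[(1+t)^λ ∂ₜψ + λ(1+t)^{λ-1}ψ + μψ + (1+t)^{2λ}|∇ψ|²/2]`. -/
def csq (μ lam γ : ℝ) (ψ : Pt → ℝ) (p : Pt) : ℝ :=
  1 - (γ - 1) * ((1 + p.1) ^ lam * dt ψ p + lam * (1 + p.1) ^ (lam - 1) * ψ p
    + μ * ψ p + (1 + p.1) ^ (2 * lam) * (∑ i, (dxi i ψ p) ^ 2) / 2)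

/-- The quadratic error term `Q(ψ) = (c²(ρ)-1)Δψ - 2(1+t)^λ ∂ₜ∇ψ·∇ψ
- 2λ(1+t)^{λ-1}|∇ψ|² - μ|∇ψ|² - (1+t)^{2λ} Σ (∂ᵢψ)(∂ⱼψ)∂ᵢⱼψ`. -/
def Qpsi (μ lam γ : ℝ) (ψ : Pt → ℝ) (p : Pt) : ℝ :=
  (csq μ lam γ ψ p - 1) * (∑ i, dxi i (fun q => dxi i ψ q) p)
    - 2 * (1 + p.1) ^ lam * ∑ i, dxi i (fun q => dt ψ q) p * dxi i ψ p
    - 2 * lam * (1 + p.1) ^ (lam - 1) * ∑ i, (dxi i ψ p) ^ 2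
    - μ * ∑ i, (dxi i ψ p) ^ 2
    - (1 + p.1) ^ (2 * lam) *
        ∑ i, ∑ j, dxi i ψ p * dxi j ψ p * dxi i (fun q => dxi j ψ q) p

/-- ψ solves `□ψ + (μ/(1+t)^λ)∂ₜψ + (2λ/(1+t))∂ₜψ - (λ(1-λ)/(1+t)²)ψ = Q(ψ)` for `t ≥ 0`. -/
def psiEq (μ lam γ : ℝ) (ψ : Pt → ℝ) : Prop :=
  ∀ p : Pt, 0 ≤ p.1 →
    box ψ p + μ / (1 + p.1) ^ lam * dt ψ p + 2 * lam / (1 + p.1) * dt ψ p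
      - lam * (1 - lam) / (1 + p.1) ^ 2 * ψ p = Qpsi μ lam γ ψ p

/-- The time-weighted energy
`E_N(ψ)(t) = Σ_{|a|≤N} ∫ ((1+t)^{2λ}|∂Γ^aψ|² + |Γ^aψ|²) dx`. -/
def energy (lam : ℝ) (N : ℕ) (ψ : Pt → ℝ) (t : ℝ) : ℝ :=
  ∑ n ∈ Finset.range (N + 1), ∑ a : Fin n → Fin 8,
    ∫ x : E3, ((1 + t) ^ (2 * lam) *
        ∑ α : Fin 4, (Dop α (GamWord (List.ofFn a) ψ) (t, x)) ^ 2
      + (GamWord (List.ofFn a) ψ (t, x)) ^ 2)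

notation:max "bo" => by omega
notation:max "bp" => by positivity
notation:max "bs" => by simp
notation:max "bl" => by linarith
notation:max "Dx" i:max => Dop (Fin.succ i)
notation "EF" => E3 → ℝ
notation "PF" => Pt → ℝ
notation "W8" => List (Fin 8)
notation "oo" => ((⊤ : ℕ∞) : WithTop ℕ∞)
notation "eor" => ENNReal.ofReal
notation "fs3" => Fin.sum_univ_three
notation:max "qq" e:max x:max => (e ^ 2 + ‖x‖ ^ 2)
lemma mnn {a b : ℝ} (h : 0 ≤ a) (h' : 0 ≤ b) : 0 ≤ a * b := mul_nonneg h h'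
lemma mll {a b c : ℝ} (h : b ≤ c) (h' : 0 ≤ a) : a * b ≤ a * c := mul_le_mul_of_nonneg_left h h'
lemma mlr {a b c : ℝ} (h : b ≤ c) (h' : 0 ≤ a) : b * a ≤ c * a := mul_le_mul_of_nonneg_right h h'
lemma sqn (a : ℝ) : 0 ≤ a ^ 2 := sq_nonneg a
lemma abn (a : ℝ) : 0 ≤ |a| := abs_nonneg a
lemma fsn {ι : Type*} {s : Finset ι} {f : ι → ℝ} (h : ∀ i ∈ s, 0 ≤ f i) : 0 ≤ ∑ i ∈ s, f i := Finset.sum_nonneg h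
lemma fsc {ι β : Type*} [AddCommMonoid β] {s : Finset ι} {f g : ι → β} (h : ∀ i ∈ s, f i = g i) : ∑ i ∈ s, f i = ∑ i ∈ s, g i := Finset.sum_congr rfl h
abbrev Smo (g : EF) : Prop := ContDiff ℝ oo g
abbrev ee (i : Fin 3) : E3 := EuclideanSpace.single i 1
def pd (i : Fin 3) (g : EF) (x : E3) : ℝ := fderiv ℝ g x (ee i)
/-- smooth compactly supported -/
def TF (g : EF) : Prop := Smo g ∧ HasCompactSupport g
lemma Smo.diff {g : EF} (h : Smo g) : Differentiable ℝ g := h.differentiable bs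
lemma Smo.pd {g : EF} (h : Smo g) (i : Fin 3) : Smo (pd i g) := by
  unfold _root_.pd
  exact (h.fderiv_right (m := oo) bs).clm_apply contDiff_const
lemma TF.pd {g : EF} (h : TF g) (i : Fin 3) : TF (pd i g) := by
  refine ⟨h.1.pd i, ?_⟩
  exact h.2.fderiv_apply ℝ (ee i)
lemma TF.mul_left {f g : EF} (hf : Smo f) (h : TF g) : TF (fun x => f x * g x) :=
  ⟨hf.mul h.1, h.2.mul_left⟩
lemma TF.add {f g : EF} (hf : TF f) (h : TF g) : TF (fun x => f x + g x) :=
  ⟨hf.1.add h.1, hf.2.add h.2⟩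
lemma TF.int {g : EF} (h : TF g) : Integrable g := h.1.continuous.integrable_of_hasCompactSupport h.2
lemma TF.sq {g : EF} (h : TF g) : TF (fun x => g x ^ 2) := by
  have := TF.mul_left h.1 h
  simpa [pow_two] using this
lemma pd_mul {f g : EF} (hf : Smo f) (hg : Smo g) (i : Fin 3) (x : E3) :
    pd i (fun x => f x * g x) x = pd i f x * g x + f x * pd i g x := by
  unfold pd
  rw [fderiv_fun_mul (hf.diff x) (hg.diff x)]
  simp; ring
lemma pd_add {f g : EF} (hf : Smo f) (hg : Smo g) (i : Fin 3) (x : E3) :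
    pd i (fun x => f x + g x) x = pd i f x + pd i g x := by
  unfold pd
  rw [fderiv_fun_add (hf.diff x) (hg.diff x)]
  simp
lemma ibp {f g : EF} (hf : Smo f) (hg : TF g) (i : Fin 3) :
    ∫ x, f x * pd i g x = - ∫ x, pd i f x * g x := by
  unfold pd
  apply integral_mul_fderiv_eq_neg_fderiv_mul_of_integrable
  · exact (TF.mul_left (hf.pd i) hg).int
  · exact (TF.mul_left hf (hg.pd i)).int
  · exact (TF.mul_left hf hg).int
  · intro x _; exact hf.diff x
  · intro x _; exact hg.1.diff x
lemma int_pd {g : EF} (hg : TF g) (i : Fin 3) : ∫ x, pd i g x = 0 := by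
  have := ibp (f := fun _ => 1) contDiff_const hg i
  simpa [pd] using this
/-! weights -/
lemma nsq (x : E3) : ‖x‖ ^ 2 = x 0 ^ 2 + x 1 ^ 2 + x 2 ^ 2 := by
  rw [EuclideanSpace.real_norm_sq_eq]; simp [fs3]
lemma smo_coord (i : Fin 3) : Smo (fun x : E3 => x i) := by
  unfold Smo; fun_prop
lemma smo_nsq : Smo (fun x : E3 => ‖x‖ ^ 2) := contDiff_norm_sq ℝ
lemma pd_coord (i j : Fin 3) (x : E3) : pd i (fun x : E3 => x j) x = if i = j then 1 else 0 := by
  unfold pd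
  have : HasFDerivAt (fun x : E3 => x j) (EuclideanSpace.proj j : E3 →L[ℝ] ℝ) x :=
    (EuclideanSpace.proj j : E3 →L[ℝ] ℝ).hasFDerivAt
  rw [this.fderiv]
  simp [ee, eq_comm]
lemma pd_nsq (i : Fin 3) (x : E3) : pd i (fun x : E3 => ‖x‖ ^ 2) x = 2 * x i := by
  unfold pd
  have : HasFDerivAt (fun x : E3 => ‖x‖ ^ 2) (2 • (innerSL ℝ x)) x :=
    (hasStrictFDerivAt_norm_sq x).hasFDerivAt
  rw [this.fderiv]
  simp [ee, EuclideanSpace.inner_single_right]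
lemma qpos {e : ℝ} (he : 0 < e) (x : E3) : 0 < e ^ 2 + ‖x‖ ^ 2 := by positivity
lemma smo_q {e : ℝ} (he : 0 < e) (a : ℝ) : Smo (fun x : E3 => qq e x ^ a) :=
  (contDiff_const.add smo_nsq).rpow_const_of_ne (fun x => (qpos he x).ne')
lemma pd_q {e : ℝ} (he : 0 < e) (a : ℝ) (i : Fin 3) (x : E3) :
    pd i (fun x : E3 => qq e x ^ a) x = 2 * x i * a * qq e x ^ (a - 1) := by
  have h1 : HasFDerivAt (fun x : E3 => e ^ 2 + ‖x‖ ^ 2) (2 • (innerSL ℝ x)) x :=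
    (hasStrictFDerivAt_norm_sq x).hasFDerivAt.const_add _
  have := h1.rpow_const (p := a) (Or.inl (qpos he x).ne')
  unfold pd; rw [this.fderiv]; simp [ee, EuclideanSpace.inner_single_right]; ring
lemma wt_id {e : ℝ} (he : 0 < e) (a : ℝ) {u : EF} (hu : TF u) :
    ∫ x : E3, u x ^ 2 * (3 * qq e x ^ a + 2 * a * ‖x‖ ^ 2 * qq e x ^ (a - 1))
     = ∫ x : E3, ∑ i, - 2 * (u x * pd i u x * (x i * qq e x ^ a)) := by
  have key : ∀ i : Fin 3, ∫ x : E3, (x i * qq e x ^ a) * (2 * (u x * pd i u x)) =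
      - ∫ x : E3, (qq e x ^ a + x i * (2 * x i * a * qq e x ^ (a - 1))) * u x ^ 2 := by
    intro i
    have h := ibp (f := fun x : E3 => x i * qq e x ^ a) ((smo_coord i).mul (smo_q he a)) hu.sq i
    convert h using 2
    · ext x
      have : (fun x => u x ^ 2) = fun x => u x * u x := by ext; ring
      rw [this, pd_mul hu.1 hu.1]; ring
    · congr 1; ext x
      rw [pd_mul (smo_coord i) (smo_q he a), pd_coord, pd_q he]; simp
  have i1 : ∀ i : Fin 3, Integrable (fun x : E3 => - 2 * (u x * pd i u x * (x i * qq e x ^ a))) := by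
    intro i
    have := (TF.mul_left ((smo_coord i).mul (smo_q he a)) (TF.mul_left hu.1 (hu.pd i))).int.const_mul (-2)
    refine this.congr (.of_forall fun x => ?_)
    simp only; ring
  have i2 : ∀ i : Fin 3, Integrable (fun x : E3 => (qq e x ^ a + x i * (2 * x i * a * qq e x ^ (a - 1))) * u x ^ 2) := by
    intro i
    refine (TF.mul_left (f := fun x : E3 => (qq e x ^ a + x i * (2 * x i * a * qq e x ^ (a - 1)))) ?_ hu.sq).int
    have h1 := smo_q he a
    have h2 := smo_q he (a-1)
    have h3 := smo_coord i
    exact h1.add (h3.mul (((contDiff_const.mul h3).mul contDiff_const).mul h2))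
  rw [integral_finsetSum _ (fun i _ => i1 i)]
  have : ∀ i : Fin 3, ∫ x : E3, - 2 * (u x * pd i u x * (x i * qq e x ^ a)) =
     ∫ x : E3, (qq e x ^ a + x i * (2 * x i * a * qq e x ^ (a - 1))) * u x ^ 2 := by
    intro i
    have := key i
    rw [← neg_eq_iff_eq_neg.mpr this, ← integral_neg]
    congr 1; ext x; ring
  rw [fsc (fun i _ => this i), ← integral_finsetSum _ (fun i _ => i2 i)]
  congr 1; ext x
  rw [fs3]; rw [nsq x]; ring
lemma hardy {e : ℝ} (he : 0 < e) {u : EF} (hu : TF u) :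
    ∫ x : E3, u x ^ 2 / qq e x ≤ 4 * ∫ x : E3, ∑ i, pd i u x ^ 2 := by
  have hid := wt_id he (-1) hu
  have hq : ∀ x : E3, qq e x ^ (-1 : ℝ) = (qq e x)⁻¹ := fun x => rpow_neg_one _
  have hq2 : ∀ x : E3, qq e x ^ (-1 - 1 : ℝ) = ((qq e x)⁻¹) ^ 2 := fun x => by
    rw [show (-1 - 1 : ℝ) = -(2 : ℕ) by norm_num, rpow_neg (qpos he x).le, rpow_natCast]
    simp
  have I1 : Integrable (fun x : E3 => u x ^ 2 / qq e x) := by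
    refine ((TF.mul_left (smo_q he (-1)) hu.sq).int).congr (.of_forall fun x => ?_)
    simp only [hq]; field_simp
  have I3 : Integrable (fun x : E3 => ∑ i, pd i u x ^ 2) := integrable_finsetSum _ (fun i _ => (hu.pd i).sq.int)
  have I2 : Integrable (fun x : E3 => u x ^ 2 * (3 * qq e x ^ (-1:ℝ) + 2 * (-1) * ‖x‖ ^ 2 * qq e x ^ (-1 - 1:ℝ))) := by
    have h1 := smo_q he (-1)
    have h2 := smo_q he (-1 - 1)
    refine ((TF.mul_left (f := fun x : E3 => (3 * qq e x ^ (-1:ℝ) + 2 * (-1) * ‖x‖ ^ 2 * qq e x ^ (-1 - 1:ℝ))) ?_ hu.sq).int).congr (.of_forall fun x => ?_)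
    · exact (contDiff_const.mul h1).add ((contDiff_const.mul smo_nsq).mul h2)
    · simp only; ring
  have I4 : Integrable (fun x : E3 => ∑ i, - 2 * (u x * pd i u x * (x i * qq e x ^ (-1:ℝ)))) := by
    refine integrable_finsetSum _ (fun i _ => ?_)
    refine ((TF.mul_left ((smo_coord i).mul (smo_q he (-1))) (TF.mul_left hu.1 (hu.pd i))).int.const_mul (-2)).congr (.of_forall fun x => ?_)
    simp only; ring
  have h1 : ∫ x : E3, u x ^ 2 / qq e x ≤ ∫ x : E3, u x ^ 2 * (3 * qq e x ^ (-1:ℝ) + 2 * (-1) * ‖x‖ ^ 2 * qq e x ^ (-1 - 1:ℝ)) := by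
    refine integral_mono I1 I2 fun x => ?_
    simp only [hq, hq2]
    rw [div_eq_mul_inv]
    apply mll _ (sqn _)
    have hp := qpos he x
    have : ‖x‖ ^ 2 * (qq e x)⁻¹ ≤ 1 := by
      rw [← div_eq_mul_inv, div_le_one hp]; nlinarith
    have h3 : 0 < (qq e x)⁻¹ := inv_pos.mpr hp
    nlinarith
  have h2 : ∫ x : E3, ∑ i, - 2 * (u x * pd i u x * (x i * qq e x ^ (-1:ℝ))) ≤
      ∫ x : E3, ((1/2) * (u x ^ 2 / qq e x) + 2 * ∑ i, pd i u x ^ 2) := by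
    refine integral_mono I4 ((I1.const_mul _).add (I3.const_mul _)) fun x => ?_
    simp only [hq, fs3]
    have hp := qpos he x
    have h3 : 0 < (qq e x)⁻¹ := inv_pos.mpr hp
    set q := (qq e x)⁻¹ with hqd
    have hk : ‖x‖ ^ 2 * q ^ 2 ≤ q := by
      have : ‖x‖ ^ 2 * q ≤ 1 := by
        rw [hqd, ← div_eq_mul_inv, div_le_one hp]; nlinarith
      nlinarith
    have hdq : u x ^ 2 / qq e x = u x ^ 2 * q := div_eq_mul_inv _ _
    rw [hdq]
    rw [nsq x] at hk
    have : u x ^ 2 * ((x 0 ^ 2 + x 1 ^ 2 + x 2 ^ 2) * q ^ 2) ≤ u x ^ 2 * q :=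
      mll hk (sqn _)
    nlinarith [sqn (u x * x 0 * q + 2 * pd 0 u x), sqn (u x * x 1 * q + 2 * pd 1 u x), sqn (u x * x 2 * q + 2 * pd 2 u x)]
  rw [integral_add (I1.const_mul _) (I3.const_mul _), integral_const_mul, integral_const_mul] at h2
  have := h1.trans (hid.le.trans h2)
  linarith
lemma sob_pre {e : ℝ} (he : 0 < e) {u : EF} (hu : TF u) :
    ∫ x : E3, u x ^ 2 * (3 * e ^ 2 * qq e x ^ (-(5/2) : ℝ)) ≤
    4 * (∫ x : E3, ∑ i, pd i u x ^ 2) + 4 * ∑ i, ∫ x : E3, ∑ j, pd j (pd i u) x ^ 2 := by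
  have hid := wt_id he (-(3/2)) hu
  have e1 : ∀ x : E3, u x ^ 2 * (3 * qq e x ^ (-(3/2) : ℝ) + 2 * (-(3/2)) * ‖x‖ ^ 2 * qq e x ^ (-(3/2) - 1 : ℝ)) = u x ^ 2 * (3 * e ^ 2 * qq e x ^ (-(5/2) : ℝ)) := by
    intro x
    have h1 : qq e x ^ (-(3/2) : ℝ) = qq e x ^ (-(5/2) : ℝ) * qq e x := by
      rw [← rpow_add_one (qpos he x).ne']; norm_num
    rw [h1, show (-(3/2) - 1 : ℝ) = -(5/2) by norm_num]; ring
  rw [integral_congr_ae (.of_forall e1)] at hid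
  rw [hid]
  have IQ : ∀ {v : EF}, TF v → Integrable (fun x : E3 => v x ^ 2 / qq e x) := by
    intro v hv
    refine ((TF.mul_left (smo_q he (-1)) hv.sq).int).congr (.of_forall fun x => ?_)
    simp only [rpow_neg_one]; field_simp
  have I4 : Integrable (fun x : E3 => ∑ i, - 2 * (u x * pd i u x * (x i * qq e x ^ (-(3/2):ℝ)))) := by
    refine integrable_finsetSum _ (fun i _ => ?_)
    refine ((TF.mul_left ((smo_coord i).mul (smo_q he (-(3/2)))) (TF.mul_left hu.1 (hu.pd i))).int.const_mul (-2)).congr (.of_forall fun x => ?_)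
    simp only; ring
  have h2 : ∫ x : E3, ∑ i, - 2 * (u x * pd i u x * (x i * qq e x ^ (-(3/2):ℝ))) ≤
      ∫ x : E3, (u x ^ 2 / qq e x + ∑ i, pd i u x ^ 2 / qq e x) := by
    refine integral_mono I4 ((IQ hu).add (integrable_finsetSum _ (fun i _ => IQ (hu.pd i)))) fun x => ?_
    have hp := qpos he x
    have hn := nsq x
    have hq : ‖x‖ ^ 2 * (qq e x)⁻¹ ≤ 1 := by
      rw [← div_eq_mul_inv, div_le_one hp]; nlinarith
    have hs : qq e x ^ (-(3/2):ℝ) = (qq e x)⁻¹ * qq e x ^ (-(1/2):ℝ) := by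
      rw [← rpow_neg_one, ← rpow_add hp]; norm_num
    have hs2 : (qq e x ^ (-(1/2):ℝ)) ^ 2 = (qq e x)⁻¹ := by
      rw [← rpow_natCast, ← rpow_mul hp.le, ← rpow_neg_one]; norm_num
    have hi := inv_pos.mpr hp
    have hd : ∀ a : ℝ, a / qq e x = a * (qq e x ^ (-(1/2):ℝ)) ^ 2 := fun a => by
      rw [hs2, div_eq_mul_inv]
    simp only [hs, fs3, hd]
    rw [← hs2] at hq hi ⊢
    generalize qq e x ^ (-(1/2):ℝ) = s at hq hi ⊢
    rw [hn] at hq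
    have : u x ^ 2 * ((x 0 ^ 2 + x 1 ^ 2 + x 2 ^ 2) * s ^ 2) ≤ u x ^ 2 * 1 :=
      mll hq (sqn _)
    have : s ^ 2 * (u x ^ 2 * ((x 0 ^ 2 + x 1 ^ 2 + x 2 ^ 2) * s ^ 2)) ≤ s ^ 2 * (u x ^ 2 * 1) :=
      mll this (sqn _)
    nlinarith [sqn (s * (u x * x 0 * s + pd 0 u x)), sqn (s * (u x * x 1 * s + pd 1 u x)), sqn (s * (u x * x 2 * s + pd 2 u x))]
  refine h2.trans ?_
  rw [integral_add (IQ hu) (integrable_finsetSum _ (fun i _ => IQ (hu.pd i))), integral_finsetSum _ (fun i _ => IQ (hu.pd i)), Finset.mul_sum]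
  exact add_le_add (hardy he hu) (Finset.sum_le_sum fun i _ => hardy he (hu.pd i))
lemma sob0 : ∃ C > 0, ∀ u : EF, TF u → u 0 ^ 2 ≤
    C * ((∑ i, ∫ x : E3, pd i u x ^ 2) + ∑ i, ∑ j, ∫ x : E3, pd j (pd i u) x ^ 2) := by
  set V := (volume (Metric.ball (0 : E3) 1)).toReal with hV
  have hVpos : 0 < V := ENNReal.toReal_pos (Metric.measure_ball_pos _ _ one_pos).ne' measure_ball_lt_top.ne
  set c := V * (3 / 2 * (2 : ℝ) ^ (-(5/2) : ℝ)) with hc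
  have hcpos : 0 < c := by positivity
  refine ⟨4 / c, by positivity, fun u hu => ?_⟩
  set B := (∑ i, ∫ x : E3, pd i u x ^ 2) + ∑ i, ∑ j, ∫ x : E3, pd j (pd i u) x ^ 2 with hB
  have hB0 : 0 ≤ B := add_nonneg (fsn fun i _ => integral_nonneg fun x => sqn _)
    (fsn fun i _ => fsn fun j _ => integral_nonneg fun x => sqn _)
  by_cases h0 : u 0 = 0
  · rw [h0]; simp only [ne_eq, OfNat.ofNat_ne_zero, not_false_eq_true, zero_pow]; exact mnn bp hB0
  have hu2 : 0 < u 0 ^ 2 := by positivity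
  have hcont : Continuous (fun x => u x ^ 2) := hu.sq.1.continuous
  have hev : ∀ᶠ x in nhds (0 : E3), u 0 ^ 2 / 2 < u x ^ 2 :=
    hcont.continuousAt.eventually_const_lt bl
  obtain ⟨e, he, hball⟩ := Metric.eventually_nhds_iff_ball.mp hev
  have hpre := sob_pre he hu
  rw [integral_finsetSum _ (fun i _ => (hu.pd i).sq.int)] at hpre
  rw [fsc (fun i _ => integral_finsetSum _ (fun j _ => ((hu.pd i).pd j).sq.int)), ← mul_add, ← hB] at hpre
  have I : Integrable (fun x : E3 => u x ^ 2 * (3 * e ^ 2 * qq e x ^ (-(5/2) : ℝ))) := by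
    refine ((TF.mul_left (smo_q he (-(5/2))) hu.sq).int.const_mul (3 * e ^ 2)).congr (.of_forall fun x => ?_)
    simp only; ring
  have h1 : ∫ x in Metric.ball (0 : E3) e, (u 0 ^ 2 / 2 * (3 * e ^ 2 * (2 * e ^ 2) ^ (-(5/2) : ℝ))) ≤
      ∫ x in Metric.ball (0 : E3) e, u x ^ 2 * (3 * e ^ 2 * qq e x ^ (-(5/2) : ℝ)) := by
    refine setIntegral_mono_on (integrableOn_const measure_ball_lt_top.ne) I.integrableOn measurableSet_ball fun x hx => ?_
    have hx' : ‖x‖ < e := by simpa using hx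
    have : ‖x‖ ^ 2 ≤ e ^ 2 := by gcongr
    have h5 : (2 * e ^ 2) ^ (-(5/2) : ℝ) ≤ qq e x ^ (-(5/2) : ℝ) :=
      rpow_le_rpow_of_nonpos (qpos he x) bl (by norm_num)
    have := (hball x hx).le
    gcongr
  have h2 : ∫ x in Metric.ball (0 : E3) e, u x ^ 2 * (3 * e ^ 2 * qq e x ^ (-(5/2) : ℝ)) ≤
      ∫ x : E3, u x ^ 2 * (3 * e ^ 2 * qq e x ^ (-(5/2) : ℝ)) :=
    setIntegral_le_integral I (.of_forall fun x => by positivity)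
  rw [setIntegral_const, smul_eq_mul, measureReal_def, Measure.addHaar_ball _ _ he.le] at h1
  have h3 : (eor (e ^ Module.finrank ℝ E3) * volume (Metric.ball (0:E3) 1)).toReal = e ^ 3 * V := by
    rw [ENNReal.toReal_mul, ENNReal.toReal_ofReal bp]; simp [hV]
  have h4 : (2 * e ^ 2) ^ (-(5/2) : ℝ) = (2:ℝ) ^ (-(5/2) : ℝ) * (e ^ 5)⁻¹ := by
    rw [mul_rpow (by norm_num) bp, ← rpow_natCast e 2, ← rpow_mul he.le, ← rpow_natCast e 5, ← rpow_neg he.le]; norm_num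
  rw [h3, h4] at h1
  have h5 : e ^ 3 * V * (u 0 ^ 2 / 2 * (3 * e ^ 2 * ((2:ℝ) ^ (-(5/2) : ℝ) * (e ^ 5)⁻¹))) = c * u 0 ^ 2 := by
    rw [hc]; field_simp
  rw [h5] at h1
  rw [div_mul_eq_mul_div, le_div_iff₀ hcpos]
  linarith
lemma pd_shift (u : EF) (y : E3) (i : Fin 3) : pd i (fun x => u (x + y)) = fun x => pd i u (x + y) := by
  ext x; unfold pd; rw [fderiv_comp_add_right]
lemma sob : ∃ C > 0, ∀ u : EF, TF u → ∀ y, u y ^ 2 ≤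
    C * ((∑ i, ∫ x : E3, pd i u x ^ 2) + ∑ i, ∑ j, ∫ x : E3, pd j (pd i u) x ^ 2) := by
  obtain ⟨C, hC, h⟩ := sob0
  refine ⟨C, hC, fun u hu y => ?_⟩
  have := h (fun x => u (x + y)) ⟨hu.1.comp (contDiff_id.add contDiff_const), hu.2.comp_homeomorph (Homeomorph.addRight y)⟩
  simp only [pd_shift, zero_add] at this
  have h1 : ∀ f : EF, ∫ x : E3, f (x + y) ^ 2 = ∫ x, f x ^ 2 := fun f => integral_add_right_eq_self (fun x => f x ^ 2) y
  simpa only [h1] using this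
lemma pd_comm {u : EF} (hu : Smo u) (i j : Fin 3) (x : E3) : pd i (pd j u) x = pd j (pd i u) x := by
  have h : ∀ i j, pd i (pd j u) x = fderiv ℝ (fderiv ℝ u) x (ee i) (ee j) := by
    intro i j
    unfold pd
    have hd : DifferentiableAt ℝ (fderiv ℝ u) x := by
      have := (hu.fderiv_right (m := oo) bs)
      exact this.differentiable bs x
    rw [fderiv_clm_apply hd (by fun_prop)]; simp
  rw [h, h]
  have := (hu.contDiffAt (x := x)).isSymmSndFDerivAt (by simp [minSmoothness]; exact WithTop.coe_le_coe.mpr (le_top : (2:ℕ∞) ≤ ⊤))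
  exact this.eq _ _
lemma ell {u : EF} (hu : TF u) (i j : Fin 3) : ∫ x : E3, pd i (pd j u) x ^ 2 = ∫ x : E3, pd i (pd i u) x * pd j (pd j u) x := by
  have h1 := ibp (hu.pd j |>.pd i).1 (hu.pd j) i
  have h2 := ibp (hu.pd i |>.pd i).1 (hu.pd j) j
  have h3 : ∀ x, pd i (pd i (pd j u)) x = pd j (pd i (pd i u)) x := by
    intro x
    rw [← pd_comm (hu.pd i).1]; congr 1; ext y; exact pd_comm hu.1 i j y
  simp only [h3] at h1
  rw [h2, ← h1]; congr 1; ext; ring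
abbrev SS : Type := Metric.sphere (0 : E3) 1
abbrev sig : Measure SS := (volume : Measure E3).toSphere
lemma polar (F : E3 → ENNReal) (hF : Measurable F) :
    ∫⁻ x, F x = ∫⁻ r in Ioi (0:ℝ), eor (r ^ 2) * ∫⁻ w : SS, F (r • (w : E3)) ∂sig := by
  have hmp := Measure.measurePreserving_homeomorphUnitSphereProd (volume : Measure E3)
  have hd : Module.finrank ℝ E3 - 1 = 2 := by simp
  rw [hd] at hmp
  have hG : Measurable (fun q : SS × Ioi (0:ℝ) => F ((q.2 : ℝ) • (q.1 : E3))) := by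
    apply hF.comp; fun_prop
  have h1 := hmp.lintegral_comp hG
  have h2 : ∫⁻ x, F x = ∫⁻ x in ({0}ᶜ : Set E3), F x := by
    rw [restrict_compl_singleton]
  rw [h2, ← lintegral_subtype_comap (measurableSet_singleton (0:E3)).compl]
  have h3 : ∀ a : ({0}ᶜ : Set E3), F ((((homeomorphUnitSphereProd E3) a).2 : ℝ) • (((homeomorphUnitSphereProd E3) a).1 : E3)) = F a := by
    intro a
    congr 1
    have : (homeomorphUnitSphereProd E3).symm ((homeomorphUnitSphereProd E3) a) = a := by simp
    rw [← homeomorphUnitSphereProd_symm_apply_coe, this]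
  simp only [h3] at h1
  rw [h1, lintegral_prod_symm _ hG.aemeasurable, Measure.volumeIoiPow]
  rw [lintegral_withDensity_eq_lintegral_mul]
  · rw [← lintegral_subtype_comap measurableSet_Ioi]; rfl
  · fun_prop
  · exact hG.lintegral_prod_left'
def rot (a b : Fin 3) (f : EF) (x : E3) : ℝ := x a * pd b f x - x b * pd a f x
lemma Smo.rot {f : EF} (hf : Smo f) (a b : Fin 3) : Smo (rot a b f) :=
  ((smo_coord a).mul (hf.pd b)).sub ((smo_coord b).mul (hf.pd a))
/-- cutoffs supported in the annulus -/
def AC (c : EF) : Prop := Smo c ∧ ∀ x : E3, (‖x‖ < 1/2 ∨ 2 < ‖x‖) → c x = 0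
def prj (x : E3) : E3 := ‖x‖⁻¹ • x
lemma smo_ann {f : EF} (h1 : ∀ x ≠ 0, ContDiffAt ℝ oo f x) (h2 : ∀ x : E3, ‖x‖ < 1/2 → f x = 0) : Smo f := by
  rw [Smo, contDiff_iff_contDiffAt]
  intro x
  by_cases hx : x = 0
  · subst hx
    have : f =ᶠ[nhds 0] fun _ => 0 := by
      filter_upwards [Metric.ball_mem_nhds (0:E3) (by norm_num : (0:ℝ) < 1/2)] with y hy
      exact h2 y (by simpa using hy)
    exact contDiffAt_const.congr_of_eventuallyEq this
  · exact h1 x hx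
lemma prj_smooth {x : E3} (hx : x ≠ 0) : ContDiffAt ℝ oo prj x := by
  unfold prj
  exact ((contDiffAt_norm ℝ hx).inv (by simpa using hx)).smul contDiffAt_id
lemma AC.mulG {c : EF} (hc : AC c) {G : EF} (hG : Smo G) : TF (fun x => c x * G (prj x)) := by
  refine ⟨smo_ann (fun x hx => ?_) (fun x hx => ?_), ?_⟩
  · exact hc.1.contDiffAt.mul (hG.contDiffAt.comp x (prj_smooth hx))
  · rw [hc.2 x (Or.inl hx), zero_mul]
  · refine HasCompactSupport.intro (isCompact_closedBall (0:E3) 2) fun x hx => ?_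
    rw [hc.2 x (Or.inr (by simpa using hx)), zero_mul]
lemma AC.pd {c : EF} (hc : AC c) (i : Fin 3) : AC (pd i c) := by
  refine ⟨hc.1.pd i, fun x hx => ?_⟩
  have : c =ᶠ[nhds x] fun _ => 0 := by
    have ho : IsOpen {y : E3 | ‖y‖ < 1/2 ∨ 2 < ‖y‖} :=
      (isOpen_lt continuous_norm continuous_const).union (isOpen_lt continuous_const continuous_norm)
    filter_upwards [ho.mem_nhds hx] with y hy using hc.2 y hy
  unfold _root_.pd; rw [this.fderiv_eq]; simp
lemma AC.nj {c : EF} (hc : AC c) (j : Fin 3) : AC (fun x => c x * (x j / ‖x‖ ^ 2)) := by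
  refine ⟨smo_ann (fun x hx => ?_) (fun x hx => ?_), fun x hx => ?_⟩
  · exact hc.1.contDiffAt.mul ((smo_coord j).contDiffAt.div smo_nsq.contDiffAt (by simpa using hx))
  · rw [hc.2 x (Or.inl hx), zero_mul]
  · simp only [hc.2 x hx, zero_mul]
lemma AC.bdd {c : EF} (hc : AC c) : ∃ K > 0, ∀ x, c x ^ 2 ≤ K := by
  have hcs : HasCompactSupport c := HasCompactSupport.intro (isCompact_closedBall (0:E3) 2) fun x hx => hc.2 x (Or.inr (by simpa using hx))
  obtain ⟨C, hC⟩ := hc.1.continuous.bounded_above_of_compact_support hcs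
  refine ⟨C ^ 2 + 1, by positivity, fun x => ?_⟩
  have := hC x
  have h0 := norm_nonneg (c x)
  rw [norm_eq_abs] at *
  rw [← sq_abs]; nlinarith
lemma pd_prj {G : EF} (hG : Smo G) {x : E3} (hx : x ≠ 0) (i : Fin 3) :
    pd i (fun x => G (prj x)) x = ∑ j, (x j / ‖x‖ ^ 2) * rot j i G (prj x) := by
  have hn : 0 < ‖x‖ := norm_pos_iff.mpr hx
  have h0 : HasFDerivAt (fun x : E3 => ‖x‖ ^ 2) (2 • (innerSL ℝ x)) x :=
    (hasStrictFDerivAt_norm_sq x).hasFDerivAt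
  have h1 := h0.rpow_const (p := -(1/2)) (Or.inl bp)
  have h2 : HasFDerivAt (fun x : E3 => (‖x‖ ^ 2) ^ (-(1/2) : ℝ) • x) _ x := h1.smul (hasFDerivAt_id x)
  have hpe : prj = fun x : E3 => (‖x‖ ^ 2) ^ (-(1/2) : ℝ) • x := by
    ext1 y; unfold prj; congr 1
    rw [← rpow_natCast, ← rpow_mul (norm_nonneg _), ← rpow_neg_one]; norm_num
  rw [← hpe] at h2
  have hd : HasFDerivAt G (fderiv ℝ G (prj x)) (prj x) := (hG.diff _).hasFDerivAt
  have h3 := hd.comp x h2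
  have hs : ((‖x‖ ^ 2) ^ (-(1/2) : ℝ)) = ‖x‖⁻¹ := by
    rw [← rpow_natCast, ← rpow_mul (norm_nonneg _), ← rpow_neg_one]; norm_num
  have hs3 : ((‖x‖ ^ 2) ^ (-(1/2) - 1 : ℝ)) = ‖x‖⁻¹ ^ 3 := by
    rw [← rpow_natCast, ← rpow_mul (norm_nonneg _), ← rpow_natCast (‖x‖⁻¹), inv_rpow (norm_nonneg _), ← rpow_neg (norm_nonneg _)]; norm_num
  have hx3 : x = ∑ j, x j • ee j := by
    ext k; simp [fs3]; fin_cases k <;> simp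
  have hL : fderiv ℝ G (prj x) x = ∑ j, x j * pd j G (prj x) := by
    have := congrArg (fderiv ℝ G (prj x)) hx3
    rw [this, map_sum]; simp [pd]
  change fderiv ℝ (G ∘ prj) x (ee i) = _
  rw [h3.fderiv]
  simp only [ContinuousLinearMap.comp_apply, ContinuousLinearMap.add_apply, ContinuousLinearMap.smul_apply, ContinuousLinearMap.smulRight_apply, map_add, map_smul, hs, hs3, id, ContinuousLinearMap.id_apply]
  rw [hL]
  have e1 : (fderiv ℝ G (prj x)) (ee i) = pd i G (prj x) := rfl
  have e2 : (innerSL ℝ x) (ee i) = x i := by simp [ee, EuclideanSpace.inner_single_right]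
  rw [e1, e2]
  simp only [smul_eq_mul, rot, prj, fs3, PiLp.smul_apply]
  have hnn := nsq x
  have : x 0 ^ 2 = ‖x‖ ^ 2 - x 1 ^ 2 - x 2 ^ 2 := by linarith
  field_simp
  simp only [nsmul_eq_mul]
  rw [hnn]; push_cast; ring
def S0 (G : EF) : ENNReal := ∫⁻ w : SS, eor (G w ^ 2) ∂sig
def S1 (G : EF) : ENNReal := S0 G + ∑ a, ∑ b, S0 (rot a b G)
def S2 (G : EF) : ENNReal := S1 G + ∑ a, ∑ b, S1 (rot a b G)
lemma claim1 {c : EF} (hc : AC c) : ∃ K : ENNReal, K ≠ ⊤ ∧ ∀ G, Smo G →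
    eor (∫ x, (c x * G (prj x)) ^ 2) ≤ K * S0 G := by
  obtain ⟨K, hK, hb⟩ := hc.bdd
  refine ⟨eor 4 * eor K * 2, by finiteness, fun G hG => ?_⟩
  have hT := (hc.mulG hG).sq
  rw [ofReal_integral_eq_lintegral_ofReal hT.int (.of_forall fun x => sqn _)]
  rw [polar _ (hT.1.continuous.measurable.ennreal_ofReal)]
  have hle : ∀ r ∈ Ioi (0:ℝ), eor (r ^ 2) * ∫⁻ w : SS, eor ((c (r • (w:E3)) * G (prj (r • (w:E3)))) ^ 2) ∂sig
      ≤ (Iic (2:ℝ)).indicator (fun _ => eor 4 * eor K * S0 G) r := by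
    intro r hr
    have hr : 0 < r := hr
    have hn : ∀ w : SS, ‖(w : E3)‖ = 1 := fun w => by simp
    by_cases h2 : r ≤ 2
    · rw [indicator_of_mem (by exact h2), mul_assoc]
      refine mul_le_mul' (ENNReal.ofReal_le_ofReal (by nlinarith)) ?_
      rw [S0, ← lintegral_const_mul' _ _ (by finiteness)]
      refine lintegral_mono fun w => ?_
      rw [← ENNReal.ofReal_mul hK.le]
      apply ENNReal.ofReal_le_ofReal
      have : prj (r • (w:E3)) = w := by
        unfold prj; rw [norm_smul, hn, norm_of_nonneg hr.le, smul_smul]; simp [hr.ne']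
      rw [this, mul_pow]
      exact mlr (hb _) (sqn _)
    · rw [indicator_of_notMem (by exact h2)]
      have : ∀ w : SS, c (r • (w:E3)) = 0 := fun w => hc.2 _ (Or.inr (by
        rw [norm_smul, hn, norm_of_nonneg hr.le]; push Not at h2; linarith))
      simp [this]
  refine (setLIntegral_mono' measurableSet_Ioi hle).trans ?_
  rw [lintegral_indicator measurableSet_Iic, Measure.restrict_restrict measurableSet_Iic, lintegral_const]
  have : Iic (2:ℝ) ∩ Ioi 0 = Ioc 0 2 := by ext; simp [and_comm]
  rw [this]; simp
  rw [mul_right_comm]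
lemma pdAC {c : EF} (hc : AC c) {G : EF} (hG : Smo G) (i : Fin 3) (x : E3) :
    pd i (fun x => c x * G (prj x)) x = pd i c x * G (prj x) + ∑ j, (c x * (x j / ‖x‖ ^ 2)) * rot j i G (prj x) := by
  by_cases hx : x = 0
  · subst hx
    have h1 := (hc.pd i).2 0 (Or.inl bs)
    have h2 := hc.2 0 (Or.inl bs)
    rw [h1, h2]
    have : (fun x => c x * G (prj x)) =ᶠ[nhds 0] fun _ => 0 := by
      filter_upwards [Metric.ball_mem_nhds (0:E3) (by norm_num : (0:ℝ) < 1/2)] with y hy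
      rw [hc.2 y (Or.inl (by simpa using hy)), zero_mul]
    unfold pd; rw [this.fderiv_eq]; simp
  · have hd : DifferentiableAt ℝ (fun x => G (prj x)) x :=
      (hG.contDiffAt.comp x (prj_smooth hx)).differentiableAt bs
    have := pd_prj hG hx i
    simp only [mul_assoc, ← Finset.mul_sum]
    rw [← this]
    unfold pd
    rw [fderiv_fun_mul (hc.1.diff x) hd]; simp; ring
lemma S0_le_S1 (G : EF) : S0 G ≤ S1 G := le_self_add
lemma S0rot_le_S1 (G : EF) (a b : Fin 3) : S0 (rot a b G) ≤ S1 G :=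
  le_trans (le_trans (Finset.single_le_sum (f := fun b => S0 (rot a b G)) (fun _ _ => zero_le) (Finset.mem_univ b))
   (Finset.single_le_sum (f := fun a => ∑ b, S0 (rot a b G)) (fun _ _ => zero_le) (Finset.mem_univ a))) le_add_self
lemma S1_le_S2 (G : EF) : S1 G ≤ S2 G := le_self_add
lemma S1rot_le_S2 (G : EF) (a b : Fin 3) : S1 (rot a b G) ≤ S2 G :=
  le_trans (le_trans (Finset.single_le_sum (f := fun b => S1 (rot a b G)) (fun _ _ => zero_le) (Finset.mem_univ b))
   (Finset.single_le_sum (f := fun a => ∑ b, S1 (rot a b G)) (fun _ _ => zero_le) (Finset.mem_univ a))) le_add_self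
lemma four_sq {f0 f1 f2 f3 : EF} (h0 : TF f0) (h1 : TF f1) (h2 : TF f2) (h3 : TF f3) :
    eor (∫ x, (f0 x + (f1 x + f2 x + f3 x)) ^ 2) ≤ 4 * (eor (∫ x, f0 x ^ 2) + eor (∫ x, f1 x ^ 2) + eor (∫ x, f2 x ^ 2) + eor (∫ x, f3 x ^ 2)) := by
  have n : ∀ f : EF, 0 ≤ ∫ x, f x ^ 2 := fun f => integral_nonneg fun x => sqn _
  rw [← ENNReal.ofReal_add (n _) (n _), ← ENNReal.ofReal_add (add_nonneg (n _) (n _)) (n _), ← ENNReal.ofReal_add (add_nonneg (add_nonneg (n _) (n _)) (n _)) (n _)]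
  rw [show (4 : ENNReal) = eor 4 by simp, ← ENNReal.ofReal_mul (by norm_num)]
  apply ENNReal.ofReal_le_ofReal
  have iA : Integrable (fun x => f0 x ^ 2 + f1 x ^ 2) := h0.sq.int.add h1.sq.int
  have iB : Integrable (fun x => f0 x ^ 2 + f1 x ^ 2 + f2 x ^ 2) := iA.add h2.sq.int
  have iC : Integrable (fun x => f0 x ^ 2 + f1 x ^ 2 + f2 x ^ 2 + f3 x ^ 2) := iB.add h3.sq.int
  rw [← integral_add h0.sq.int h1.sq.int, ← integral_add iA h2.sq.int, ← integral_add iB h3.sq.int, ← integral_const_mul]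
  refine integral_mono (h0.add ((h1.add h2).add h3)).sq.int (iC.const_mul 4) fun x => ?_
  dsimp only
  nlinarith [sqn (f0 x - f1 x), sqn (f0 x - f2 x), sqn (f0 x - f3 x), sqn (f1 x - f2 x), sqn (f1 x - f3 x), sqn (f2 x - f3 x)]
lemma claim2 {c : EF} (hc : AC c) (i : Fin 3) : ∃ K : ENNReal, K ≠ ⊤ ∧ ∀ G, Smo G →
    eor (∫ x, (pd i (fun x => c x * G (prj x)) x) ^ 2) ≤ K * S1 G := by
  obtain ⟨K, hK, h⟩ := claim1 (hc.pd i)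
  choose K' hK' h' using fun j => claim1 (hc.nj j)
  refine ⟨4 * (K + K' 0 + K' 1 + K' 2), by have := hK' 0; have := hK' 1; have := hK' 2; finiteness, fun G hG => ?_⟩
  simp only [pdAC hc hG, fs3]
  refine (four_sq ((hc.pd i).mulG hG) ((hc.nj 0).mulG (hG.rot 0 i)) ((hc.nj 1).mulG (hG.rot 1 i)) ((hc.nj 2).mulG (hG.rot 2 i))).trans ?_
  rw [mul_assoc]
  gcongr
  rw [add_mul, add_mul, add_mul]
  gcongr
  · exact (h G hG).trans (by gcongr; exact S0_le_S1 G)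
  · exact (h' 0 _ (hG.rot 0 i)).trans (by gcongr; exact S0rot_le_S1 G _ _)
  · exact (h' 1 _ (hG.rot 1 i)).trans (by gcongr; exact S0rot_le_S1 G _ _)
  · exact (h' 2 _ (hG.rot 2 i)).trans (by gcongr; exact S0rot_le_S1 G _ _)
lemma claim3 {c : EF} (hc : AC c) (i k : Fin 3) : ∃ K : ENNReal, K ≠ ⊤ ∧ ∀ G, Smo G →
    eor (∫ x, (pd k (pd i (fun x => c x * G (prj x))) x) ^ 2) ≤ K * S2 G := by
  obtain ⟨K, hK, h⟩ := claim2 (hc.pd i) k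
  choose K' hK' h' using fun j => claim2 (hc.nj j) k
  refine ⟨4 * (K + K' 0 + K' 1 + K' 2), by have := hK' 0; have := hK' 1; have := hK' 2; finiteness, fun G hG => ?_⟩
  have e : pd i (fun x => c x * G (prj x)) = fun x => pd i c x * G (prj x) + (c x * (x 0 / ‖x‖ ^ 2) * rot 0 i G (prj x) + c x * (x 1 / ‖x‖ ^ 2) * rot 1 i G (prj x) + c x * (x 2 / ‖x‖ ^ 2) * rot 2 i G (prj x)) := by
    ext x; rw [pdAC hc hG, fs3]
  have t0 := (hc.pd i).mulG hG
  have t1 := (hc.nj 0).mulG (hG.rot 0 i)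
  have t2 := (hc.nj 1).mulG (hG.rot 1 i)
  have t3 := (hc.nj 2).mulG (hG.rot 2 i)
  rw [e]
  have e2 : ∀ x, pd k (fun x => pd i c x * G (prj x) + (c x * (x 0 / ‖x‖ ^ 2) * rot 0 i G (prj x) + c x * (x 1 / ‖x‖ ^ 2) * rot 1 i G (prj x) + c x * (x 2 / ‖x‖ ^ 2) * rot 2 i G (prj x))) x = _ := fun x =>
    (pd_add t0.1 ((t1.add t2).add t3).1 k x).trans (congrArg _ ((pd_add (t1.add t2).1 t3.1 k x).trans (congrArg (· + _) (pd_add t1.1 t2.1 k x))))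
  simp only [e2]
  refine (four_sq (t0.pd k) (t1.pd k) (t2.pd k) (t3.pd k)).trans ?_
  rw [mul_assoc]
  gcongr
  rw [add_mul, add_mul, add_mul]
  gcongr
  · exact (h G hG).trans (by gcongr; exact S1_le_S2 G)
  · exact (h' 0 _ (hG.rot 0 i)).trans (by gcongr; exact S1rot_le_S2 G _ _)
  · exact (h' 1 _ (hG.rot 1 i)).trans (by gcongr; exact S1rot_le_S2 G _ _)
  · exact (h' 2 _ (hG.rot 2 i)).trans (by gcongr; exact S1rot_le_S2 G _ _)
lemma exAC : ∃ c, AC c ∧ ∀ x : E3, ‖x‖ = 1 → c x = 1 := by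
  let f : ContDiffBump (1:ℝ) := ⟨1/4, 1/2, by norm_num, by norm_num⟩
  refine ⟨fun x => f (‖x‖ ^ 2), ⟨f.contDiff.comp smo_nsq, fun x hx => ?_⟩, fun x hx => ?_⟩
  · apply f.zero_of_le_dist
    rw [Real.dist_eq]
    have h0 := norm_nonneg x
    rcases hx with h | h
    · rw [abs_sub_comm]; refine le_trans ?_ (le_abs_self _); change (1/2 : ℝ) ≤ _; nlinarith
    · refine le_trans ?_ (le_abs_self _); change (1/2 : ℝ) ≤ _; nlinarith
  · show f (‖x‖ ^ 2) = 1
    rw [hx]; apply f.one_of_mem_closedBall; simp [f]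
lemma sph : ∃ C : ENNReal, C ≠ ⊤ ∧ ∀ G, Smo G → ∀ w : E3, ‖w‖ = 1 → eor (G w ^ 2) ≤ C * S2 G := by
  obtain ⟨c, hc, h1⟩ := exAC
  obtain ⟨C, hC, hs⟩ := sob
  choose K2 hK2 h2 using fun i => claim2 hc i
  choose K3 hK3 h3 using fun i k => claim3 hc i k
  refine ⟨eor C * ((∑ i, K2 i) + ∑ i, ∑ k, K3 i k), ?_, fun G hG w hw => ?_⟩
  · refine ENNReal.mul_ne_top (by finiteness) (ENNReal.add_ne_top.mpr ⟨?_, ?_⟩)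
    · exact ENNReal.sum_ne_top.mpr fun i _ => hK2 i
    · exact ENNReal.sum_ne_top.mpr fun i _ => ENNReal.sum_ne_top.mpr fun k _ => hK3 i k
  have := hs _ (hc.mulG hG) w
  have hp : prj w = w := by unfold prj; simp [hw]
  rw [hp, h1 w hw, one_mul] at this
  have n : ∀ f : EF, 0 ≤ ∫ x, f x ^ 2 := fun f => integral_nonneg fun x => sqn _
  refine (ENNReal.ofReal_le_ofReal this).trans ?_
  rw [ENNReal.ofReal_mul hC.le, mul_assoc]
  gcongr
  rw [ENNReal.ofReal_add (fsn fun i _ => n _) (fsn fun i _ => fsn fun j _ => n _), add_mul, ENNReal.ofReal_sum_of_nonneg (fun i _ => n _), ENNReal.ofReal_sum_of_nonneg (fun i _ => fsn fun j _ => n _), Finset.sum_mul, Finset.sum_mul]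
  gcongr with i _ i _
  · exact (h2 i G hG).trans (by gcongr; exact S1_le_S2 G)
  · rw [ENNReal.ofReal_sum_of_nonneg (fun i _ => n _), Finset.sum_mul]
    gcongr with k _
    exact h3 i k G hG
def R0 (G : EF) : ℝ := ∫ x, G x ^ 2
def R1 (G : EF) : ℝ := R0 G + ∑ a, ∑ b, R0 (rot a b G)
def R2 (G : EF) : ℝ := R1 G + ∑ a, ∑ b, R1 (rot a b G)
lemma R0_nn (G : EF) : 0 ≤ R0 G := integral_nonneg fun x => sqn _
lemma R1_nn (G : EF) : 0 ≤ R1 G :=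
  add_nonneg (R0_nn _) (fsn fun i _ => fsn fun j _ => R0_nn _)
lemma R2_nn (G : EF) : 0 ≤ R2 G :=
  add_nonneg (R1_nn _) (fsn fun i _ => fsn fun j _ => R1_nn _)
lemma TF.rot {f : EF} (hf : TF f) (a b : Fin 3) : TF (rot a b f) := by
  have h1 := TF.mul_left (smo_coord a) (hf.pd b)
  have h2 := TF.mul_left ((contDiff_const (c := (-1:ℝ))).mul (smo_coord b)) (hf.pd a)
  have := h1.add h2
  convert this using 1
  ext x; simp [_root_.rot]; ring
lemma rot_scale {f : EF} (hf : Smo f) (s : ℝ) (a b : Fin 3) :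
    rot a b (fun x => f (s • x)) = fun x => rot a b f (s • x) := by
  have hp : ∀ i x, pd i (fun x => f (s • x)) x = s * pd i f (s • x) := by
    intro i x
    unfold pd
    have h1 : HasFDerivAt (fun x : E3 => s • x) (s • ContinuousLinearMap.id ℝ E3) x :=
      (hasFDerivAt_id x).const_smul s
    have := ((hf.diff (s • x)).hasFDerivAt.comp x h1).fderiv
    change fderiv ℝ (f ∘ fun x => s • x) x (ee i) = _
    rw [this]; simp
  ext x; unfold rot; rw [hp, hp]; simp; ring
lemma Smo.scale {f : EF} (hf : Smo f) (s : ℝ) : Smo (fun x => f (s • x)) :=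
  hf.comp (g := f) (f := fun x : E3 => s • x) (contDiff_id.const_smul s)
lemma meas_S0 {f : EF} (hf : Smo f) : Measurable (fun s : ℝ => eor (s ^ 2) * S0 (fun x => f (s • x))) := by
  have hc := hf.continuous
  have h : Measurable (fun p : ℝ × SS => eor (f (p.1 • (p.2 : E3)) ^ 2)) := by
    have : Continuous (fun p : ℝ × SS => f (p.1 • (p.2 : E3)) ^ 2) := by fun_prop
    exact this.measurable.ennreal_ofReal
  have h2 : Measurable (fun s : ℝ => ∫⁻ w : SS, eor (f (s • (w : E3)) ^ 2) ∂sig) := h.lintegral_prod_right'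
  unfold S0
  fun_prop
lemma int_S0 {f : EF} (hf : TF f) : ∫⁻ s in Ioi (0:ℝ), eor (s ^ 2) * S0 (fun x => f (s • x)) = eor (R0 f) := by
  unfold R0 S0
  rw [ofReal_integral_eq_lintegral_ofReal hf.sq.int (.of_forall fun x => sqn _),
    polar _ (hf.sq.1.continuous.measurable.ennreal_ofReal)]
lemma meas_S1 {f : EF} (hf : Smo f) : Measurable (fun s : ℝ => eor (s ^ 2) * S1 (fun x => f (s • x))) := by
  unfold S1
  simp only [rot_scale hf, mul_add, Finset.mul_sum]
  exact (meas_S0 hf).add (Finset.measurable_fun_sum _ fun a _ => Finset.measurable_fun_sum _ fun b _ => meas_S0 (hf.rot a b))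
lemma int_S1 {f : EF} (hf : TF f) : ∫⁻ s in Ioi (0:ℝ), eor (s ^ 2) * S1 (fun x => f (s • x)) = eor (R1 f) := by
  unfold S1 R1
  simp only [rot_scale hf.1, mul_add, Finset.mul_sum]
  rw [lintegral_add_left (meas_S0 hf.1), lintegral_finsetSum _ (fun a _ => Finset.measurable_fun_sum _ fun b _ => meas_S0 (hf.1.rot a b)), int_S0 hf,
    ENNReal.ofReal_add (R0_nn _) (fsn fun i _ => fsn fun j _ => R0_nn _),
    ENNReal.ofReal_sum_of_nonneg (fun i _ => fsn fun j _ => R0_nn _)]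
  congr 1
  refine fsc fun a _ => ?_
  rw [lintegral_finsetSum _ (fun b _ => meas_S0 (hf.1.rot a b)), ENNReal.ofReal_sum_of_nonneg (fun i _ => R0_nn _)]
  exact fsc fun b _ => int_S0 (hf.rot a b)
lemma int_S2 {f : EF} (hf : TF f) : ∫⁻ s in Ioi (0:ℝ), eor (s ^ 2) * S2 (fun x => f (s • x)) = eor (R2 f) := by
  unfold S2 R2
  simp only [rot_scale hf.1, mul_add, Finset.mul_sum]
  rw [lintegral_add_left (meas_S1 hf.1), lintegral_finsetSum _ (fun a _ => Finset.measurable_fun_sum _ fun b _ => meas_S1 (hf.1.rot a b)), int_S1 hf,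
    ENNReal.ofReal_add (R1_nn _) (fsn fun i _ => fsn fun j _ => R1_nn _),
    ENNReal.ofReal_sum_of_nonneg (fun i _ => fsn fun j _ => R1_nn _)]
  congr 1
  refine fsc fun a _ => ?_
  rw [lintegral_finsetSum _ (fun b _ => meas_S1 (hf.1.rot a b)), ENNReal.ofReal_sum_of_nonneg (fun i _ => R1_nn _)]
  exact fsc fun b _ => int_S1 (hf.rot a b)
lemma Jray : ∃ C > 0, ∀ f, TF f → ∀ w : E3, ‖w‖ = 1 →
    ∫⁻ s in Ioi (0:ℝ), eor (s ^ 2 * f (s • w) ^ 2) ≤ eor (C * R2 f) := by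
  obtain ⟨C, hC, h⟩ := sph
  refine ⟨C.toReal + 1, by positivity, fun f hf w hw => ?_⟩
  calc ∫⁻ s in Ioi (0:ℝ), eor (s ^ 2 * f (s • w) ^ 2)
      ≤ ∫⁻ s in Ioi (0:ℝ), C * (eor (s ^ 2) * S2 (fun x => f (s • x))) := by
        refine lintegral_mono fun s => ?_
        rw [ENNReal.ofReal_mul (sqn _), mul_left_comm]
        gcongr
        exact h _ (hf.1.scale s) w hw
    _ = C * eor (R2 f) := by
        rw [lintegral_const_mul' _ _ hC, int_S2 hf]
    _ ≤ _ := by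
        rw [ENNReal.ofReal_mul bp]
        gcongr
        rw [← ENNReal.ofReal_toReal hC]
        apply ENNReal.ofReal_le_ofReal; simp
lemma ray_ftc {v : EF} (hv : TF v) {w : E3} (hw : ‖w‖ = 1) {r : ℝ} (hr : 0 ≤ r) :
    eor (r ^ 2 * v (r • w) ^ 2) ≤
     ∫⁻ s in Ioi (0:ℝ), (eor (s ^ 2 * v (s • w) ^ 2) + ∑ j, eor (s ^ 2 * pd j v (s • w) ^ 2)) := by
  obtain ⟨R, hR⟩ := hv.2.isCompact.isBounded.exists_norm_le
  set R' := max R r + 1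
  have hrR : r ≤ R' := by simp only [R']; linarith [le_max_right R r]
  have h0 : v (R' • w) = 0 := by
    by_contra hne
    have := hR _ (subset_tsupport _ hne)
    rw [norm_smul, hw, Real.norm_eq_abs] at this
    have := le_abs_self R'
    simp only [R'] at *; linarith [le_max_left R r]
  set vs : ℝ → ℝ := fun s => ∑ j, w j * pd j v (s • w)
  have hd : ∀ s, HasDerivAt (fun s => v (s • w)) (vs s) s := by
    intro s
    have h1 : HasDerivAt (fun s : ℝ => s • w) w s := by simpa using (hasDerivAt_id s).smul_const w
    have := (hv.1.diff (s • w)).hasFDerivAt.comp_hasDerivAt s h1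
    have hwe : w = ∑ j, w j • ee j := by
      ext k; fin_cases k <;> simp [ee, fs3]
    have h2 : fderiv ℝ v (s • w) w = fderiv ℝ v (s • w) (∑ j, w j • ee j) := congrArg _ hwe
    rw [h2, map_sum] at this
    have h3 : vs s = ∑ j, fderiv ℝ v (s • w) (w j • ee j) := by simp [vs, pd]
    rw [h3]; exact this
  have hcv : Continuous v := hv.1.continuous
  have hcp : ∀ j, Continuous (pd j v) := fun j => (hv.pd j).1.continuous
  have hcs : Continuous vs := by simp only [vs]; fun_prop
  have hft := intervalIntegral.integral_eq_sub_of_hasDerivAt (a := r) (b := R') (f := fun s => s ^ 2 * v (s • w) ^ 2)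
    (f' := fun s => 2 * s * v (s • w) ^ 2 + s ^ 2 * (2 * v (s • w) * vs s))
    (fun s _ => by
      have := ((hasDerivAt_id s).pow 2).mul ((hd s).pow 2)
      refine this.congr_deriv ?_; simp)
    (Continuous.intervalIntegrable (by fun_prop) _ _)
  simp only [h0] at hft
  set g : ℝ → ℝ := fun s => s ^ 2 * v (s • w) ^ 2 + ∑ j, s ^ 2 * pd j v (s • w) ^ 2
  have hgc : Continuous g := by simp only [g]; fun_prop
  have hg0 : ∀ s, 0 ≤ g s := fun s => add_nonneg bp (fsn fun j _ => by positivity)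
  have hle : r ^ 2 * v (r • w) ^ 2 ≤ ∫ s in r..R', g s := by
    have : ∫ s in r..R', -(2 * s * v (s • w) ^ 2 + s ^ 2 * (2 * v (s • w) * vs s)) ≤ ∫ s in r..R', g s := by
      refine intervalIntegral.integral_mono_on hrR (Continuous.intervalIntegrable (by fun_prop) _ _) (hgc.intervalIntegrable _ _) fun s hs => ?_
      have hs0 : 0 ≤ s := hr.trans hs.1
      have hcs : vs s ^ 2 ≤ ∑ j, pd j v (s • w) ^ 2 := by
        have := Finset.sum_mul_sq_le_sq_mul_sq Finset.univ (fun j => w j) (fun j => pd j v (s • w))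
        have hw2 : ∑ j, w j ^ 2 = 1 := by
          have := nsq w; rw [hw] at this; simp [fs3]; linarith
        rw [hw2, one_mul] at this
        exact this
      simp only [g, ← Finset.mul_sum]
      have h1 : 0 ≤ s ^ 2 * (v (s • w) + vs s) ^ 2 := by positivity
      have h2 : 0 ≤ s * v (s • w) ^ 2 := by positivity
      nlinarith [mll hcs (sqn s)]
    rw [intervalIntegral.integral_neg, hft] at this
    linarith
  refine (ENNReal.ofReal_le_ofReal hle).trans ?_
  rw [intervalIntegral.integral_of_le hrR, ofReal_integral_eq_lintegral_ofReal (hgc.integrableOn_Ioc) (.of_forall hg0)]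
  refine (lintegral_mono_set (fun s hs => lt_of_le_of_lt hr hs.1 : Ioc r R' ⊆ Ioi 0)).trans ?_
  refine lintegral_mono fun s => ?_
  simp only [g]
  rw [ENNReal.ofReal_add bp (fsn fun j _ => by positivity), ENNReal.ofReal_sum_of_nonneg fun j _ => by positivity]
lemma Wlem : ∃ C > 0, ∀ v, TF v → ∀ x : E3, ‖x‖ ^ 2 * v x ^ 2 ≤ C * (R2 v + ∑ j, R2 (pd j v)) := by
  obtain ⟨C, hC, h⟩ := Jray
  refine ⟨C, hC, fun v hv x => ?_⟩
  by_cases hx : x = 0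
  · subst hx; simp only [norm_zero]; 
    have : 0 ≤ R2 v + ∑ j, R2 (pd j v) := add_nonneg (R2_nn _) (fsn fun j _ => R2_nn _)
    have := mnn hC.le this
    simpa using this
  have hn : ‖x‖ ≠ 0 := by simpa using hx
  have hw : ‖‖x‖⁻¹ • x‖ = 1 := by rw [norm_smul]; simp [hn]
  have := ray_ftc hv hw (norm_nonneg x)
  rw [smul_smul, mul_inv_cancel₀ hn, one_smul] at this
  have hm : ∀ f : EF, TF f → Measurable (fun s : ℝ => eor (s ^ 2 * f (s • ‖x‖⁻¹ • x) ^ 2)) := fun f hf => by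
    have := hf.1.continuous
    have : Continuous (fun s : ℝ => s ^ 2 * f (s • ‖x‖⁻¹ • x) ^ 2) := by fun_prop
    exact this.measurable.ennreal_ofReal
  rw [lintegral_add_left (hm v hv), lintegral_finsetSum _ (fun j _ => hm _ (hv.pd j))] at this
  have h2 := this.trans (add_le_add (h v hv _ hw) (Finset.sum_le_sum fun j _ => h _ (hv.pd j) _ hw))
  rw [← ENNReal.ofReal_sum_of_nonneg (fun j _ => mnn hC.le (R2_nn _)), ← ENNReal.ofReal_add (mnn hC.le (R2_nn _)) (fsn fun j _ => mnn hC.le (R2_nn _))] at h2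
  rw [ENNReal.ofReal_le_ofReal_iff (add_nonneg (mnn hC.le (R2_nn _)) (fsn fun j _ => mnn hC.le (R2_nn _)))] at h2
  rw [mul_add, Finset.mul_sum]; exact h2
def Sm (f : PF) : Prop := ∀ p : Pt, 0 < p.1 → ContDiffAt ℝ oo f p
def vv : Fin 4 → Pt := ![(1, 0), (0, EuclideanSpace.single 0 1), (0, EuclideanSpace.single 1 1), (0, EuclideanSpace.single 2 1)]
def co (α : Fin 4) (p : Pt) : ℝ := ![p.1, p.2 0, p.2 1, p.2 2] α
def cc (k : Fin 8) (α β : Fin 4) : ℝ :=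
  if k = 7 then (if α = β then 1 else 0)
  else if k = 4 then (if α = 2 ∧ β = 3 then 1 else if α = 3 ∧ β = 2 then -1 else 0)
  else if k = 5 then (if α = 3 ∧ β = 1 then 1 else if α = 1 ∧ β = 3 then -1 else 0)
  else if k = 6 then (if α = 1 ∧ β = 2 then 1 else if α = 2 ∧ β = 1 then -1 else 0)
  else 0
def xi (k : Fin 8) (β : Fin 4) (p : Pt) : ℝ :=
  (if (k : ℕ) = (β : ℕ) then 1 else 0) + ∑ α, cc k α β * co α p
lemma Dop_eq (α : Fin 4) (f : PF) (p : Pt) : Dop α f p = fderiv ℝ f p (vv α) := by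
  fin_cases α <;> simp [Dop, vv, dt, dxi]
lemma gam_eq (k : Fin 8) (f : PF) (p : Pt) : Gam k f p = ∑ β, xi k β p * Dop β f p := by
  fin_cases k <;> simp [Gam, Dop, Fin.sum_univ_four, fs3, xi, cc, co] <;> ring
lemma opn : IsOpen {p : Pt | 0 < p.1} := isOpen_lt continuous_const continuous_fst
lemma Sm.diff {f : PF} (hf : Sm f) {p : Pt} (hp : 0 < p.1) : DifferentiableAt ℝ f p :=
  (hf p hp).differentiableAt bs
lemma Sm.D {f : PF} (hf : Sm f) (α : Fin 4) : Sm (Dop α f) := by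
  have : Dop α f = fun p => fderiv ℝ f p (vv α) := funext fun p => Dop_eq α f p
  rw [this]
  intro p hp
  exact ((hf p hp).fderiv_right (m := oo) bs).clm_apply contDiffAt_const
lemma Sm.mul {f g : PF} (hf : Sm f) (hg : Sm g) : Sm (fun p => f p * g p) :=
  fun p hp => (hf p hp).mul (hg p hp)
lemma Sm.add {f g : PF} (hf : Sm f) (hg : Sm g) : Sm (fun p => f p + g p) :=
  fun p hp => (hf p hp).add (hg p hp)
lemma Sm.const (c : ℝ) : Sm (fun _ => c) := fun _ _ => contDiffAt_const
lemma Sm.smul {f : PF} (c : ℝ) (hf : Sm f) : Sm (fun p => c * f p) := (Sm.const c).mul hf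
lemma Sm.sum {ι : Type} (s : Finset ι) {f : ι → PF} (h : ∀ i ∈ s, Sm (f i)) : Sm (fun p => ∑ i ∈ s, f i p) :=
  fun p hp => ContDiffAt.sum fun i hi => h i hi p hp
lemma Sm.congr {f g : PF} (hf : Sm f) (h : ∀ p : Pt, 0 < p.1 → f p = g p) : Sm g := fun p hp =>
  (hf p hp).congr_of_eventuallyEq (by filter_upwards [opn.mem_nhds hp] with q hq using (h q hq).symm)
lemma sm_co (α : Fin 4) : Sm (co α) := by
  intro p _
  have : ContDiff ℝ oo (co α) := by
    have h : ∀ i : Fin 3, ContDiff ℝ oo (fun p : Pt => p.2 i) := fun i =>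
      (smo_coord i).comp contDiff_snd
    fin_cases α
    · exact contDiff_fst
    · exact h 0
    · exact h 1
    · exact h 2
  exact this.contDiffAt
lemma sm_xi (k : Fin 8) (β : Fin 4) : Sm (xi k β) :=
  (Sm.const _).add (Sm.sum _ fun α _ => (Sm.const _).mul (sm_co α))
lemma Sm.gam {f : PF} (hf : Sm f) (k : Fin 8) : Sm (Gam k f) := by
  have : Gam k f = fun p => ∑ β, xi k β p * Dop β f p := funext fun p => gam_eq k f p
  rw [this]
  exact Sm.sum _ fun β _ => (sm_xi k β).mul (hf.D β)
lemma D_congr {f g : PF} (h : ∀ p : Pt, 0 < p.1 → f p = g p) (α : Fin 4) (p : Pt) (hp : 0 < p.1) : Dop α f p = Dop α g p := by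
  rw [Dop_eq, Dop_eq]
  have : f =ᶠ[nhds p] g := by filter_upwards [opn.mem_nhds hp] with q hq using h q hq
  rw [this.fderiv_eq]
lemma gam_congr {f g : PF} (h : ∀ p : Pt, 0 < p.1 → f p = g p) (k : Fin 8) (p : Pt) (hp : 0 < p.1) : Gam k f p = Gam k g p := by
  rw [gam_eq, gam_eq]; simp only [D_congr h _ p hp]
lemma D_mul {f g : PF} (hf : Sm f) (hg : Sm g) (α : Fin 4) (p : Pt) (hp : 0 < p.1) :
    Dop α (fun p => f p * g p) p = Dop α f p * g p + f p * Dop α g p := by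
  simp only [Dop_eq]
  rw [fderiv_fun_mul (hf.diff hp) (hg.diff hp)]; simp; ring
lemma D_add {f g : PF} (hf : Sm f) (hg : Sm g) (α : Fin 4) (p : Pt) (hp : 0 < p.1) :
    Dop α (fun p => f p + g p) p = Dop α f p + Dop α g p := by
  simp only [Dop_eq]
  rw [fderiv_fun_add (hf.diff hp) (hg.diff hp)]; simp
lemma D_const (c : ℝ) (α : Fin 4) (p : Pt) : Dop α (fun _ => c) p = 0 := by simp [Dop_eq]
lemma D_smul {f : PF} (c : ℝ) (hf : Sm f) (α : Fin 4) (p : Pt) (hp : 0 < p.1) :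
    Dop α (fun p => c * f p) p = c * Dop α f p := by
  rw [D_mul (Sm.const c) hf α p hp, D_const]; ring
lemma D_sum {ι : Type} (s : Finset ι) {f : ι → PF} (h : ∀ i ∈ s, Sm (f i)) (α : Fin 4) (p : Pt) (hp : 0 < p.1) :
    Dop α (fun p => ∑ i ∈ s, f i p) p = ∑ i ∈ s, Dop α (f i) p := by
  simp only [Dop_eq]
  rw [fderiv_fun_sum fun i hi => (h i hi).diff hp]; simp
lemma gam_mul {f g : PF} (hf : Sm f) (hg : Sm g) (k : Fin 8) (p : Pt) (hp : 0 < p.1) :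
    Gam k (fun p => f p * g p) p = Gam k f p * g p + f p * Gam k g p := by
  simp only [gam_eq, D_mul hf hg _ p hp, Finset.sum_mul, Finset.mul_sum, ← Finset.sum_add_distrib]
  exact fsc fun β _ => by ring
lemma gam_add {f g : PF} (hf : Sm f) (hg : Sm g) (k : Fin 8) (p : Pt) (hp : 0 < p.1) :
    Gam k (fun p => f p + g p) p = Gam k f p + Gam k g p := by
  simp only [gam_eq, D_add hf hg _ p hp, ← Finset.sum_add_distrib]
  exact fsc fun β _ => by ring
lemma gam_smul {f : PF} (c : ℝ) (hf : Sm f) (k : Fin 8) (p : Pt) (hp : 0 < p.1) :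
    Gam k (fun p => c * f p) p = c * Gam k f p := by
  simp only [gam_eq, D_smul c hf _ p hp, Finset.mul_sum]
  exact fsc fun β _ => by ring
lemma D_comm {f : PF} (hf : Sm f) (α β : Fin 4) (p : Pt) (hp : 0 < p.1) :
    Dop α (Dop β f) p = Dop β (Dop α f) p := by
  have h1 : ∀ γ, Dop γ f = fun p => fderiv ℝ f p (vv γ) := fun γ => funext fun p => Dop_eq γ f p
  rw [h1, h1, Dop_eq, Dop_eq]
  have hd : DifferentiableAt ℝ (fderiv ℝ f) p :=
    ((hf p hp).fderiv_right (m := oo) bs).differentiableAt bs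
  have h2 : ∀ v w : Pt, fderiv ℝ (fun q => fderiv ℝ f q v) p w = fderiv ℝ (fderiv ℝ f) p w v := by
    intro v w
    rw [fderiv_clm_apply hd (by fun_prop)]; simp
  rw [h2, h2]
  have hs : IsSymmSndFDerivAt ℝ f p := (hf p hp).isSymmSndFDerivAt (by simp; exact WithTop.coe_le_coe.mpr le_top)
  exact hs _ _
lemma D_co (α β : Fin 4) (p : Pt) : Dop α (co β) p = if α = β then 1 else 0 := by
  have h0 : fderiv ℝ (co 0) p = ContinuousLinearMap.fst ℝ ℝ E3 := by
    change fderiv ℝ (Prod.fst : PF) p = _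
    exact fderiv_fst
  have h : ∀ i : Fin 3, fderiv ℝ (fun p : Pt => p.2 i) p = (EuclideanSpace.proj i).comp (ContinuousLinearMap.snd ℝ ℝ E3) := fun i =>
    ((EuclideanSpace.proj i : E3 →L[ℝ] ℝ).comp (ContinuousLinearMap.snd ℝ ℝ E3)).fderiv
  have h1 : fderiv ℝ (co 1) p = _ := h 0
  have h2 : fderiv ℝ (co 2) p = _ := h 1
  have h3 : fderiv ℝ (co 3) p = _ := h 2
  rw [Dop_eq]
  fin_cases β
  · change fderiv ℝ (co 0) p _ = _
    rw [h0]; fin_cases α <;> simp [vv]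
  · change fderiv ℝ (co 1) p _ = _
    rw [h1]; fin_cases α <;> simp [vv]
  · change fderiv ℝ (co 2) p _ = _
    rw [h2]; fin_cases α <;> simp [vv]
  · change fderiv ℝ (co 3) p _ = _
    rw [h3]; fin_cases α <;> simp [vv]
lemma D_xi (k : Fin 8) (α β : Fin 4) (p : Pt) (hp : 0 < p.1) : Dop α (xi k β) p = cc k α β := by
  unfold xi
  rw [D_add (Sm.const _) (Sm.sum _ fun α _ => (Sm.const _).mul (sm_co α)) α p hp, D_const,
    D_sum _ (fun α _ => (Sm.const _).mul (sm_co α)) α p hp]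
  simp only [D_smul _ (sm_co _) α p hp, D_co]
  simp
lemma D_gam {f : PF} (hf : Sm f) (k : Fin 8) (α : Fin 4) (p : Pt) (hp : 0 < p.1) :
    Dop α (Gam k f) p = Gam k (Dop α f) p + ∑ β, cc k α β * Dop β f p := by
  have : Gam k f = fun p => ∑ β, xi k β p * Dop β f p := funext fun p => gam_eq k f p
  rw [this, D_sum _ (fun β _ => (sm_xi k β).mul (hf.D β)) α p hp, gam_eq, ← Finset.sum_add_distrib]
  refine fsc fun β _ => ?_
  rw [D_mul (sm_xi k β) (hf.D β) α p hp, D_xi k α β p hp, D_comm hf α β p hp]; ring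
lemma box_eq (f : PF) (p : Pt) : box f p = Dop 0 (Dop 0 f) p - Dop 1 (Dop 1 f) p - Dop 2 (Dop 2 f) p - Dop 3 (Dop 3 f) p := by
  unfold box; simp [Dop, fs3]; change dt (dt f) p - (dxi 0 (dxi 0 f) p + dxi 1 (dxi 1 f) p + dxi 2 (dxi 2 f) p) = _; ring
lemma box_congr {f g : PF} (h : ∀ p : Pt, 0 < p.1 → f p = g p) (p : Pt) (hp : 0 < p.1) : box f p = box g p := by
  simp only [box_eq, D_congr (fun q hq => D_congr h _ q hq) _ p hp]
lemma DD_gam {f : PF} (hf : Sm f) (k : Fin 8) (α : Fin 4) (p : Pt) (hp : 0 < p.1) :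
    Dop α (Dop α (Gam k f)) p = Gam k (Dop α (Dop α f)) p + 2 * ∑ β, cc k α β * Dop α (Dop β f) p := by
  rw [D_congr (D_gam hf k α) α p hp, D_add ((hf.D α).gam k) (Sm.sum _ fun β _ => (hf.D β).smul _) α p hp,
    D_gam (hf.D α) k α p hp, D_sum _ (fun β _ => (hf.D β).smul _) α p hp]
  simp only [D_smul _ (hf.D _) α p hp, D_comm hf _ α p hp]
  ring
lemma Sm.box {f : PF} (hf : Sm f) : Sm (box f) := by
  have h := fun α => (hf.D α).D α
  have := (((h 0).add ((h 1).smul (-1))).add ((h 2).smul (-1))).add ((h 3).smul (-1))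
  exact this.congr fun p _ => by rw [box_eq]; ring
lemma gam_box {f : PF} (hf : Sm f) (k : Fin 8) (p : Pt) (hp : 0 < p.1) :
    Gam k (box f) p = box (Gam k f) p - (if k = 7 then 2 else 0) * box f p := by
  have h := fun α => (hf.D α).D α
  have e : ∀ p : Pt, 0 < p.1 → box f p = ((Dop 0 (Dop 0 f) p + (-1) * Dop 1 (Dop 1 f) p) + (-1) * Dop 2 (Dop 2 f) p) + (-1) * Dop 3 (Dop 3 f) p :=
    fun p _ => by rw [box_eq]; ring
  rw [gam_congr e k p hp, gam_add (((h 0).add ((h 1).smul (-1))).add ((h 2).smul (-1))) ((h 3).smul (-1)) k p hp,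
    gam_add ((h 0).add ((h 1).smul (-1))) ((h 2).smul (-1)) k p hp, gam_add (h 0) ((h 1).smul (-1)) k p hp,
    gam_smul _ (h 1) k p hp, gam_smul _ (h 2) k p hp, gam_smul _ (h 3) k p hp, box_eq (Gam k f) p, e p hp]
  simp only [DD_gam hf k _ p hp, Fin.sum_univ_four]
  have c10 := D_comm hf 1 0 p hp
  have c20 := D_comm hf 2 0 p hp
  have c30 := D_comm hf 3 0 p hp
  have c21 := D_comm hf 2 1 p hp
  have c31 := D_comm hf 3 1 p hp
  have c32 := D_comm hf 3 2 p hp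
  rw [c10, c20, c30, c21, c31, c32]
  fin_cases k <;> simp [cc] <;> ring
lemma box_add {f g : PF} (hf : Sm f) (hg : Sm g) (p : Pt) (hp : 0 < p.1) :
    box (fun p => f p + g p) p = box f p + box g p := by
  simp only [box_eq, D_congr (D_add hf hg _) _ p hp, D_add (hf.D _) (hg.D _) _ p hp]; ring
lemma box_smul {f : PF} (c : ℝ) (hf : Sm f) (p : Pt) (hp : 0 < p.1) :
    box (fun p => c * f p) p = c * box f p := by
  simp only [box_eq, D_congr (D_smul c hf _) _ p hp, D_smul c (hf.D _) _ p hp]; ring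
def Supp (M : ℝ) (f : PF) : Prop := ∀ p : Pt, 0 < p.1 → p.1 + M < ‖p.2‖ → f p = 0
def SF (M : ℝ) (f : PF) : Prop := Sm f ∧ Supp M f
lemma Supp.D {M : ℝ} {f : PF} (hf : Supp M f) (α : Fin 4) : Supp M (Dop α f) := by
  intro p hp h
  have : f =ᶠ[nhds p] fun _ => 0 := by
    have ho : IsOpen {p : Pt | p.1 + M < ‖p.2‖} := isOpen_lt (by fun_prop) (by fun_prop)
    filter_upwards [opn.mem_nhds hp, ho.mem_nhds h] with q h1 h2 using hf q h1 h2
  rw [Dop_eq, this.fderiv_eq]; simp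
lemma SF.D {M : ℝ} {f : PF} (hf : SF M f) (α : Fin 4) : SF M (Dop α f) := ⟨hf.1.D α, hf.2.D α⟩
lemma SF.gam {M : ℝ} {f : PF} (hf : SF M f) (k : Fin 8) : SF M (Gam k f) :=
  ⟨hf.1.gam k, fun p hp h => by rw [gam_eq]; exact Finset.sum_eq_zero fun β _ => by rw [hf.2.D β p hp h, mul_zero]⟩
lemma SF.mulL {M : ℝ} {f g : PF} (hg : Sm g) (hf : SF M f) : SF M (fun p => g p * f p) :=
  ⟨hg.mul hf.1, fun p hp h => by simp only [hf.2 p hp h, mul_zero]⟩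
lemma SF.mulR {M : ℝ} {f g : PF} (hf : SF M f) (hg : Sm g) : SF M (fun p => f p * g p) :=
  ⟨hf.1.mul hg, fun p hp h => by simp only [hf.2 p hp h, zero_mul]⟩
lemma SF.add {M : ℝ} {f g : PF} (hf : SF M f) (hg : SF M g) : SF M (fun p => f p + g p) :=
  ⟨hf.1.add hg.1, fun p hp h => by simp only [hf.2 p hp h, hg.2 p hp h, zero_add]⟩
lemma SF.smul {M : ℝ} {f : PF} (c : ℝ) (hf : SF M f) : SF M (fun p => c * f p) := SF.mulL (Sm.const c) hf
lemma SF.congr {M : ℝ} {f g : PF} (hf : SF M f) (h : ∀ p : Pt, 0 < p.1 → f p = g p) : SF M g :=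
  ⟨hf.1.congr h, fun p hp hh => by rw [← h p hp]; exact hf.2 p hp hh⟩
lemma SF.sum {M : ℝ} {ι : Type} (s : Finset ι) {f : ι → PF} (h : ∀ i ∈ s, SF M (f i)) : SF M (fun p => ∑ i ∈ s, f i p) :=
  ⟨Sm.sum s fun i hi => (h i hi).1, fun p hp hh => Finset.sum_eq_zero fun i hi => (h i hi).2 p hp hh⟩
lemma SF.box {M : ℝ} {f : PF} (hf : SF M f) : SF M (box f) :=
  ⟨hf.1.box, fun p hp h => by
    rw [box_eq]; simp only [((hf.2.D _).D _) p hp h]; ring⟩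
lemma Sm.slice {f : PF} (hf : Sm f) {t : ℝ} (ht : 0 < t) : Smo (fun x => f (t, x)) := by
  rw [Smo, contDiff_iff_contDiffAt]
  intro x
  exact (hf (t, x) ht).comp x (contDiffAt_const.prodMk contDiffAt_id)
lemma SF.slice {M : ℝ} {f : PF} (hf : SF M f) {t : ℝ} (ht : 0 < t) : TF (fun x => f (t, x)) := by
  refine ⟨hf.1.slice ht, HasCompactSupport.of_support_subset_isCompact (isCompact_closedBall (0 : E3) (t + M)) fun x hx => ?_⟩
  rw [mem_closedBall_zero_iff]
  by_contra h
  push Not at h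
  exact hx (hf.2 (t, x) ht h)
lemma slice_pd {f : PF} (hf : Sm f) {t : ℝ} (ht : 0 < t) (i : Fin 3) (x : E3) :
    pd i (fun x => f (t, x)) x = Dx i f (t, x) := by
  have h1 : HasFDerivAt (fun x : E3 => ((t, x) : Pt)) (ContinuousLinearMap.inr ℝ ℝ E3) x := hasFDerivAt_prodMk_right t x
  have := ((hf.diff (p := (t, x)) ht).hasFDerivAt.comp x h1).fderiv
  unfold pd
  change fderiv ℝ (f ∘ fun x => (t, x)) x (ee i) = _
  rw [this, Dop_eq]
  fin_cases i <;> simp [vv, ee]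
lemma slice_pd' {f : PF} (hf : Sm f) {t : ℝ} (ht : 0 < t) (i : Fin 3) :
    pd i (fun x => f (t, x)) = fun x => Dx i f (t, x) := funext fun x => slice_pd hf ht i x
lemma ibpS {M : ℝ} {f g : PF} (hf : Sm f) (hg : SF M g) {t : ℝ} (ht : 0 < t) (i : Fin 3) :
    ∫ x, f (t, x) * Dx i g (t, x) = - ∫ x, Dx i f (t, x) * g (t, x) := by
  have := ibp (hf.slice ht) (hg.slice ht) i
  rw [slice_pd' hg.1 ht, slice_pd' hf ht] at this
  exact this
lemma dInt {M : ℝ} {f : PF} (hf : SF M f) {t : ℝ} (ht : 0 < t) :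
    HasDerivAt (fun s => ∫ x, f (s, x)) (∫ x, Dop 0 f (t, x)) t := by
  set K : Set Pt := Icc (t / 2) (2 * t) ×ˢ Metric.closedBall (0 : E3) (2 * t + M)
  have hK : IsCompact K := isCompact_Icc.prod (isCompact_closedBall _ _)
  have hcon : ContinuousOn (Dop 0 f) K := fun p hp =>
    ((hf.1.D 0) p (by have := hp.1.1; linarith)).continuousAt.continuousWithinAt
  obtain ⟨C, hC⟩ := hK.exists_bound_of_continuousOn hcon
  refine (hasDerivAt_integral_of_dominated_loc_of_deriv_le (F := fun s x => f (s, x)) (F' := fun s x => Dop 0 f (s, x))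
    (s := Ioo (t / 2) (2 * t)) (bound := (Metric.closedBall (0 : E3) (2 * t + M)).indicator fun _ => C)
    (Ioo_mem_nhds bl bl) ?_ (hf.slice ht).int ((hf.D 0).slice ht).int.aestronglyMeasurable ?_ ?_ ?_).2
  · filter_upwards [lt_mem_nhds ht] with s hs using (hf.slice hs).int.aestronglyMeasurable
  · refine .of_forall fun x s hs => ?_
    by_cases hx : x ∈ Metric.closedBall (0 : E3) (2 * t + M)
    · rw [indicator_of_mem hx]; exact hC (s, x) ⟨⟨hs.1.le, hs.2.le⟩, hx⟩
    · rw [indicator_of_notMem hx, (hf.2.D 0) (s, x) (by simp only; linarith [hs.1]) (by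
        rw [mem_closedBall_zero_iff] at hx; push Not at hx; simp only; linarith [hs.2])]; simp
  · exact (integrable_indicator_iff Metric.isClosed_closedBall.measurableSet).2 (integrableOn_const (by exact (isCompact_closedBall _ _).measure_lt_top.ne))
  · refine .of_forall fun x s hs => ?_
    have h1 : HasDerivAt (fun s : ℝ => ((s, x) : Pt)) ((1, 0) : Pt) s := (hasDerivAt_id s).prodMk (hasDerivAt_const s x)
    have := (hf.1.diff (p := (s, x)) (by simp only; linarith [hs.1])).hasFDerivAt.comp_hasDerivAt s h1
    exact this
lemma ks {u : PF} (hu : Sm u) (p : Pt) (hp : 0 < p.1) :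
    ((1 + p.1) ^ 2 - ‖p.2‖ ^ 2) * Dop 0 (Dop 0 u) p =
      (1 + p.1) * (Dop 0 (Gam 7 u) p + Dop 0 (Dop 0 u) p) - (∑ i : Fin 3, p.2 i * (Dx i (Gam 7 u) p + Dx i (Dop 0 u) p))
      - (Gam 4 (Gam 4 u) p + Gam 5 (Gam 5 u) p + Gam 6 (Gam 6 u) p) - (1 + p.1) * Dop 0 u p - (∑ i : Fin 3, p.2 i * Dx i u p)
      - ‖p.2‖ ^ 2 * box u p := by
  rw [nsq, box_eq]
  rw [gam_eq 4 (Gam 4 u), gam_eq 5 (Gam 5 u), gam_eq 6 (Gam 6 u)]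
  simp only [D_gam hu _ _ p hp, gam_eq]
  have c10 := D_comm hu 1 0 p hp
  have c20 := D_comm hu 2 0 p hp
  have c30 := D_comm hu 3 0 p hp
  have c21 := D_comm hu 2 1 p hp
  have c31 := D_comm hu 3 1 p hp
  have c32 := D_comm hu 3 2 p hp
  simp only [Fin.sum_univ_four, fs3]
  have s0 : (0 : Fin 3).succ = 1 := rfl
  have s1 : (1 : Fin 3).succ = 2 := rfl
  have s2 : (2 : Fin 3).succ = 3 := rfl
  rw [s0, s1, s2]
  rw [c10, c20, c30, c21, c31, c32]
  simp [xi, cc, co, Fin.sum_univ_four]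
  ring
lemma sm_w (s : ℝ) : Sm (fun p => (1 + p.1) ^ s) := by
  intro p hp
  exact (contDiffAt_const.add contDiffAt_fst).rpow_const_of_ne bl
lemma D_w (s : ℝ) (p : Pt) (hp : 0 < p.1) (α : Fin 4) : Dop α (fun p => (1 + p.1) ^ s) p = if α = 0 then s * (1 + p.1) ^ (s - 1) else 0 := by
  have h1 : HasFDerivAt (fun p : Pt => 1 + p.1) (ContinuousLinearMap.fst ℝ ℝ E3) p := (hasFDerivAt_fst).const_add 1
  have := h1.rpow_const (p := s) (Or.inl bl)
  rw [Dop_eq, this.fderiv]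
  fin_cases α <;> simp [vv]
lemma gam_w (s : ℝ) (p : Pt) (hp : 0 < p.1) (k : Fin 8) : Gam k (fun p => (1 + p.1) ^ s) p =
    (if k = 0 then s else if k = 7 then -s else 0) * (1 + p.1) ^ (s - 1) + (if k = 7 then s else 0) * (1 + p.1) ^ s := by
  rw [gam_eq]; simp only [D_w s p hp]
  have : (1 + p.1) ^ s = (1 + p.1) ^ (s - 1) * (1 + p.1) := by
    rw [rpow_sub_one bl]; field_simp
  rw [this]
  fin_cases k <;> simp [xi, cc, co, Fin.sum_univ_four] <;> ring
section
structure Prm where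
  μ : ℝ
  lam : ℝ
  γ : ℝ
  M : ℝ
  N : ℕ
  hμ : 0 < μ
  hlam0 : 0 < lam
  hlam1 : lam ≤ 1
  hγ : 1 < γ
  hM : 0 < M
  hN : 8 ≤ N
structure Adm (P : Prm) (ψ : PF) : Prop where
  sm : ContDiff ℝ (⊤ : ℕ∞) ψ
  supp : ∀ t : ℝ, 0 ≤ t → ∀ x : E3, t + P.M < ‖x‖ → ψ (t, x) = 0
  eq : psiEq P.μ P.lam P.γ ψ
abbrev Op : Type := (PF) → PF
def G (l : W8) : Op := fun ψ => GamWord l ψ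
def w (s : ℝ) : Op := fun _ p => (1 + p.1) ^ s
def gO (k : Fin 8) (A : Op) : Op := fun ψ => Gam k (A ψ)
def cs (α : Fin 4) : Fin 8 := Fin.castLE (by norm_num) α
lemma gam_cs (α : Fin 4) : Gam (cs α) = Dop α := by fin_cases α <;> rfl
lemma G_cs (α : Fin 4) (l : W8) (ψ : PF) : G (cs α :: l) ψ = Dop α (G l ψ) := by
  change Gam (cs α) (G l ψ) = _; rw [gam_cs]
variable {P : Prm}
lemma Adm.sf {ψ : PF} (h : Adm P ψ) : SF P.M ψ :=
  ⟨fun p _ => h.sm.contDiffAt, fun p hp hh => h.supp p.1 hp.le p.2 hh⟩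
lemma Adm.g {ψ : PF} (h : Adm P ψ) (l : W8) : SF P.M (G l ψ) := by
  induction l with
  | nil => exact h.sf
  | cons k l ih => exact ih.gam k
def SO (P : Prm) (A : Op) : Prop := ∀ ψ, Adm P ψ → Sm (A ψ)
def Eqv (P : Prm) (A B : Op) : Prop := ∀ ψ, Adm P ψ → ∀ p : Pt, 0 < p.1 → A ψ p = B ψ p
inductive Sp (P : Prm) (S : Set Op) : Op → Prop
  | of (A : Op) : A ∈ S → Sp P S A
  | zero : Sp P S 0
  | add (A B : Op) : Sp P S A → Sp P S B → Sp P S (A + B)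
  | smul (c : ℝ) (A : Op) : Sp P S A → Sp P S (c • A)
  | congr (A B : Op) : Eqv P A B → Sp P S A → Sp P S B
lemma Sp.bind {S S' : Set Op} (h : ∀ A ∈ S, Sp P S' A) {A : Op} (hA : Sp P S A) : Sp P S' A := by
  induction hA with
  | of A hA => exact h A hA
  | zero => exact .zero
  | add A B _ _ h1 h2 => exact .add _ _ h1 h2
  | smul c A _ h => exact .smul _ _ h
  | congr A B e _ h => exact .congr _ _ e h
lemma Sp.mono {S S' : Set Op} (h : S ⊆ S') {A : Op} (hA : Sp P S A) : Sp P S' A :=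
  hA.bind fun A hA => .of _ (h hA)
lemma Sp.sum {S : Set Op} {ι : Type} (s : Finset ι) {f : ι → Op} (h : ∀ i ∈ s, Sp P S (f i)) : Sp P S (∑ i ∈ s, f i) :=
  Finset.sum_induction f (Sp P S) (fun _ _ => .add _ _) .zero h
lemma Sp.so {S : Set Op} (h : ∀ A ∈ S, SO P A) {A : Op} (hA : Sp P S A) : SO P A := by
  induction hA with
  | of A hA => exact h A hA
  | zero => exact fun ψ _ => Sm.const 0
  | add A B _ _ h1 h2 => exact fun ψ hψ => (h1 ψ hψ).add (h2 ψ hψ)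
  | smul c A _ h => exact fun ψ hψ => (h ψ hψ).smul c
  | congr A B e _ h => exact fun ψ hψ => (h ψ hψ).congr (e ψ hψ)
lemma Sp.sf {S : Set Op} (h : ∀ A ∈ S, ∀ ψ, Adm P ψ → SF P.M (A ψ)) {A : Op} (hA : Sp P S A) : ∀ ψ, Adm P ψ → SF P.M (A ψ) := by
  induction hA with
  | of A hA => exact h A hA
  | zero => exact fun ψ _ => ⟨Sm.const 0, fun p _ _ => rfl⟩
  | add A B _ _ h1 h2 => exact fun ψ hψ => (h1 ψ hψ).add (h2 ψ hψ)
  | smul c A _ h => exact fun ψ hψ => (h ψ hψ).smul c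
  | congr A B e _ h => exact fun ψ hψ => (h ψ hψ).congr (e ψ hψ)
lemma Sp.gam {S S' : Set Op} (k : Fin 8) (h : ∀ A ∈ S, SO P A) (h' : ∀ A ∈ S, Sp P S' (gO k A)) {A : Op} (hA : Sp P S A) :
    Sp P S' (gO k A) := by
  induction hA with
  | of A hA => exact h' A hA
  | zero =>
    refine .congr 0 _ (fun ψ _ p _ => ?_) .zero
    change 0 = Gam k (fun _ => 0) p
    rw [gam_eq]; simp [D_const]
  | add A B hA hB h1 h2 =>
    refine .congr _ _ (fun ψ hψ p hp => ?_) (.add _ _ h1 h2)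
    exact (gam_add (hA.so h ψ hψ) (hB.so h ψ hψ) k p hp).symm
  | smul c A hA ih =>
    refine .congr _ _ (fun ψ hψ p hp => ?_) (.smul c _ ih)
    exact (gam_smul c (hA.so h ψ hψ) k p hp).symm
  | congr A B e hA ih =>
    exact .congr _ _ (fun ψ hψ p hp => gam_congr (e ψ hψ) k p hp) ih
lemma Sp.mul {S S' S'' : Set Op} (h : ∀ A ∈ S, ∀ B ∈ S', Sp P S'' (A * B)) {A B : Op} (hA : Sp P S A) (hB : Sp P S' B) :
    Sp P S'' (A * B) := by
  induction hA with
  | of A hA =>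
    induction hB with
    | of B hB => exact h A hA B hB
    | zero => exact .congr 0 _ (fun ψ _ p _ => (mul_zero (A ψ p)).symm) .zero
    | add B C _ _ h1 h2 => exact .congr _ _ (fun ψ _ p _ => (mul_add (A ψ p) _ _).symm) (.add _ _ h1 h2)
    | smul c B _ h => exact .congr _ _ (fun ψ _ p _ => (mul_left_comm (A ψ p) c _).symm) (.smul c _ h)
    | congr B C e _ h => exact .congr _ _ (fun ψ hψ p hp => congrArg (A ψ p * ·) (e ψ hψ p hp)) h
  | zero => exact .congr 0 _ (fun ψ _ p _ => (zero_mul (B ψ p)).symm) .zero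
  | add A C _ _ h1 h2 => exact .congr _ _ (fun ψ _ p _ => (add_mul (A ψ p) _ _).symm) (.add _ _ h1 h2)
  | smul c A _ h => exact .congr _ _ (fun ψ _ p _ => (mul_assoc c (A ψ p) _).symm) (.smul c _ h)
  | congr A C e _ h => exact .congr _ _ (fun ψ hψ p hp => congrArg (· * B ψ p) (e ψ hψ p hp)) h
def GG (n : ℕ) : Set Op := {A | ∃ l : W8, l.length < n ∧ A = G l}
def DG (n : ℕ) : Set Op := {A | ∃ (α : Fin 4) (l : W8), l.length < n ∧ A = G (cs α :: l)}
def Sg (n : ℕ) : Set Op := {A | ∃ (α β : Fin 4) (l : W8), l.length ≤ n ∧ A = G (cs α :: cs β :: l)}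
def Wt (I : ℝ) (S : Set Op) : Set Op := {A | ∃ s B, s ≤ I ∧ B ∈ S ∧ A = w s * B}
def Pr (S S' : Set Op) : Set Op := {A | ∃ B C, B ∈ S ∧ C ∈ S' ∧ A = B * C}
def Fg (P : Prm) (b : ℕ) : Set Op := Wt 0 (GG (b + 1)) ∪ Wt P.lam (DG (b + 1))
def EE (n : ℕ) : Set Op := Wt (-1) (DG n) ∪ Wt (-2) (GG n)
def Rm (P : Prm) (n c : ℕ) : Set Op :=
  {A | ∃ b c', b + c' ≤ n ∧ c' < c ∧ A ∈ Pr (Fg P b) (Sg c')} ∪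
  {A | ∃ b b' c', b + b' + c' ≤ n ∧ c' < c ∧ A ∈ Pr (Pr (Fg P b) (Fg P b')) (Sg c')} ∪
  {A | ∃ b c', b + c' ≤ n ∧ A ∈ Pr (Wt 0 (DG (b + 1))) (DG (c' + 1))}
/-- class with support -/
def Gd (P : Prm) (S : Set Op) : Prop := ∀ A ∈ S, ∀ ψ, Adm P ψ → SF P.M (A ψ)
lemma Gd.so {S : Set Op} (h : Gd P S) : ∀ A ∈ S, SO P A := fun A hA ψ hψ => (h A hA ψ hψ).1
lemma gd_GG (n : ℕ) : Gd P (GG n) := by rintro _ ⟨l, _, rfl⟩ ψ hψ; exact hψ.g l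
lemma gd_DG (n : ℕ) : Gd P (DG n) := by rintro _ ⟨_, l, _, rfl⟩ ψ hψ; exact hψ.g _
lemma gd_Sg (n : ℕ) : Gd P (Sg n) := by rintro _ ⟨_, _, l, _, rfl⟩ ψ hψ; exact hψ.g _
lemma so_w (s : ℝ) : SO P (w s) := fun _ _ => sm_w s
lemma Gd.wt {S : Set Op} (h : Gd P S) (I : ℝ) : Gd P (Wt I S) := by
  rintro _ ⟨s, B, _, hB, rfl⟩ ψ hψ; exact SF.mulL (sm_w s) (h B hB ψ hψ)
lemma Gd.pr {S S' : Set Op} (h : Gd P S) (h' : Gd P S') : Gd P (Pr S S') := by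
  rintro _ ⟨B, C, hB, hC, rfl⟩ ψ hψ; exact SF.mulL (h B hB ψ hψ).1 (h' C hC ψ hψ)
lemma Gd.union {S S' : Set Op} (h : Gd P S) (h' : Gd P S') : Gd P (S ∪ S') := by
  rintro A (hA | hA)
  · exact h A hA
  · exact h' A hA
lemma gd_Fg (b : ℕ) : Gd P (Fg P b) := ((gd_GG _).wt _).union ((gd_DG _).wt _)
lemma gd_EE (n : ℕ) : Gd P (EE n) := ((gd_DG _).wt _).union ((gd_GG _).wt _)
lemma gd_Rm (n c : ℕ) : Gd P (Rm P n c) := by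
  rintro A ((⟨b, c', _, _, h⟩ | ⟨b, b', c', _, _, h⟩) | ⟨b, c', _, h⟩)
  · exact ((gd_Fg b).pr (gd_Sg c')) A h
  · exact (((gd_Fg b).pr (gd_Fg b')).pr (gd_Sg c')) A h
  · exact (((gd_DG _).wt _).pr (gd_DG _)) A h
/-- closure relation -/
def Cl (P : Prm) (k : Fin 8) (S S' : Set Op) : Prop := ∀ A ∈ S, Sp P S' (gO k A)
lemma cl_GG (k : Fin 8) (n : ℕ) : Cl P k (GG n) (GG (n + 1)) := by
  rintro _ ⟨l, hl, rfl⟩; exact .of _ ⟨k :: l, by simpa using hl, rfl⟩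
lemma commG (k : Fin 8) (α : Fin 4) (l : W8) :
    Eqv P (G (cs α :: k :: l) + ∑ β, (-cc k α β) • G (cs β :: l)) (G (k :: cs α :: l)) := by
  intro ψ hψ p hp
  have h := D_gam (hψ.g l).1 k α p hp
  have e1 : G (k :: cs α :: l) ψ = Gam k (Dop α (G l ψ)) := by
    change Gam k (G (cs α :: l) ψ) = _; rw [G_cs]
  rw [e1]
  simp only [Pi.add_apply, Finset.sum_apply, Pi.smul_apply, smul_eq_mul, G_cs]
  have e2 : G (k :: l) ψ = Gam k (G l ψ) := rfl
  rw [e2, h]; simp [add_assoc, ← Finset.sum_add_distrib]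
lemma cl_DG (k : Fin 8) (n : ℕ) : Cl P k (DG n) (DG (n + 1)) := by
  rintro _ ⟨α, l, hl, rfl⟩
  refine .congr _ _ (commG k α l) (.add _ _ (.of _ ⟨α, k :: l, by simpa using hl, rfl⟩) (Sp.sum _ fun β _ => .smul _ _ (.of _ ⟨β, l, by omega, rfl⟩)))
lemma cl_Sg (k : Fin 8) (n : ℕ) : Cl P k (Sg n) (Sg (n + 1)) := by
  rintro _ ⟨α, β, l, hl, rfl⟩
  refine .congr _ _ (commG k α (cs β :: l)) (.add _ _ ?_ (Sp.sum _ fun β' _ => .smul _ _ (.of _ ⟨β', β, l, by omega, rfl⟩)))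
  have h1 : Sp P (DG (n + 2)) (G (k :: cs β :: l)) := cl_DG k (n + 1) _ ⟨β, l, by omega, rfl⟩
  refine Sp.gam (cs α) (gd_DG _).so ?_ h1
  rintro _ ⟨β', l', hl', rfl⟩
  exact .of _ ⟨α, β', l', by omega, rfl⟩
lemma Cl.pr {k : Fin 8} {S S' S1 S1' T : Set Op} (hS : Gd P S) (hS' : Gd P S') (h : Cl P k S S1) (h' : Cl P k S' S1')
    (t1 : Pr S1 S' ⊆ T) (t2 : Pr S S1' ⊆ T) : Cl P k (Pr S S') T := by
  rintro _ ⟨B, C, hB, hC, rfl⟩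
  refine .congr (gO k B * C + B * gO k C) _ (fun ψ hψ p hp => (gam_mul (hS B hB ψ hψ).1 (hS' C hC ψ hψ).1 k p hp).symm) ?_
  refine .add _ _ ?_ ?_
  · exact Sp.mul (fun A hA B hB => .of _ (t1 ⟨A, B, hA, hB, rfl⟩)) (h B hB) (Sp.of (S := S') C hC)
  · exact Sp.mul (fun A hA B hB => .of _ (t2 ⟨A, B, hA, hB, rfl⟩)) (Sp.of (S := S) B hB) (h' C hC)
lemma Cl.wt {k : Fin 8} {S S1 T : Set Op} {I : ℝ} (hS : Gd P S) (h : Cl P k S S1) (t1 : Wt I S1 ⊆ T) (t2 : Wt I S ⊆ T) : Cl P k (Wt I S) T := by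
  rintro _ ⟨s, B, hs, hB, rfl⟩
  refine .congr (((if k = 0 then s else if k = 7 then -s else 0) • (w (s - 1) * B) + (if k = 7 then s else 0) • (w s * B)) + w s * gO k B) _
    (fun ψ hψ p hp => ?_) ?_
  · have := gam_mul (sm_w s) (hS B hB ψ hψ).1 k p hp
    refine Eq.trans ?_ this.symm
    rw [gam_w s p hp k]
    simp only [Pi.add_apply, Pi.smul_apply, Pi.mul_apply, smul_eq_mul, w, gO]; ring
  · refine .add _ _ (.add _ _ (.smul _ _ (.of _ (t2 ⟨s - 1, B, by linarith, hB, rfl⟩))) (.smul _ _ (.of _ (t2 ⟨s, B, hs, hB, rfl⟩)))) ?_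
    exact Sp.mul (S := {w s}) (fun A hA C hC => .of _ (t1 ⟨s, C, hs, hC, by rw [hA]⟩)) (.of _ rfl) (h B hB)
lemma Cl.union {k : Fin 8} {S S' T : Set Op} (h : Cl P k S T) (h' : Cl P k S' T) : Cl P k (S ∪ S') T := by
  rintro A (hA | hA)
  · exact h A hA
  · exact h' A hA
lemma GG_mono {n m : ℕ} (h : n ≤ m) : GG n ⊆ GG m := by rintro _ ⟨l, hl, rfl⟩; exact ⟨l, by omega, rfl⟩
lemma DG_mono {n m : ℕ} (h : n ≤ m) : DG n ⊆ DG m := by rintro _ ⟨α, l, hl, rfl⟩; exact ⟨α, l, by omega, rfl⟩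
lemma Sg_mono {n m : ℕ} (h : n ≤ m) : Sg n ⊆ Sg m := by rintro _ ⟨α, β, l, hl, rfl⟩; exact ⟨α, β, l, by omega, rfl⟩
lemma Wt_mono {I : ℝ} {S T : Set Op} (h : S ⊆ T) : Wt I S ⊆ Wt I T := by rintro _ ⟨s, B, hs, hB, rfl⟩; exact ⟨s, B, hs, h hB, rfl⟩
lemma Pr_mono {S T S' T' : Set Op} (h : S ⊆ T) (h' : S' ⊆ T') : Pr S S' ⊆ Pr T T' := by
  rintro _ ⟨s, B, hs, hB, rfl⟩; exact ⟨s, B, h hs, h' hB, rfl⟩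
lemma Fg_mono {n m : ℕ} (h : n ≤ m) : Fg P n ⊆ Fg P m := union_subset_union (Wt_mono (GG_mono bo)) (Wt_mono (DG_mono bo))
lemma EE_mono {n m : ℕ} (h : n ≤ m) : EE n ⊆ EE m := union_subset_union (Wt_mono (DG_mono h)) (Wt_mono (GG_mono h))
lemma cl_Fg (k : Fin 8) (b : ℕ) : Cl P k (Fg P b) (Fg P (b + 1)) := by
  refine Cl.union (Cl.wt (gd_GG _) (cl_GG k _) subset_union_left ?_) (Cl.wt (gd_DG _) (cl_DG k _) subset_union_right ?_)
  · exact (Wt_mono (GG_mono bo)).trans subset_union_left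
  · exact (Wt_mono (DG_mono bo)).trans subset_union_right
lemma cl_EE (k : Fin 8) (b : ℕ) : Cl P k (EE b) (EE (b + 1)) := by
  refine Cl.union (Cl.wt (gd_DG _) (cl_DG k _) subset_union_left ?_) (Cl.wt (gd_GG _) (cl_GG k _) subset_union_right ?_)
  · exact (Wt_mono (DG_mono bo)).trans subset_union_left
  · exact (Wt_mono (GG_mono bo)).trans subset_union_right
lemma Rm1 {n c b c' : ℕ} (h : b + c' ≤ n) (h' : c' < c) : Pr (Fg P b) (Sg c') ⊆ Rm P n c :=
  fun A hA => Or.inl (Or.inl ⟨b, c', h, h', hA⟩)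
lemma Rm2 {n c b b' c' : ℕ} (h : b + b' + c' ≤ n) (h' : c' < c) : Pr (Pr (Fg P b) (Fg P b')) (Sg c') ⊆ Rm P n c :=
  fun A hA => Or.inl (Or.inr ⟨b, b', c', h, h', hA⟩)
lemma Rm3 {n c b c' : ℕ} (h : b + c' ≤ n) : Pr (Wt 0 (DG (b + 1))) (DG (c' + 1)) ⊆ Rm P n c :=
  fun A hA => Or.inr ⟨b, c', h, hA⟩
lemma Rm_mono {n m c d : ℕ} (h : n ≤ m) (h' : c ≤ d) : Rm P n c ⊆ Rm P m d := by
  rintro A ((⟨b, c', h1, h2, hA⟩ | ⟨b, b', c', h1, h2, hA⟩) | ⟨b, c', h1, hA⟩)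
  · exact Rm1 bo bo hA
  · exact Rm2 bo bo hA
  · exact Rm3 bo hA
lemma cl_Rm (k : Fin 8) (n c : ℕ) : Cl P k (Rm P n c) (Rm P (n + 1) (c + 1)) := by
  rintro A ((⟨b, c', h1, h2, h⟩ | ⟨b, b', c', h1, h2, h⟩) | ⟨b, c', h1, h⟩)
  · exact Cl.pr (gd_Fg b) (gd_Sg c') (cl_Fg k b) (cl_Sg k c') (Rm1 bo bo) (Rm1 bo bo) A h
  · have hp : Cl P k (Pr (Fg P b) (Fg P b')) (Pr (Fg P (b + 1)) (Fg P b') ∪ Pr (Fg P b) (Fg P (b' + 1))) :=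
      Cl.pr (gd_Fg b) (gd_Fg b') (cl_Fg k b) (cl_Fg k b') subset_union_left subset_union_right
    refine Cl.pr ((gd_Fg b).pr (gd_Fg b')) (gd_Sg c') hp (cl_Sg k c') ?_ (Rm2 bo bo) A h
    rintro _ ⟨B, C, hB | hB, hC, rfl⟩
    · exact Rm2 (b := b + 1) (b' := b') (c' := c') bo bo ⟨B, C, hB, hC, rfl⟩
    · exact Rm2 (b := b) (b' := b' + 1) (c' := c') bo bo ⟨B, C, hB, hC, rfl⟩
  · have hw : Cl P k (Wt 0 (DG (b + 1))) (Wt 0 (DG (b + 1 + 1))) := Cl.wt (gd_DG _) (cl_DG k _) subset_rfl (Wt_mono (DG_mono bo))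
    exact Cl.pr ((gd_DG _).wt _) (gd_DG _) hw (cl_DG k _) (Rm3 bo) (Rm3 bo) A h
end
section
variable {P : Prm}
def boxO (A : Op) : Op := fun ψ => box (A ψ)
def qO (P : Prm) (i : Fin 3) : Op := w P.lam * G [cs i.succ]
def g0 (P : Prm) : Op := (-(P.γ - 1)) • (w P.lam * G [cs 0] + P.lam • (w (P.lam - 1) * G []) + P.μ • (w 0 * G []) + (1 / 2 : ℝ) • ∑ i, qO P i * qO P i)
def HO (P : Prm) (i j : Fin 3) : Op := (if i = j then g0 P else 0) + (-1 : ℝ) • (qO P i * qO P j)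
def cf (P : Prm) (α β : Fin 4) : Op :=
  Fin.cases (motive := fun _ => Op) (Fin.cases (motive := fun _ => Op) 0 (fun j => (-1 : ℝ) • qO P j) β)
    (fun i => Fin.cases (motive := fun _ => Op) ((-1 : ℝ) • qO P i) (fun j => HO P i j) β) α
def PO (P : Prm) (l : W8) : Op := ∑ α, ∑ β, cf P α β * G (cs α :: cs β :: l)
def LO (P : Prm) (A : Op) : Op := boxO A + P.μ • (w (-P.lam) * gO 0 A) + (2 * P.lam) • (w (-1) * gO 0 A) + (-(P.lam * (1 - P.lam))) • (w (-2) * A)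
def CF (P : Prm) : Set Op := Fg P 0 ∪ Pr (Fg P 0) (Fg P 0)
lemma gd_CF : Gd P (CF P) := (gd_Fg 0).union ((gd_Fg 0).pr (gd_Fg 0))
lemma qO_mem (i : Fin 3) : qO P i ∈ Fg P 0 := Or.inr ⟨P.lam, _, le_rfl, ⟨i.succ, [], by simp, rfl⟩, rfl⟩
lemma qq_mem (i j : Fin 3) : Sp P (CF P) (qO P i * qO P j) := .of _ (Or.inr ⟨_, _, qO_mem i, qO_mem j, rfl⟩)
lemma g0_mem : Sp P (CF P) (g0 P) := by
  refine .smul _ _ (.add _ _ (.add _ _ (.add _ _ (.of _ ?_) (.smul _ _ (.of _ ?_))) (.smul _ _ (.of _ ?_))) (.smul _ _ (Sp.sum _ fun i _ => qq_mem i i)))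
  · exact Or.inl (Or.inr ⟨P.lam, _, le_rfl, ⟨0, [], by simp, rfl⟩, rfl⟩)
  · exact Or.inl (Or.inl ⟨P.lam - 1, _, by linarith [P.hlam1], ⟨[], by simp, rfl⟩, rfl⟩)
  · exact Or.inl (Or.inl ⟨0, _, le_rfl, ⟨[], by simp, rfl⟩, rfl⟩)
lemma HO_mem (i j : Fin 3) : Sp P (CF P) (HO P i j) := by
  refine .add _ _ ?_ (.smul _ _ (qq_mem i j))
  split_ifs
  · exact g0_mem
  · exact .zero
lemma cf_mem (α β : Fin 4) : Sp P (CF P) (cf P α β) := by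
  refine Fin.cases ?_ (fun i => ?_) α <;> refine Fin.cases ?_ (fun j => ?_) β
  · exact .zero
  · exact .smul _ _ (.of _ (Or.inl (qO_mem j)))
  · exact .smul _ _ (.of _ (Or.inl (qO_mem i)))
  · exact HO_mem i j
lemma cf_so (α β : Fin 4) : SO P (cf P α β) := (cf_mem α β).so gd_CF.so
lemma CF_Sg {n : ℕ} : ∀ A ∈ CF P, ∀ B ∈ Sg n, Sp P (Rm P n (n + 1)) (A * B) := by
  rintro A (hA | hA) B hB
  · exact .of _ (Rm1 (b := 0) (c' := n) bo bo ⟨A, B, hA, hB, rfl⟩)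
  · exact .of _ (Rm2 (b := 0) (b' := 0) (c' := n) bo bo ⟨A, B, hA, hB, rfl⟩)
lemma PO_mem (l : W8) : Sp P (Rm P l.length (l.length + 1)) (PO P l) :=
  Sp.sum _ fun α _ => Sp.sum _ fun β _ => Sp.mul CF_Sg (cf_mem α β) (.of (S := Sg l.length) _ ⟨α, β, l, le_rfl, rfl⟩)
lemma cm2 (k : Fin 8) (α β : Fin 4) (l : W8) :
    ∃ Z, Sp P (Sg l.length) Z ∧ Eqv P (gO k (G (cs α :: cs β :: l))) (G (cs α :: cs β :: k :: l) + Z) := by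
  refine ⟨∑ β', (-cc k β β') • G (cs α :: cs β' :: l) + ∑ β', (-cc k α β') • G (cs β' :: cs β :: l), ?_, ?_⟩
  · exact .add _ _ (Sp.sum _ fun β' _ => .smul _ _ (.of _ ⟨α, β', l, le_rfl, rfl⟩)) (Sp.sum _ fun β' _ => .smul _ _ (.of _ ⟨β', β, l, le_rfl, rfl⟩))
  · intro ψ hψ p hp
    have h1 := commG k α (cs β :: l) ψ hψ p hp
    have h2 : G (cs α :: k :: cs β :: l) ψ p = G (cs α :: cs β :: k :: l) ψ p + ∑ β', -cc k β β' * G (cs α :: cs β' :: l) ψ p := by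
      rw [G_cs, D_congr (fun p hp => (commG k β l ψ hψ p hp).symm) α p hp]
      have := D_add (hψ.g (cs β :: k :: l)).1 (Sm.sum Finset.univ fun β' _ => (hψ.g (cs β' :: l)).1.smul (-cc k β β')) α p hp
      have e : (G (cs β :: k :: l) + ∑ β', (-cc k β β') • G (cs β' :: l)) ψ = fun p => G (cs β :: k :: l) ψ p + ∑ β', -cc k β β' * G (cs β' :: l) ψ p := by
        funext p; simp [Finset.sum_apply]
      rw [e, this, D_sum _ (fun β' _ => (hψ.g (cs β' :: l)).1.smul (-cc k β β')) α p hp]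
      simp only [G_cs, D_smul _ ((hψ.g l).1.D _) α p hp]
    change G (k :: cs α :: cs β :: l) ψ p = _
    rw [← h1]
    simp only [Pi.add_apply, Finset.sum_apply, Pi.smul_apply, smul_eq_mul]
    rw [h2]; ring
lemma PO_gam (k : Fin 8) (l : W8) :
    ∃ Z, Sp P (Rm P (l.length + 1) (l.length + 1)) Z ∧ Eqv P (gO k (PO P l)) (PO P (k :: l) + Z) := by
  choose Z hZ eZ using fun α β => cm2 k α β l
  set n := l.length with hn
  refine ⟨∑ α, ∑ β, (gO k (cf P α β) * G (cs α :: cs β :: l) + cf P α β * Z α β), ?_, ?_⟩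
  · refine Sp.sum _ fun α _ => Sp.sum _ fun β _ => .add _ _ ?_ ?_
    · have hp : Cl P k (CF P) (Fg P 1 ∪ (Pr (Fg P 1) (Fg P 0) ∪ Pr (Fg P 0) (Fg P 1))) := by
        refine Cl.union (fun A hA => (cl_Fg k 0 A hA).mono subset_union_left) ?_
        exact Cl.pr (gd_Fg 0) (gd_Fg 0) (cl_Fg k 0) (cl_Fg k 0) (subset_union_left.trans subset_union_right) (subset_union_right.trans subset_union_right)
      refine Sp.mul ?_ (Sp.gam k gd_CF.so hp (cf_mem α β)) (.of (S := Sg n) _ ⟨α, β, l, le_rfl, rfl⟩)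
      rintro A (hA | hA | hA) B hB
      · exact .of _ (Rm1 (b := 1) (c' := n) bo bo ⟨A, B, hA, hB, rfl⟩)
      · exact .of _ (Rm2 (b := 1) (b' := 0) (c' := n) bo bo ⟨A, B, hA, hB, rfl⟩)
      · exact .of _ (Rm2 (b := 0) (b' := 1) (c' := n) bo bo ⟨A, B, hA, hB, rfl⟩)
    · exact (Sp.mul CF_Sg (cf_mem α β) (hZ α β)).mono (Rm_mono bo le_rfl)
  · intro ψ hψ p hp
    have s1 : ∀ α β, Sm (fun p => cf P α β ψ p * G (cs α :: cs β :: l) ψ p) := fun α β => (cf_so α β ψ hψ).mul (hψ.g _).1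
    have e : gO k (PO P l) ψ = Gam k (fun p => ∑ α, ∑ β, cf P α β ψ p * G (cs α :: cs β :: l) ψ p) := by
      refine congrArg (Gam k) (funext fun p => ?_); simp [PO, Finset.sum_apply]
    rw [e, gam_eq]
    simp only [D_sum _ (fun α _ => Sm.sum _ fun β _ => s1 α β) _ p hp, D_sum _ (fun β _ => s1 _ β) _ p hp]
    have e2 : ∀ α β, ∑ κ, xi k κ p * Dop κ (fun p => cf P α β ψ p * G (cs α :: cs β :: l) ψ p) p =
        gO k (cf P α β) ψ p * G (cs α :: cs β :: l) ψ p + cf P α β ψ p * (G (cs α :: cs β :: k :: l) ψ p + Z α β ψ p) := by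
      intro α β
      rw [← gam_eq, gam_mul (cf_so α β ψ hψ) (hψ.g _).1 k p hp]
      have := eZ α β ψ hψ p hp
      change Gam k (G (cs α :: cs β :: l) ψ) p = _ at this
      rw [this]; try rfl
    have e3 : ∑ κ, xi k κ p * ∑ α, ∑ β, Dop κ (fun p => cf P α β ψ p * G (cs α :: cs β :: l) ψ p) p
      = ∑ α, ∑ β, ∑ κ, xi k κ p * Dop κ (fun p => cf P α β ψ p * G (cs α :: cs β :: l) ψ p) p := by
      simp only [Finset.mul_sum]
      rw [Finset.sum_comm]; refine fsc fun α _ => Finset.sum_comm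
    rw [e3]; simp only [e2, PO, Pi.add_apply, Finset.sum_apply, Pi.mul_apply, ← Finset.sum_add_distrib]
    refine fsc fun α _ => fsc fun β _ => ?_
    ring
def jk (k : Fin 8) : ℝ := if k = 7 then 1 else 0
def nk (k : Fin 8) : ℝ := if k = 0 then 1 else if k = 7 then -1 else 0
lemma gam_wf {f : PF} (hf : Sm f) (s : ℝ) (k : Fin 8) (p : Pt) (hp : 0 < p.1) :
    Gam k (fun p => (1 + p.1) ^ s * f p) p = (s * nk k * (1 + p.1) ^ (s - 1) + s * jk k * (1 + p.1) ^ s) * f p + (1 + p.1) ^ s * Gam k f p := by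
  rw [gam_mul (sm_w s) hf k p hp, gam_w s p hp k]
  unfold jk nk; fin_cases k <;> simp
lemma D0_gam {f : PF} (hf : Sm f) (k : Fin 8) (p : Pt) (hp : 0 < p.1) :
    Dop 0 (Gam k f) p = Gam k (Dop 0 f) p + jk k * Dop 0 f p := by
  rw [D_gam hf k 0 p hp]; congr 1; unfold jk; fin_cases k <;> simp [cc, Fin.sum_univ_four]
def Lf (P : Prm) (f : PF) (p : Pt) : ℝ :=
  box f p + P.μ * ((1 + p.1) ^ (-P.lam) * Dop 0 f p) + 2 * P.lam * ((1 + p.1) ^ (-1 : ℝ) * Dop 0 f p)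
    + (-(P.lam * (1 - P.lam))) * ((1 + p.1) ^ (-2 : ℝ) * f p)
lemma L_gam {f : PF} (hf : Sm f) (k : Fin 8) (p : Pt) (hp : 0 < p.1) :
    Lf P (Gam k f) p = Gam k (Lf P f) p + jk k * (1 + P.lam) * Lf P f p + jk k * (1 - P.lam) * box f p
      + (nk k * P.μ * P.lam * ((1 + p.1) ^ (-P.lam - 1) * Dop 0 f p) + 2 * P.lam * nk k * ((1 + p.1) ^ (-2 : ℝ) * Dop 0 f p)
        + 2 * P.lam * (1 - P.lam) * jk k * ((1 + p.1) ^ (-1 : ℝ) * Dop 0 f p)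
        + P.lam * (1 - P.lam) * (-2) * nk k * ((1 + p.1) ^ (-3 : ℝ) * f p) + P.lam * (1 - P.lam) * jk k * (P.lam - 1) * ((1 + p.1) ^ (-2 : ℝ) * f p)) := by
  have s1 := (sm_w (-P.lam)).mul (hf.D 0)
  have s2 := (sm_w (-1)).mul (hf.D 0)
  have s3 := (sm_w (-2)).mul hf
  have h1 : Gam k (Lf P f) p = Gam k (box f) p + P.μ * Gam k (fun p => (1 + p.1) ^ (-P.lam) * Dop 0 f p) p
      + 2 * P.lam * Gam k (fun p => (1 + p.1) ^ (-1 : ℝ) * Dop 0 f p) p + (-(P.lam * (1 - P.lam))) * Gam k (fun p => (1 + p.1) ^ (-2 : ℝ) * f p) p := by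
    have := gam_add ((hf.box.add (s1.smul P.μ)).add (s2.smul (2 * P.lam))) (s3.smul (-(P.lam * (1 - P.lam)))) k p hp
    refine this.trans ?_
    rw [gam_add (hf.box.add (s1.smul P.μ)) (s2.smul (2 * P.lam)) k p hp, gam_add hf.box (s1.smul P.μ) k p hp, gam_smul _ s1 k p hp, gam_smul _ s2 k p hp, gam_smul _ s3 k p hp]
  have hb := gam_box hf k p hp
  have hj : (if k = 7 then (2:ℝ) else 0) = 2 * jk k := by unfold jk; split_ifs <;> simp
  rw [h1, gam_wf (hf.D 0) _ k p hp, gam_wf (hf.D 0) _ k p hp, gam_wf hf _ k p hp]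
  unfold Lf
  rw [D0_gam hf k p hp, hb, hj, show (-1 : ℝ) - 1 = -2 by norm_num, show (-2 : ℝ) - 1 = -3 by norm_num]
  ring
lemma LO_eq (A : Op) (ψ : PF) (p : Pt) : LO P A ψ p = Lf P (A ψ) p := rfl
lemma star0 : ∃ R V E, Sp P (Rm P 0 0) R ∧ Sp P (GG 0) V ∧ Sp P (EE 0) E ∧ Eqv P (LO P (G [])) (PO P [] + R + boxO V + E) := by
  refine ⟨(-2 * P.lam) • ∑ i : Fin 3, (w (P.lam - 1) * G [cs i.succ]) * G [cs i.succ] + (-P.μ) • ∑ i : Fin 3, (w 0 * G [cs i.succ]) * G [cs i.succ], 0, 0, ?_, .zero, .zero, ?_⟩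
  · have hm : ∀ i : Fin 3, ∀ s : ℝ, s ≤ 0 → Sp P (Rm P 0 0) ((w s * G [cs i.succ]) * G [cs i.succ]) := fun i s hs =>
      .of _ (Rm3 (b := 0) (c' := 0) bo ⟨_, _, ⟨s, _, hs, ⟨i.succ, [], by simp, rfl⟩, rfl⟩, ⟨i.succ, [], by simp, rfl⟩, rfl⟩)
    exact .add _ _ (.smul _ _ (Sp.sum _ fun i _ => hm i _ (by linarith [P.hlam1]))) (.smul _ _ (Sp.sum _ fun i _ => hm i _ le_rfl))
  · intro ψ hψ p hp
    have h := hψ.eq p hp.le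
    have hT : 0 < 1 + p.1 := by linarith
    have b0 : boxO 0 ψ p = 0 := by change box (fun _ => 0) p = 0; rw [box_eq]; simp [D_const, show ∀ α, Dop α (fun _ => (0:ℝ)) = fun _ => 0 from fun α => funext fun p => D_const 0 α p]
    have cm := fun α β => D_comm hψ.sf.1 α β p hp
    rw [LO_eq]
    have e1 : Lf P ψ p = Qpsi P.μ P.lam P.γ ψ p := by
      rw [← h]; unfold Lf
      rw [rpow_neg hT.le, rpow_neg_one, rpow_neg hT.le, rpow_two, div_eq_mul_inv, div_eq_mul_inv, div_eq_mul_inv]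
      change _ = box ψ p + P.μ * _ * Dop 0 ψ p + 2 * P.lam * _ * Dop 0 ψ p - _
      ring
    change Lf P ψ p = _
    rw [e1]
    have g1 : ∀ α, G [cs α] ψ = Dop α ψ := fun α => G_cs α [] ψ
    have g2 : ∀ α β, G [cs α, cs β] ψ = Dop α (Dop β ψ) := fun α β => by rw [G_cs, g1]
    have g3 : G [] ψ = ψ := rfl
    have e2 : (1 + p.1) ^ (2 * P.lam) = (1 + p.1) ^ P.lam * (1 + p.1) ^ P.lam := by rw [two_mul, rpow_add hT]
    have x1 : dxi 0 = Dop 1 := rfl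
    have x2 : dxi 1 = Dop 2 := rfl
    have x3 : dxi 2 = Dop 3 := rfl
    have x0 : dt = Dop 0 := rfl
    have c00 : cf P 0 0 = 0 := rfl
    have c01 : ∀ j : Fin 3, cf P 0 j.succ = (-1 : ℝ) • qO P j := fun j => rfl
    have c10 : ∀ j : Fin 3, cf P j.succ 0 = (-1 : ℝ) • qO P j := fun j => rfl
    have c11 : ∀ i j : Fin 3, cf P i.succ j.succ = HO P i j := fun i j => rfl
    have hPO : PO P [] ψ p = ∑ j : Fin 3, ((-1 : ℝ) * ((1 + p.1) ^ P.lam * Dx j ψ p)) * Dop 0 (Dx j ψ) p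
        + ∑ i : Fin 3, (((-1 : ℝ) * ((1 + p.1) ^ P.lam * Dx i ψ p)) * Dop 0 (Dx i ψ) p + ∑ j : Fin 3, HO P i j ψ p * Dx i (Dx j ψ) p) := by
      simp only [PO, Finset.sum_apply, Pi.mul_apply, g2, Fin.sum_univ_succ (n := 3), c00, c01, c10, c11]
      simp only [Pi.smul_apply, Pi.add_apply, Finset.sum_apply, Pi.mul_apply, qO, w, g1, g2, smul_eq_mul, cm _ 0, Pi.zero_apply, zero_mul, zero_add]
    have hH : ∀ i j, HO P i j ψ p = (if i = j then csq P.μ P.lam P.γ ψ p - 1 else 0) - ((1 + p.1) ^ P.lam * Dx i ψ p) * ((1 + p.1) ^ P.lam * Dx j ψ p) := by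
      intro i j
      have hg : g0 P ψ p = csq P.μ P.lam P.γ ψ p - 1 := by
        unfold csq g0
        simp only [Pi.smul_apply, Pi.add_apply, Pi.mul_apply, qO, w, g1, g3, smul_eq_mul, Finset.sum_apply, e2, rpow_zero, fs3, x0, x1, x2, x3]
        simp only [show (0 : Fin 3).succ = 1 from rfl, show (1 : Fin 3).succ = 2 from rfl, show (2 : Fin 3).succ = 3 from rfl]
        ring
      unfold HO
      split_ifs <;> simp only [Pi.smul_apply, Pi.add_apply, Pi.mul_apply, qO, w, g1, smul_eq_mul, hg, Pi.zero_apply] <;> ring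
    simp only [Pi.add_apply, b0, Pi.zero_apply, hPO, hH, Pi.smul_apply, smul_eq_mul, Finset.sum_apply, Pi.mul_apply, w, g1, rpow_zero]
    unfold Qpsi
    change (csq P.μ P.lam P.γ ψ p - 1) * (∑ i, dxi i (dxi i ψ) p) - 2 * (1 + p.1) ^ P.lam * (∑ i, dxi i (dt ψ) p * dxi i ψ p) - 2 * P.lam * (1 + p.1) ^ (P.lam - 1) * (∑ i, dxi i ψ p ^ 2) - P.μ * (∑ i, dxi i ψ p ^ 2) - (1 + p.1) ^ (2 * P.lam) * (∑ i, ∑ j, dxi i ψ p * dxi j ψ p * dxi i (dxi j ψ) p) = _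
    generalize csq P.μ P.lam P.γ ψ p = c
    simp only [fs3, e2, x0, x1, x2, x3, cm _ 0]
    simp only [show (0 : Fin 3).succ = 1 from rfl, show (1 : Fin 3).succ = 2 from rfl, show (2 : Fin 3).succ = 3 from rfl]
    simp
    ring
lemma star (l : W8) : ∃ R V E, Sp P (Rm P l.length l.length) R ∧ Sp P (GG l.length) V ∧ Sp P (EE l.length) E ∧
    Eqv P (LO P (G l)) (PO P l + R + boxO V + E) := by
  induction l with
  | nil => exact star0
  | cons k l ih =>
    obtain ⟨R, V, E, hR, hV, hE, h⟩ := ih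
    obtain ⟨Z, hZ, eZ⟩ := PO_gam k l
    simp only [List.length_cons]
    set n := l.length
    set κ := jk k * (1 + P.lam)
    refine ⟨gO k R + κ • R + κ • PO P l + Z, gO k V + (κ - 2 * jk k) • V + (jk k * (1 - P.lam)) • G l,
      gO k E + κ • E + ((nk k * P.μ * P.lam) • (w (-P.lam - 1) * G (cs 0 :: l)) + (2 * P.lam * nk k) • (w (-2) * G (cs 0 :: l))
        + (2 * P.lam * (1 - P.lam) * jk k) • (w (-1) * G (cs 0 :: l)) + (P.lam * (1 - P.lam) * (-2) * nk k) • (w (-3) * G l)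
        + (P.lam * (1 - P.lam) * jk k * (P.lam - 1)) • (w (-2) * G l)), ?_, ?_, ?_, ?_⟩
    · exact .add _ _ (.add _ _ (.add _ _ (Sp.gam k (gd_Rm _ _).so (cl_Rm k _ _) hR) (.smul _ _ (hR.mono (Rm_mono bo bo))))
        (.smul _ _ ((PO_mem l).mono (Rm_mono bo bo)))) hZ
    · exact .add _ _ (.add _ _ (Sp.gam k (gd_GG _).so (cl_GG k _) hV) (.smul _ _ (hV.mono (GG_mono bo)))) (.smul _ _ (.of _ ⟨l, by omega, rfl⟩))
    · have d : ∀ s : ℝ, s ≤ -1 → Sp P (EE (n + 1)) (w s * G (cs 0 :: l)) := fun s hs => .of _ (Or.inl ⟨s, _, hs, ⟨0, l, by omega, rfl⟩, rfl⟩)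
      have g : ∀ s : ℝ, s ≤ -2 → Sp P (EE (n + 1)) (w s * G l) := fun s hs => .of _ (Or.inr ⟨s, _, hs, ⟨l, by omega, rfl⟩, rfl⟩)
      refine .add _ _ (.add _ _ (Sp.gam k (gd_EE _).so (cl_EE k _) hE) (.smul _ _ (hE.mono (EE_mono bo)))) ?_
      exact .add _ _ (.add _ _ (.add _ _ (.add _ _ (.smul _ _ (d _ (by linarith [P.hlam0]))) (.smul _ _ (d _ (by norm_num)))) (.smul _ _ (d _ le_rfl)))
        (.smul _ _ (g _ (by norm_num)))) (.smul _ _ (g _ le_rfl))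
    · intro ψ hψ p hp
      have sV := hV.so (gd_GG _).so ψ hψ
      have sR := hR.so (gd_Rm _ _).so ψ hψ
      have sE := hE.so (gd_EE _).so ψ hψ
      have sP := (PO_mem l).so (gd_Rm _ _).so ψ hψ
      have su := (hψ.g l).1
      have h1 := L_gam (P := P) su k p hp
      have h2 : ∀ p : Pt, 0 < p.1 → Lf P (G l ψ) p = PO P l ψ p + R ψ p + box (V ψ) p + E ψ p := fun p hp => h ψ hψ p hp
      have h3 : Gam k (Lf P (G l ψ)) p = Gam k (PO P l ψ) p + Gam k (R ψ) p + (box (Gam k (V ψ)) p - 2 * jk k * box (V ψ) p) + Gam k (E ψ) p := by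
        rw [gam_congr h2 k p hp, gam_add ((sP.add sR).add sV.box) sE k p hp, gam_add (sP.add sR) sV.box k p hp, gam_add sP sR k p hp, gam_box sV k p hp]
        congr 4
        unfold jk; split_ifs <;> simp
      have h4 : Gam k (PO P l ψ) p = PO P (k :: l) ψ p + Z ψ p := eZ ψ hψ p hp
      have h5 : box ((gO k V + (κ - 2 * jk k) • V + (jk k * (1 - P.lam)) • G l) ψ) p = box (Gam k (V ψ)) p + (κ - 2 * jk k) * box (V ψ) p + jk k * (1 - P.lam) * box (G l ψ) p := by
        refine (box_add ((sV.gam k).add (sV.smul _)) (su.smul _) p hp).trans ?_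
        rw [box_add (sV.gam k) (sV.smul _) p hp, box_smul _ sV p hp, box_smul _ su p hp]
      change Lf P (Gam k (G l ψ)) p = _
      rw [h1, h3, h4, h2 p hp]
      rw [Pi.add_apply, Pi.add_apply, Pi.add_apply, Pi.add_apply, Pi.add_apply, Pi.add_apply]
      unfold boxO; rw [h5]
      simp only [Pi.add_apply, Pi.smul_apply, Pi.mul_apply, w, gO, smul_eq_mul, G_cs]
      ring
end
def CC (f : EF) : Prop := Continuous f ∧ HasCompactSupport f
def nm (f : EF) : ℝ := Real.sqrt (∫ x, f x ^ 2)
lemma TF.cc {f : EF} (h : TF f) : CC f := ⟨h.1.continuous, h.2⟩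
lemma CC.mulL {f g : EF} (hf : Continuous f) (hg : CC g) : CC (fun x => f x * g x) :=
  ⟨hf.mul hg.1, hg.2.mul_left⟩
lemma CC.mulR {f g : EF} (hf : CC f) (hg : Continuous g) : CC (fun x => f x * g x) :=
  ⟨hf.1.mul hg, hf.2.mul_right⟩
lemma CC.add {f g : EF} (hf : CC f) (hg : CC g) : CC (fun x => f x + g x) := ⟨hf.1.add hg.1, hf.2.add hg.2⟩
lemma CC.smul {f : EF} (c : ℝ) (hf : CC f) : CC (fun x => c * f x) := CC.mulL continuous_const hf
lemma CC.abs {f : EF} (hf : CC f) : CC (fun x => |f x|) := ⟨hf.1.abs, hf.2.comp_left (g := fun y : ℝ => |y|) abs_zero⟩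
lemma CC.int {f : EF} (hf : CC f) : Integrable f := hf.1.integrable_of_hasCompactSupport hf.2
lemma CC.sq {f : EF} (hf : CC f) : CC (fun x => f x ^ 2) := by
  have := hf.mulL hf.1; simpa [pow_two] using this
lemma CC.zero : CC (fun _ => 0) := ⟨continuous_const, HasCompactSupport.zero⟩
lemma CC.sum {ι : Type} (s : Finset ι) {f : ι → EF} (h : ∀ i ∈ s, CC (f i)) : CC (fun x => ∑ i ∈ s, f i x) := by
  classical
  induction s using Finset.induction_on with
  | empty => simpa using CC.zero
  | insert a s ha ih =>
    simp only [Finset.sum_insert ha]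
    exact (h _ (Finset.mem_insert_self _ _)).add (ih fun i hi => h i (Finset.mem_insert_of_mem hi))
lemma nm_nn (f : EF) : 0 ≤ nm f := sqrt_nonneg _
lemma nm_sq (f : EF) : nm f ^ 2 = ∫ x, f x ^ 2 := sq_sqrt (integral_nonneg fun x => sqn _)
lemma nm_le {f : EF} {B : ℝ} (hB : 0 ≤ B) (h : ∫ x, f x ^ 2 ≤ B ^ 2) : nm f ≤ B := by
  rw [nm, sqrt_le_left hB]; exact h
lemma nm_mono {f g : EF} (hg : CC g) (h : ∀ x, |f x| ≤ |g x|) : nm f ≤ nm g :=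
  sqrt_le_sqrt (integral_mono_of_nonneg (.of_forall fun x => sqn _) hg.sq.int
    (.of_forall fun x => sq_le_sq.2 (h x)))
lemma nm_smul (c : ℝ) (f : EF) : nm (fun x => c * f x) = |c| * nm f := by
  unfold nm; simp only [mul_pow]
  rw [integral_const_mul, sqrt_mul (sqn _), sqrt_sq_eq_abs]
lemma cs_int {f g : EF} (hf : CC f) (hg : CC g) : ∫ x, f x * g x ≤ nm f * nm g := by
  have hfg' := CC.mulL hf.1 hg
  have key : ∀ s : ℝ, 0 ≤ nm f ^ 2 * (s * s) + 2 * (∫ x, f x * g x) * s + nm g ^ 2 := by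
    intro s
    have h : 0 ≤ ∫ x, (s * f x + g x) ^ 2 := integral_nonneg fun x => sqn _
    have e : (fun x => (s * f x + g x) ^ 2) = fun x => s ^ 2 * f x ^ 2 + 2 * s * (f x * g x) + g x ^ 2 := by funext x; ring
    rw [e, integral_add ((hf.sq.smul _).add (hfg'.smul _)).int hg.sq.int, integral_add (hf.sq.smul _).int (hfg'.smul _).int,
      integral_const_mul, integral_const_mul] at h
    rw [nm_sq, nm_sq]; linarith
  have := discrim_le_zero key
  unfold discrim at this
  have h2 : (∫ x, f x * g x) ^ 2 ≤ (nm f * nm g) ^ 2 := by nlinarith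
  exact (abs_le_of_sq_le_sq' h2 (mnn (nm_nn _) (nm_nn _))).2
lemma cs_abs {f g : EF} (hf : CC f) (hg : CC g) : |∫ x, f x * g x| ≤ nm f * nm g := by
  refine abs_le.2 ⟨?_, cs_int hf hg⟩
  have := cs_int (hf.smul (-1)) hg
  rw [nm_smul] at this
  simp only [mul_assoc, integral_const_mul] at this
  norm_num at this; linarith
lemma nm_add {f g : EF} (hf : CC f) (hg : CC g) : nm (fun x => f x + g x) ≤ nm f + nm g := by
  refine nm_le (add_nonneg (nm_nn _) (nm_nn _)) ?_
  have hfg' := CC.mulL hf.1 hg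
  have e : (fun x => (f x + g x) ^ 2) = fun x => f x ^ 2 + 2 * (f x * g x) + g x ^ 2 := by funext x; ring
  rw [e, integral_add (hf.sq.add (hfg'.smul _)).int hg.sq.int, integral_add hf.sq.int (hfg'.smul _).int, integral_const_mul]
  have := cs_int hf hg
  nlinarith [nm_sq f, nm_sq g]
section
variable {I : Type}
def Le (a b : I → ℝ) : Prop := ∃ C : ℝ, 0 ≤ C ∧ ∀ c, a c ≤ C * b c
def NF (F : I → EF) (b : I → ℝ) : Prop := (∀ c, CC (F c)) ∧ Le (fun c => nm (F c)) b
def SU (F : I → EF) (b : I → ℝ) : Prop := ∃ C : ℝ, 0 ≤ C ∧ ∀ c x, |F c x| ≤ C * b c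
lemma Le.rfl {a : I → ℝ} : Le a a := ⟨1, zero_le_one, fun c => by simp⟩
lemma Le.of {a b : I → ℝ} (h : ∀ c, a c ≤ b c) : Le a b := ⟨1, zero_le_one, fun c => by simpa using h c⟩
lemma Le.trans {a b d : I → ℝ} (h : Le a b) (h' : Le b d) : Le a d := by
  obtain ⟨C, hC, h⟩ := h; obtain ⟨C', hC', h'⟩ := h'
  exact ⟨C * C', mnn hC hC', fun c => (h c).trans (by rw [mul_assoc]; exact mll (h' c) hC)⟩
lemma Le.add {a b d : I → ℝ} (h : Le a d) (h' : Le b d) : Le (fun c => a c + b c) d := by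
  obtain ⟨C, hC, h⟩ := h; obtain ⟨C', hC', h'⟩ := h'
  exact ⟨C + C', add_nonneg hC hC', fun c => by rw [add_mul]; exact add_le_add (h c) (h' c)⟩
lemma Le.smul {a b : I → ℝ} (K : ℝ) (hK : 0 ≤ K) (h : Le a b) : Le (fun c => K * a c) b := by
  obtain ⟨C, hC, h⟩ := h
  exact ⟨K * C, mnn hK hC, fun c => by rw [mul_assoc]; exact mll (h c) hK⟩
lemma Le.mul {a b a' b' : I → ℝ} (h : Le a b) (h' : Le a' b') (ha : ∀ c, 0 ≤ a' c) (hb : ∀ c, 0 ≤ b c) :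
    Le (fun c => a c * a' c) (fun c => b c * b' c) := by
  obtain ⟨C, hC, h⟩ := h; obtain ⟨C', hC', h'⟩ := h'
  refine ⟨C * C', mnn hC hC', fun c => ?_⟩
  calc a c * a' c ≤ (C * b c) * (C' * b' c) := mul_le_mul (h c) (h' c) (ha c) (mnn hC (hb c))
    _ = _ := by ring
lemma Le.sum {ι : Type} (s : Finset ι) {a : ι → I → ℝ} {b : I → ℝ} (hb : ∀ c, 0 ≤ b c) (h : ∀ i ∈ s, Le (a i) b) : Le (fun c => ∑ i ∈ s, a i c) b := by
  classical
  induction s using Finset.induction_on with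
  | empty => exact Le.of fun c => by simpa using hb c
  | insert j s hj ih =>
    simp only [Finset.sum_insert hj]
    exact (h _ (Finset.mem_insert_self _ _)).add (ih fun i hi => h i (Finset.mem_insert_of_mem hi))
lemma NF.le {F : I → EF} {b b' : I → ℝ} (h : NF F b) (hb : Le b b') : NF F b' := ⟨h.1, h.2.trans hb⟩
lemma NF.add {F F' : I → EF} {b : I → ℝ} (h : NF F b) (h' : NF F' b) : NF (fun c x => F c x + F' c x) b :=
  ⟨fun c => (h.1 c).add (h'.1 c), (Le.of fun c => nm_add (h.1 c) (h'.1 c)).trans (h.2.add h'.2)⟩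
lemma NF.smul {F : I → EF} {b : I → ℝ} (K : ℝ) (h : NF F b) : NF (fun c x => K * F c x) b :=
  ⟨fun c => (h.1 c).smul K, (Le.of fun c => (nm_smul K _).le).trans (h.2.smul _ (abn K))⟩
lemma NF.tmul {F : I → EF} {b : I → ℝ} (K : I → ℝ) (hK : ∀ c, 0 ≤ K c) (h : NF F b) : NF (fun c x => K c * F c x) (fun c => K c * b c) := by
  obtain ⟨h0, C, hC, h⟩ := h
  refine ⟨fun c => (h0 c).smul _, C, hC, fun c => ?_⟩
  change nm (fun x => K c * F c x) ≤ C * (K c * b c)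
  rw [nm_smul, abs_of_nonneg (hK c), mul_left_comm]
  exact mll (h c) (hK c)
lemma NF.abs {F : I → EF} {b : I → ℝ} (h : NF F b) : NF (fun c x => |F c x|) b :=
  ⟨fun c => (h.1 c).abs, (Le.of fun c => nm_mono (h.1 c) fun x => by simp).trans h.2⟩
lemma NF.sum {ι : Type} (s : Finset ι) {F : ι → I → EF} {b : I → ℝ} (hb : ∀ c, 0 ≤ b c) (h : ∀ i ∈ s, NF (F i) b) : NF (fun c x => ∑ i ∈ s, F i c x) b := by
  classical
  induction s using Finset.induction_on with
  | empty =>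
    refine ⟨fun c => by simpa using CC.zero, Le.of fun c => ?_⟩
    simpa [nm] using hb c
  | insert j s hj ih =>
    simp only [Finset.sum_insert hj]
    exact (h _ (Finset.mem_insert_self _ _)).add (ih fun i hi => h i (Finset.mem_insert_of_mem hi))
lemma NF.dom {F F' : I → EF} {b : I → ℝ} (hF : ∀ c, CC (F c)) (K : ℝ) (h : ∀ c x, |F c x| ≤ K * |F' c x|) (h' : NF F' b) : NF F b := by
  refine ⟨hF, (Le.of fun c => nm_mono ((h'.1 c).smul |K|) fun x => (h c x).trans ?_).trans (h'.smul |K|).2⟩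
  rw [abs_mul, abs_abs]; exact mlr (le_abs_self K) (abn _)
lemma SU.le {F : I → EF} {b b' : I → ℝ} (h : SU F b) (hb : Le b b') : SU F b' := by
  obtain ⟨C, hC, h⟩ := h; obtain ⟨C', hC', h'⟩ := hb
  exact ⟨C * C', mnn hC hC', fun c x => (h c x).trans (by rw [mul_assoc]; exact mll (h' c) hC)⟩
lemma SU.add {F F' : I → EF} {b : I → ℝ} (h : SU F b) (h' : SU F' b) : SU (fun c x => F c x + F' c x) b := by
  obtain ⟨C, hC, h⟩ := h; obtain ⟨C', hC', h'⟩ := h'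
  exact ⟨C + C', add_nonneg hC hC', fun c x => (abs_add_le _ _).trans (by rw [add_mul]; exact add_le_add (h c x) (h' c x))⟩
lemma SU.tmul {F : I → EF} {b : I → ℝ} (K : I → ℝ) (hK : ∀ c, 0 ≤ K c) (h : SU F b) : SU (fun c x => K c * F c x) (fun c => K c * b c) := by
  obtain ⟨C, hC, h⟩ := h
  refine ⟨C, hC, fun c x => ?_⟩
  rw [abs_mul, abs_of_nonneg (hK c), mul_left_comm]
  exact mll (h c x) (hK c)
lemma SU.smul {F : I → EF} {b : I → ℝ} (K : ℝ) (h : SU F b) : SU (fun c x => K * F c x) b := by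
  obtain ⟨C, hC, h⟩ := h
  exact ⟨|K| * C, mnn (abn _) hC, fun c x => by rw [abs_mul, mul_assoc]; exact mll (h c x) (abn _)⟩
lemma SU.dom {F F' : I → EF} {b : I → ℝ} (K : ℝ) (hK : 0 ≤ K) (h : ∀ c x, |F c x| ≤ K * |F' c x|) (h' : SU F' b) : SU F b := by
  obtain ⟨C, hC, h'⟩ := h'
  exact ⟨K * C, mnn hK hC, fun c x => (h c x).trans (by rw [mul_assoc]; exact mll (h' c x) hK)⟩
lemma SU.nf {F F' H : I → EF} {b b' : I → ℝ} (hb : ∀ c, 0 ≤ b c) (hH : ∀ c, CC (H c)) (h : SU F b) (h' : NF F' b') (K : ℝ) (hK : ∀ c x, |H c x| ≤ K * |F c x * F' c x|) :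
    NF H (fun c => b c * b' c) := by
  obtain ⟨C, hC, h⟩ := h
  refine NF.dom hH (|K| * C) (fun c x => (hK c x).trans ?_) (h'.tmul b hb)
  rw [abs_mul, abs_mul, abs_of_nonneg (hb c)]
  calc K * (|F c x| * |F' c x|) ≤ |K| * ((C * b c) * |F' c x|) :=
        mul_le_mul (le_abs_self K) (mlr (h c x) (abn _)) (mnn (abn _) (abn _)) (abn _)
    _ = _ := by ring
lemma NF.int {F F' : I → EF} {b b' : I → ℝ} (hb : ∀ c, 0 ≤ b c) (h : NF F b) (h' : NF F' b') : Le (fun c => |∫ x, F c x * F' c x|) (fun c => b c * b' c) := by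
  refine (Le.of fun c => cs_abs (h.1 c) (h'.1 c)).trans (h.2.mul h'.2 (fun c => nm_nn _) hb)
end
structure Ctx (P : Prm) where
  ψ : PF
  e : ℝ
  t : ℝ
  adm : Adm P ψ
  he0 : 0 < e
  he1 : e ≤ 1
  en : energy P.lam P.N ψ t ≤ e ^ 2
  ht : 0 < t
section
variable {P : Prm}
def Tc (c : Ctx P) : ℝ := 1 + c.t
lemma Tc1 (c : Ctx P) : 1 ≤ Tc c := by have := c.ht; unfold Tc; linarith
lemma Tc0 (c : Ctx P) : 0 < Tc c := lt_of_lt_of_le one_pos (Tc1 c)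
lemma Tp (c : Ctx P) (s : ℝ) : 0 < Tc c ^ s := rpow_pos_of_pos (Tc0 c) s
lemma Tmono (c : Ctx P) {s s' : ℝ} (h : s ≤ s') : Tc c ^ s ≤ Tc c ^ s' := rpow_le_rpow_of_exponent_le (Tc1 c) h
def sl (A : Op) (c : Ctx P) (x : E3) : ℝ := A c.ψ (c.t, x)
lemma sl_tf {A : Op} {c : Ctx P} (h : SF P.M (A c.ψ)) : TF (sl A c) := h.slice c.ht
lemma sl_g (l : W8) (c : Ctx P) : TF (sl (G l) c) := (c.adm.g l).slice c.ht
lemma sl_w (s : ℝ) (A : Op) (c : Ctx P) (x : E3) : sl (w s * A) c x = Tc c ^ s * sl A c x := rfl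
lemma sl_supp {A : Op} {c : Ctx P} (h : SF P.M (A c.ψ)) {x : E3} (hx : (1 + P.M) * Tc c < ‖x‖) : sl A c x = 0 := by
  refine h.2 (c.t, x) c.ht ?_
  have := c.ht; have := P.hM; have h1 : c.t + P.M ≤ (1 + P.M) * Tc c := by unfold Tc; nlinarith
  exact lt_of_le_of_lt h1 hx
def e1 (c : Ctx P) (l : W8) : ℝ := ∑ α, nm (sl (G (cs α :: l)) c) ^ 2
def Dq (n : ℕ) (c : Ctx P) : ℝ := ∑ m ∈ Finset.range n, ∑ a : Fin m → Fin 8, e1 c (List.ofFn a)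
def Dm (n : ℕ) (c : Ctx P) : ℝ := Real.sqrt (Dq n c)
def DD (c : Ctx P) : ℝ := Dm (P.N + 1) c
lemma e1_nn (c : Ctx P) (l : W8) : 0 ≤ e1 c l := fsn fun _ _ => sqn _
lemma Dq_nn (n : ℕ) (c : Ctx P) : 0 ≤ Dq n c := fsn fun _ _ => fsn fun _ _ => e1_nn _ _
lemma Dm_nn (n : ℕ) (c : Ctx P) : 0 ≤ Dm n c := sqrt_nonneg _
lemma DD_nn (c : Ctx P) : 0 ≤ DD c := sqrt_nonneg _
lemma Dm_sq (n : ℕ) (c : Ctx P) : Dm n c ^ 2 = Dq n c := sq_sqrt (Dq_nn n c)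
lemma ws_le {f : W8 → ℝ} (hf : ∀ l, 0 ≤ f l) {n : ℕ} {l : W8} (h : l.length < n) :
    f l ≤ ∑ m ∈ Finset.range n, ∑ a : Fin m → Fin 8, f (List.ofFn a) := by
  calc f l = f (List.ofFn l.get) := by rw [List.ofFn_get]
    _ ≤ ∑ a : Fin l.length → Fin 8, f (List.ofFn a) := Finset.single_le_sum (f := fun a : Fin l.length → Fin 8 => f (List.ofFn a)) (fun a _ => hf _) (Finset.mem_univ _)
    _ ≤ _ := Finset.single_le_sum (f := fun m => ∑ a : Fin m → Fin 8, f (List.ofFn a)) (fun m _ => fsn fun a _ => hf _) (Finset.mem_range.2 h)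
lemma Dq_mono {n m : ℕ} (h : n ≤ m) (c : Ctx P) : Dq n c ≤ Dq m c :=
  Finset.sum_le_sum_of_subset_of_nonneg (Finset.range_subset_range.2 h) fun _ _ _ => fsn fun _ _ => e1_nn _ _
lemma Dm_mono {n m : ℕ} (h : n ≤ m) (c : Ctx P) : Dm n c ≤ Dm m c := sqrt_le_sqrt (Dq_mono h c)
lemma nm_Dm {n : ℕ} {l : W8} (h : l.length < n) (α : Fin 4) (c : Ctx P) : nm (sl (G (cs α :: l)) c) ≤ Dm n c := by
  refine le_sqrt_of_sq_le ?_
  exact (Finset.single_le_sum (f := fun α => nm (sl (G (cs α :: l)) c) ^ 2) (fun _ _ => sqn _) (Finset.mem_univ α)).trans (ws_le (fun l => e1_nn c l) h)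
lemma nf_DG {n : ℕ} {A : Op} (h : A ∈ DG n) : NF (sl (P := P) A) (Dm n) := by
  obtain ⟨α, l, hl, rfl⟩ := h
  exact ⟨fun c => (sl_g _ c).cc, Le.of fun c => nm_Dm hl α c⟩
lemma en_eq (c : Ctx P) : energy P.lam P.N c.ψ c.t = Tc c ^ (2 * P.lam) * Dq (P.N + 1) c + ∑ m ∈ Finset.range (P.N + 1), ∑ a : Fin m → Fin 8, nm (sl (G (List.ofFn a)) c) ^ 2 := by
  unfold energy Dq
  rw [Finset.mul_sum, ← Finset.sum_add_distrib]
  refine fsc fun m _ => ?_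
  rw [Finset.mul_sum, ← Finset.sum_add_distrib]
  refine fsc fun a _ => ?_
  set l := List.ofFn a
  have i1 : CC (fun x => ∑ α, (sl (G (cs α :: l)) c x) ^ 2) := CC.sum _ fun α _ => (sl_g _ c).cc.sq
  have h : ∀ x, (1 + c.t) ^ (2 * P.lam) * ∑ α : Fin 4, (Dop α (GamWord l c.ψ) (c.t, x)) ^ 2 + (GamWord l c.ψ (c.t, x)) ^ 2
      = Tc c ^ (2 * P.lam) * (∑ α, (sl (G (cs α :: l)) c x) ^ 2) + (sl (G l) c x) ^ 2 := by
    intro x; unfold sl; simp only [G_cs]; rfl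
  simp only [h]
  rw [integral_add (i1.smul _).int (sl_g l c).cc.sq.int, integral_const_mul, integral_finsetSum _ fun α _ => (sl_g _ c).cc.sq.int]
  simp only [e1, nm_sq]
lemma D_e (c : Ctx P) : Tc c ^ P.lam * DD c ≤ c.e := by
  refine le_of_sq_le_sq ?_ c.he0.le
  rw [mul_pow, DD, Dm_sq, ← rpow_natCast, ← rpow_mul (Tc0 c).le, mul_comm P.lam]
  have := en_eq c; have h := c.en
  have h2 : 0 ≤ ∑ m ∈ Finset.range (P.N + 1), ∑ a : Fin m → Fin 8, nm (sl (G (List.ofFn a)) c) ^ 2 := fsn fun _ _ => fsn fun _ _ => sqn _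
  push_cast; linarith
lemma D_e' (c : Ctx P) : DD c ≤ Tc c ^ (-P.lam) * c.e := by
  have := D_e c
  rw [rpow_neg (Tc0 c).le, inv_mul_eq_div, le_div_iff₀ (Tp c _)]; linarith
lemma D_le_e (c : Ctx P) : DD c ≤ c.e := by
  refine le_trans ?_ (D_e c)
  have : 1 ≤ Tc c ^ P.lam := one_le_rpow (Tc1 c) P.hlam0.le
  nlinarith [DD_nn c]
lemma nm_e {l : W8} (h : l.length ≤ P.N) (c : Ctx P) : nm (sl (G l) c) ≤ c.e := by
  refine le_of_sq_le_sq ?_ c.he0.le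
  have h1 := ws_le (f := fun l => nm (sl (G l) c) ^ 2) (fun _ => sqn _) (n := P.N + 1) (l := l) bo
  have := en_eq c; have h2 := c.en
  have : 0 ≤ Tc c ^ (2 * P.lam) * Dq (P.N + 1) c := mnn (Tp c _).le (Dq_nn _ c)
  linarith
lemma nf_GGe {A : Op} (h : A ∈ GG (P.N + 1)) : NF (sl (P := P) A) (fun c => c.e) := by
  obtain ⟨l, hl, rfl⟩ := h
  exact ⟨fun c => (sl_g _ c).cc, Le.of fun c => nm_e bo c⟩
lemma sl_eqv {A B : Op} (h : Eqv P A B) (c : Ctx P) (x : E3) : sl A c x = sl B c x := h c.ψ c.adm (c.t, x) c.ht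
lemma Sp.nfw {S : Set Op} {ω : Ctx P → EF} {b : Ctx P → ℝ} (hb : ∀ c, 0 ≤ b c) (h : ∀ A ∈ S, NF (fun c x => ω c x * sl A c x) b) {A : Op} (hA : Sp P S A) :
    NF (fun c x => ω c x * sl A c x) b := by
  induction hA with
  | of A hA => exact h A hA
  | zero =>
    have : (fun (c : Ctx P) x => ω c x * sl (0 : Op) c x) = fun c x => ∑ i ∈ (∅ : Finset ℕ), 0 := by funext c x; simp [sl]
    rw [this]; exact NF.sum (F := fun _ _ _ => 0) _ hb bs
  | add A B _ _ h1 h2 =>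
    have : (fun c x => ω c x * sl (A + B) c x) = fun c x => ω c x * sl A c x + ω c x * sl B c x := by funext c x; exact mul_add _ _ _
    rw [this]; exact h1.add h2
  | smul k A _ h =>
    have : (fun c x => ω c x * sl (k • A) c x) = fun c x => k * (ω c x * sl A c x) := by funext c x; exact mul_left_comm _ _ _
    rw [this]; exact h.smul k
  | congr A B e _ h =>
    have : (fun c x => ω c x * sl B c x) = fun c x => ω c x * sl A c x := by funext c x; rw [sl_eqv e]
    rw [this]; exact h
lemma Sp.nf {S : Set Op} {b : Ctx P → ℝ} (hb : ∀ c, 0 ≤ b c) (h : ∀ A ∈ S, NF (sl A) b) {A : Op} (hA : Sp P S A) :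
    NF (sl A) b := by
  have := Sp.nfw (ω := fun _ _ => 1) hb (fun A hA => by simpa using h A hA) hA
  simpa using this
lemma Sp.suw {S : Set Op} {ω : Ctx P → EF} {b : Ctx P → ℝ} (hb : ∀ c, 0 ≤ b c) (h : ∀ A ∈ S, SU (fun c x => ω c x * sl A c x) b) {A : Op} (hA : Sp P S A) :
    SU (fun c x => ω c x * sl A c x) b := by
  induction hA with
  | of A hA => exact h A hA
  | zero => exact ⟨0, le_rfl, fun c x => by simp [sl]⟩
  | add A B _ _ h1 h2 =>
    have : (fun c x => ω c x * sl (A + B) c x) = fun c x => ω c x * sl A c x + ω c x * sl B c x := by funext c x; exact mul_add _ _ _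
    rw [this]; exact h1.add h2
  | smul k A _ h =>
    have : (fun c x => ω c x * sl (k • A) c x) = fun c x => k * (ω c x * sl A c x) := by funext c x; exact mul_left_comm _ _ _
    rw [this]; exact h.smul k
  | congr A B e _ h =>
    have : (fun c x => ω c x * sl B c x) = fun c x => ω c x * sl A c x := by funext c x; rw [sl_eqv e]
    rw [this]; exact h
lemma app_DG (m : W8) (α : Fin 4) (l : W8) : Sp P (DG (m.length + l.length + 1)) (G (m ++ cs α :: l)) := by
  induction m with
  | nil => exact .of _ ⟨α, l, by simp, rfl⟩
  | cons k m ih =>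
    have := Sp.gam k (gd_DG _).so (cl_DG k _) ih
    refine Sp.mono (DG_mono ?_) this
    simp; try omega
lemma nf_app {m l : W8} {n : ℕ} (α : Fin 4) (h : m.length + l.length < n) : NF (sl (P := P) (G (m ++ cs α :: l))) (Dm n) :=
  Sp.nf (Dm_nn n) (fun _ hA => nf_DG hA) (Sp.mono (DG_mono bo) (app_DG m α l))
end
section
variable {I : Type}
lemma NF.sq {F : I → EF} {b : I → ℝ} (h : NF F b) : Le (fun c => ∫ x, F c x ^ 2) (fun c => b c ^ 2) := by
  obtain ⟨_, C, hC, h⟩ := h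
  refine ⟨C ^ 2, sqn C, fun c => ?_⟩
  change (∫ x, F c x ^ 2) ≤ C ^ 2 * b c ^ 2
  rw [← nm_sq, ← mul_pow]; exact pow_le_pow_left₀ (nm_nn _) (h c) 2
lemma SU.of_sq {F : I → EF} {b : I → ℝ} (hb : ∀ c, 0 ≤ b c) {a : I → ℝ} (h : ∀ c x, F c x ^ 2 ≤ a c) (ha : Le a (fun c => b c ^ 2)) : SU F b := by
  obtain ⟨C, hC, h'⟩ := ha
  refine ⟨√C, sqrt_nonneg C, fun c x => ?_⟩
  refine abs_le_of_sq_le_sq ?_ (mnn (sqrt_nonneg C) (hb c))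
  rw [mul_pow, sq_sqrt hC]; exact (h c x).trans (h' c)
lemma suSob {v : I → EF} {b : I → ℝ} (hb : ∀ c, 0 ≤ b c) (hv : ∀ c, TF (v c)) (h1 : ∀ i, NF (fun c => pd i (v c)) b)
    (h2 : ∀ i j, NF (fun c => pd j (pd i (v c))) b) : SU v b := by
  obtain ⟨C, hC, h⟩ := sob
  refine SU.of_sq hb (fun c x => h (v c) (hv c) x) (Le.smul C hC.le (Le.add ?_ ?_))
  · exact Le.sum _ (fun c => sqn _) fun i _ => (h1 i).sq
  · exact Le.sum _ (fun c => sqn _) fun i _ => Le.sum _ (fun c => sqn _) fun j _ => (h2 i j).sq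
end
section
variable {P : Prm}
lemma pd_sl {A : Op} {c : Ctx P} (h : SF P.M (A c.ψ)) (i : Fin 3) : pd i (sl A c) = sl (gO (cs i.succ) A) c := by
  have := slice_pd' h.1 c.ht i
  unfold gO; unfold sl; rw [this, gam_cs]
lemma pd_slg (l : W8) (c : Ctx P) (i : Fin 3) : pd i (sl (G l) c) = sl (G (cs i.succ :: l)) c := pd_sl (c.adm.g l) i
lemma su_Z {l : W8} {b : Ctx P → ℝ} (hb : ∀ c, 0 ≤ b c) (h1 : ∀ i : Fin 3, NF (sl (G (cs i.succ :: l))) b)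
    (h2 : ∀ i j : Fin 3, NF (sl (G (cs j.succ :: cs i.succ :: l))) b) : SU (sl (G l)) b := by
  refine suSob hb (fun c => sl_g l c) (fun i => ?_) (fun i j => ?_)
  · simpa only [pd_slg] using h1 i
  · simpa only [pd_slg] using h2 i j
lemma rot_sl (a b : Fin 3) : ∃ s : ℝ, ∃ k : Fin 8, ∀ l (c : Ctx P), rot a b (sl (G l) c) = fun x => s * sl (G (k :: l)) c x := by
  have key : ∀ (s : ℝ) (k : Fin 8), (∀ (f : PF) (p : Pt), p.2 a * Dop b.succ f p - p.2 b * Dop a.succ f p = s * Gam k f p) →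
      ∀ l (c : Ctx P), rot a b (sl (G l) c) = fun x => s * sl (G (k :: l)) c x := by
    intro s k h l c
    funext x; unfold rot; rw [pd_slg, pd_slg]; unfold sl; rw [G_cs, G_cs]; exact h (G l c.ψ) (c.t, x)
  fin_cases a <;> fin_cases b
  · exact ⟨0, 0, key _ _ fun f p => by simp⟩
  · exact ⟨1, 6, key _ _ fun f p => by simp [Gam, Dop]⟩
  · exact ⟨-1, 5, key _ _ fun f p => by simp [Gam, Dop]⟩
  · exact ⟨-1, 6, key _ _ fun f p => by simp [Gam, Dop]⟩
  · exact ⟨0, 0, key _ _ fun f p => by simp⟩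
  · exact ⟨1, 4, key _ _ fun f p => by simp [Gam, Dop]⟩
  · exact ⟨1, 5, key _ _ fun f p => by simp [Gam, Dop]⟩
  · exact ⟨-1, 4, key _ _ fun f p => by simp [Gam, Dop]⟩
  · exact ⟨0, 0, key _ _ fun f p => by simp⟩
lemma rot_smul (a b : Fin 3) (s : ℝ) {f : EF} (hf : Smo f) : rot a b (fun x => s * f x) = fun x => s * rot a b f x := by
  funext x; unfold rot pd; rw [fderiv_const_mul (hf.diff x)]; simp; ring
lemma R0_smul (s : ℝ) (f : EF) : R0 (fun x => s * f x) = s ^ 2 * R0 f := by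
  unfold R0; simp only [mul_pow]; rw [integral_const_mul]
lemma R1_smul (s : ℝ) {f : EF} (hf : Smo f) : R1 (fun x => s * f x) = s ^ 2 * R1 f := by
  unfold R1; simp only [rot_smul _ _ s hf, R0_smul, mul_add, Finset.mul_sum]
lemma R1_le {l : W8} {b : Ctx P → ℝ} (h : NF (sl (G l)) b) (h1 : ∀ k, NF (sl (G (k :: l))) b) :
    Le (fun c : Ctx P => R1 (sl (G l) c)) (fun c => b c ^ 2) := by
  refine Le.add h.sq (Le.sum _ (fun c => sqn _) fun i _ => Le.sum _ (fun c => sqn _) fun j _ => ?_)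
  obtain ⟨s, k, hs⟩ := rot_sl (P := P) i j
  simp only [hs, R0_smul]
  exact (h1 k).sq.smul _ (sqn s)
lemma R2_le {l : W8} {b : Ctx P → ℝ} (h : ∀ m : W8, m.length ≤ 2 → NF (sl (P := P) (G (m ++ l))) b) :
    Le (fun c : Ctx P => R2 (sl (G l) c)) (fun c => b c ^ 2) := by
  refine Le.add (R1_le (h [] bs) fun k => h [k] bs) (Le.sum _ (fun c => sqn _) fun i _ => Le.sum _ (fun c => sqn _) fun j _ => ?_)
  obtain ⟨s, k, hs⟩ := rot_sl (P := P) i j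
  simp only [hs, R1_smul _ (sl_g _ _).1]
  exact (R1_le (h [k] bs) fun k' => h [k', k] bs).smul _ (sqn s)
def om (x : E3) : ℝ := 1 + ‖x‖
lemma om1 (x : E3) : 1 ≤ om x := by unfold om; linarith [norm_nonneg x]
lemma om0 (x : E3) : 0 < om x := lt_of_lt_of_le one_pos (om1 x)
lemma om_cont : Continuous om := by unfold om; fun_prop
lemma omi_cont : Continuous (fun x => (om x)⁻¹) := om_cont.inv₀ fun x => (om0 x).ne'
lemma su_W {l : W8} {b : Ctx P → ℝ} (hb : ∀ c, 0 ≤ b c) (h : ∀ m : W8, m.length ≤ 2 → NF (sl (G (m ++ l))) b)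
    (h' : ∀ m : W8, m.length ≤ 2 → ∀ j : Fin 3, NF (sl (G (m ++ cs j.succ :: l))) b) :
    SU (fun (c : Ctx P) x => om x * sl (G l) c x) b := by
  obtain ⟨C, hC, hW⟩ := Wlem
  have h1 : SU (fun (c : Ctx P) x => ‖x‖ * sl (G l) c x) b := by
    refine SU.of_sq hb (fun c x => ?_) (Le.smul C hC.le (Le.add (R2_le h) (Le.sum Finset.univ (fun c => sqn _) fun j _ => R2_le fun m hm => h' m hm j)))
    rw [mul_pow]; have := hW _ (sl_g l c) x
    simpa only [pd_slg] using this
  have h2 : SU (sl (P := P) (G l)) b := su_Z hb (fun i => h' [] bs i) (fun i j => h' [cs j.succ] bs i)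
  have := h2.add h1
  refine SU.dom 1 zero_le_one (fun c x => ?_) this
  rw [one_mul, om, add_mul, one_mul]
lemma DD_le {n : ℕ} (h : n ≤ P.N + 1) (c : Ctx P) : Dm n c ≤ DD c := Dm_mono h c
lemma nf_appD {m l : W8} (α : Fin 4) (h : m.length + l.length ≤ P.N) : NF (sl (P := P) (G (m ++ cs α :: l))) DD := nf_app α bo
/-- W bound -/
lemma W {l : W8} (hl : l.length + 3 ≤ P.N) (α : Fin 4) : SU (fun (c : Ctx P) x => om x * sl (G (cs α :: l)) c x) DD := by
  refine su_W DD_nn (fun m hm => nf_appD α bo) (fun m hm j => nf_appD j.succ (by simp; omega))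
lemma Wz {l : W8} (hl : l.length + 2 ≤ P.N) : SU (fun (c : Ctx P) x => om x * sl (G l) c x) (fun c => c.e) := by
  refine su_W (fun c => c.he0.le) (fun m hm => nf_GGe ⟨_, by simp; omega, rfl⟩) (fun m hm j => (nf_appD j.succ bo).le (Le.of D_le_e))
lemma hardyN {e : ℝ} (he : 0 < e) (l : W8) (c : Ctx P) : ∫ x, sl (G l) c x ^ 2 / qq e x ≤ 4 * e1 c l := by
  refine (hardy he (sl_g l c)).trans (mll ?_ (by norm_num))
  simp only [pd_slg]
  rw [integral_finsetSum _ fun i _ => (sl_g _ c).cc.sq.int]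
  have h0 : e1 c l = nm (sl (G (cs 0 :: l)) c) ^ 2 + ∑ i : Fin 3, nm (sl (G (cs i.succ :: l)) c) ^ 2 := Fin.sum_univ_succ _
  rw [h0]; simp only [nm_sq]
  have : 0 ≤ ∫ x, sl (G (cs 0 :: l)) c x ^ 2 := integral_nonneg fun x => sqn _
  linarith
lemma hint {e : ℝ} (he : 0 < e) (l : W8) (c : Ctx P) : Integrable (fun x => sl (G l) c x ^ 2 / qq e x) := by
  have : Continuous fun x : E3 => (qq e x)⁻¹ := by
    refine Continuous.inv₀ (by fun_prop) fun x => ?_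
    positivity
  simpa only [div_eq_mul_inv] using ((sl_g l c).cc.sq.mulR this).int
lemma Hd {n : ℕ} {l : W8} (hl : l.length < n) : NF (fun (c : Ctx P) x => (om x)⁻¹ * sl (G l) c x) (Dm n) := by
  refine ⟨fun c => (sl_g l c).cc.mulL omi_cont, 2, by norm_num, fun c => nm_le (by have := Dm_nn n c; linarith) ?_⟩
  have h := hardyN one_pos l c
  have h2 : e1 c l ≤ Dm n c ^ 2 := by rw [Dm_sq]; exact ws_le (fun l => e1_nn c l) hl
  have h3 : ∫ x, ((om x)⁻¹ * sl (G l) c x) ^ 2 ≤ ∫ x, sl (G l) c x ^ 2 / (1 ^ 2 + ‖x‖ ^ 2) := by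
    refine integral_mono_of_nonneg (.of_forall fun x => sqn _) (hint one_pos l c) (.of_forall fun x => ?_)
    simp only
    rw [mul_pow, inv_pow, mul_comm, ← div_eq_mul_inv]
    refine div_le_div_of_nonneg_left (sqn _) bp ?_
    unfold om; nlinarith [norm_nonneg x]
  calc _ ≤ _ := h3
    _ ≤ _ := by nlinarith
lemma Po {n : ℕ} {l : W8} (hl : l.length < n) : NF (fun (c : Ctx P) x => sl (G l) c x) (fun c => Tc c * Dm n c) := by
  set K := 1 + (1 + P.M) ^ 2 with hK
  have hK0 : 0 < K := by positivity
  refine ⟨fun c => (sl_g l c).cc, 2 * √K, by positivity, fun c => nm_le (by have := Dm_nn n c; have := (Tc0 c).le; positivity) ?_⟩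
  have h := hardyN (Tc0 c) l c
  have h2 : e1 c l ≤ Dm n c ^ 2 := by rw [Dm_sq]; exact ws_le (fun l => e1_nn c l) hl
  have hT := Tc0 c
  have h3 : ∫ x, (sl (G l) c x) ^ 2 ≤ ∫ x, (K * Tc c ^ 2) * (sl (G l) c x ^ 2 / (Tc c ^ 2 + ‖x‖ ^ 2)) := by
    refine integral_mono_of_nonneg (.of_forall fun x => sqn _) ((hint (Tc0 c) l c).const_mul _) (.of_forall fun x => ?_)
    simp only
    by_cases hx : (1 + P.M) * Tc c < ‖x‖
    · rw [sl_supp (c.adm.g l) hx]; simp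
    · push Not at hx
      have : Tc c ^ 2 + ‖x‖ ^ 2 ≤ K * Tc c ^ 2 := by
        have := pow_le_pow_left₀ (norm_nonneg x) hx 2
        rw [hK]; nlinarith
      rw [← mul_div_assoc, le_div_iff₀ bp, mul_comm]
      exact mlr this (sqn _)
  rw [integral_const_mul] at h3
  calc _ ≤ _ := h3
    _ ≤ (K * Tc c ^ 2) * (4 * Dm n c ^ 2) := mll (h.trans bl) bp
    _ = _ := by rw [mul_pow, mul_pow, sq_sqrt hK0.le]; ring
end
section
variable {P : Prm}
def ch (c : Ctx P) (x : E3) : ℝ := 1 - ‖x‖ ^ 2 / Tc c ^ 2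
lemma ch_smo (c : Ctx P) : Smo (ch c) := by unfold Smo ch; exact contDiff_const.sub (smo_nsq.div_const _)
lemma ch_cont (c : Ctx P) : Continuous (ch c) := (ch_smo c).continuous
def Y (c : Ctx P) : ℝ := ∑ m ∈ Finset.range P.N, ∑ a : Fin m → Fin 8, ∑ α, ∑ β, nm (fun x => ch c x * sl (G (cs α :: cs β :: List.ofFn a)) c x)
lemma Y_nn (c : Ctx P) : 0 ≤ Y c := fsn fun _ _ => fsn fun _ _ => fsn fun _ _ => fsn fun _ _ => nm_nn _
def BB (c : Ctx P) : ℝ := Y c + Tc c ^ (-P.lam) * DD c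
lemma BB_nn (c : Ctx P) : 0 ≤ BB c := add_nonneg (Y_nn c) (mnn (Tp c _).le (DD_nn c))
lemma Y_BB (c : Ctx P) : Y c ≤ BB c := by unfold BB; linarith [mnn (Tp c (-P.lam)).le (DD_nn c)]
lemma Ti (c : Ctx P) : (Tc c)⁻¹ ≤ Tc c ^ (-P.lam) := by
  rw [← rpow_neg_one]; exact Tmono c (by linarith [P.hlam1])
lemma TD_BB (c : Ctx P) : (Tc c)⁻¹ * DD c ≤ BB c := by
  unfold BB; have := mlr (Ti c) (DD_nn c); linarith [Y_nn c]
lemma nf_Y {l : W8} (hl : l.length < P.N) (α β : Fin 4) : NF (fun (c : Ctx P) x => ch c x * sl (G (cs α :: cs β :: l)) c x) Y := by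
  refine ⟨fun c => (sl_g _ c).cc.mulL (ch_cont c), Le.of fun c => ?_⟩
  refine le_trans ?_ (ws_le (f := fun l => ∑ α, ∑ β, nm (fun x => ch c x * sl (G (cs α :: cs β :: l)) c x)) (fun l => fsn fun _ _ => fsn fun _ _ => nm_nn _) hl)
  refine le_trans ?_ (Finset.single_le_sum (f := fun α => ∑ β, nm (fun x => ch c x * sl (G (cs α :: cs β :: l)) c x)) (fun _ _ => fsn fun _ _ => nm_nn _) (Finset.mem_univ α))
  exact Finset.single_le_sum (f := fun β => nm (fun x => ch c x * sl (G (cs α :: cs β :: l)) c x)) (fun _ _ => nm_nn _) (Finset.mem_univ β)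
lemma F1a {b : ℕ} (hb : b + 2 ≤ P.N) {A : Op} (hA : A ∈ Wt 0 (GG (b + 1))) : SU (fun (c : Ctx P) x => om x * sl A c x) (fun c => c.e) := by
  obtain ⟨s, _, hs, ⟨l, hl, rfl⟩, rfl⟩ := hA
  refine SU.dom 1 zero_le_one (fun c x => ?_) (Wz (l := l) bo)
  rw [sl_w, mul_left_comm, abs_mul, abs_of_pos (Tp c s)]
  refine mlr ?_ (abn _)
  simpa using Tmono c hs
lemma F1b {b : ℕ} (hb : b + 3 ≤ P.N) {A : Op} (hA : A ∈ Wt P.lam (DG (b + 1))) : SU (fun (c : Ctx P) x => om x * sl A c x) (fun c => c.e) := by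
  obtain ⟨s, _, hs, ⟨α, l, hl, rfl⟩, rfl⟩ := hA
  have := (SU.tmul (fun c : Ctx P => Tc c ^ P.lam) (fun c => (Tp c _).le) (W (l := l) bo α)).le (Le.of D_e)
  refine SU.dom 1 zero_le_one (fun c x => ?_) this
  rw [sl_w, mul_left_comm, abs_mul, abs_mul (Tc c ^ P.lam), abs_of_pos (Tp c s), abs_of_pos (Tp c _), one_mul]
  exact mlr (Tmono c hs) (abn _)
lemma F1 {b : ℕ} (hb : b + 3 ≤ P.N) {A : Op} (hA : A ∈ Fg P b) : SU (fun (c : Ctx P) x => om x * sl A c x) (fun c => c.e) := by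
  rcases hA with hA | hA
  · exact F1a bo hA
  · exact F1b hb hA
lemma om_drop {F : Ctx P → EF} {b : Ctx P → ℝ} (h : SU (fun c x => om x * F c x) b) : SU F b := by
  refine SU.dom 1 zero_le_one (fun c x => ?_) h
  rw [abs_mul, abs_of_pos (om0 x), one_mul]
  exact le_mul_of_one_le_left (abn _) (om1 x)
lemma F2 {b : ℕ} (hb : b ≤ P.N) {A : Op} (hA : A ∈ Fg P b) : NF (sl (P := P) A) (fun c => c.e) := by
  rcases hA with ⟨s, _, hs, ⟨l, hl, rfl⟩, rfl⟩ | ⟨s, _, hs, ⟨α, l, hl, rfl⟩, rfl⟩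
  · refine NF.dom (fun c => CC.smul (Tc c ^ s) (sl_g l c).cc) 1 (fun c x => ?_) (nf_GGe (P := P) ⟨l, by omega, rfl⟩)
    rw [sl_w, abs_mul, abs_of_pos (Tp c s)]
    refine mlr ?_ (abn _)
    simpa using Tmono c hs
  · have := (NF.tmul (fun c : Ctx P => Tc c ^ P.lam) (fun c => (Tp c _).le) ((nf_DG (P := P) ⟨α, l, hl, rfl⟩).le (Le.of (DD_le bo)))).le (Le.of D_e)
    refine NF.dom (fun c => CC.smul (Tc c ^ s) (sl_g (cs α :: l) c).cc) 1 (fun c x => ?_) this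
    rw [sl_w, abs_mul, abs_mul, abs_of_pos (Tp c s), abs_of_pos (Tp c _), one_mul]
    exact mlr (Tmono c hs) (abn _)
lemma Sb1 {k : ℕ} (hk : k < P.N) {A : Op} (hA : A ∈ Sg k) : NF (sl (P := P) A) DD := by
  obtain ⟨α, β, l, hl, rfl⟩ := hA
  exact nf_appD (m := [cs α]) β (by simp; omega)
lemma Sb2 {k : ℕ} (hk : k + 4 ≤ P.N) {A : Op} (hA : A ∈ Sg k) : SU (fun (c : Ctx P) x => om x * sl A c x) DD := by
  obtain ⟨α, β, l, hl, rfl⟩ := hA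
  exact W (by simp; omega) α
lemma Sb3 {k : ℕ} (hk : k < P.N) {A : Op} (hA : A ∈ Sg k) : NF (fun (c : Ctx P) x => ch c x * sl A c x) Y := by
  obtain ⟨α, β, l, hl, rfl⟩ := hA
  exact nf_Y bo α β
lemma ch_dich (c : Ctx P) (x : E3) : 3 / 4 ≤ |ch c x| ∨ Tc c ≤ 2 * om x := by
  by_cases h : Tc c ≤ 2 * om x
  · exact .inr h
  · left
    push Not at h
    have hT := Tc0 c
    unfold om at h
    have h2 : ‖x‖ ^ 2 / Tc c ^ 2 ≤ 1 / 4 := by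
      rw [div_le_iff₀ bp]
      nlinarith [norm_nonneg x]
    refine le_trans ?_ (le_abs_self _)
    unfold ch; linarith
/-- x_i f / T^2 bound -/
lemma nf_x {A : Op} (hA : ∀ ψ, Adm P ψ → SF P.M (A ψ)) {b : Ctx P → ℝ} (h : NF (sl A) b) (i : Fin 3) :
    NF (fun c x => x i / Tc c ^ 2 * sl A c x) (fun c => (Tc c)⁻¹ * b c) := by
  have h' := NF.tmul (fun c : Ctx P => (Tc c)⁻¹) (fun c => (inv_pos.2 (Tc0 c)).le) h
  refine NF.dom (fun c => (sl_tf (hA c.ψ c.adm)).cc.mulL (by fun_prop)) (1 + P.M) (fun c x => ?_) h'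
  by_cases hx : (1 + P.M) * Tc c < ‖x‖
  · rw [sl_supp (hA c.ψ c.adm) hx]; simp
  · push Not at hx
    have hT := Tc0 c
    have h1 : |x i| ≤ (1 + P.M) * Tc c := (PiLp.norm_apply_le x i).trans hx
    rw [abs_mul, abs_mul, ← mul_assoc]
    refine mlr ?_ (abn _)
    rw [abs_div, abs_of_pos (by positivity : 0 < Tc c ^ 2), abs_of_pos (inv_pos.2 hT), div_le_iff₀ bp]
    calc |x i| ≤ _ := h1
      _ = _ := by field_simp
lemma nf_xB {A : Op} (hA : ∀ ψ, Adm P ψ → SF P.M (A ψ)) (h : NF (sl (P := P) A) DD) (i : Fin 3) :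
    NF (fun (c : Ctx P) x => x i / Tc c ^ 2 * sl A c x) BB := (nf_x hA h i).le (Le.of TD_BB)
lemma nf_TB {F : Ctx P → EF} (h : NF F DD) : NF (fun c x => (Tc c ^ 2)⁻¹ * F c x) BB := by
  refine (NF.tmul (fun c : Ctx P => (Tc c ^ 2)⁻¹) (fun c => by have := Tc0 c; positivity) h).le (Le.of fun c => le_trans ?_ (TD_BB c))
  refine mlr ?_ (DD_nn c)
  have := Tc1 c
  exact inv_anti₀ (Tc0 c) (by nlinarith)
lemma pd_ch (c : Ctx P) (i : Fin 3) (x : E3) : pd i (ch c) x = -2 * (x i / Tc c ^ 2) := by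
  have e : ch c = fun x => 1 + (-(Tc c ^ 2)⁻¹) * ‖x‖ ^ 2 := by funext x; unfold ch; ring
  have h1 : pd i (fun x : E3 => ‖x‖ ^ 2) x = 2 * x i := pd_nsq i x
  rw [e]; unfold pd at *
  rw [fderiv_const_add, fderiv_const_mul (smo_nsq.diff x)]
  simp only [ContinuousLinearMap.smul_apply, smul_eq_mul]; rw [h1]; ring
lemma pd_xT (c : Ctx P) (i j : Fin 3) (x : E3) : pd j (fun x => -2 * (x i / Tc c ^ 2)) x = (if i = j then 1 else 0) * (-2 / Tc c ^ 2) := by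
  have e : (fun x : E3 => -2 * (x i / Tc c ^ 2)) = fun x => (-2 / Tc c ^ 2) * x i := by funext x; ring
  have h1 := pd_coord j i x
  rw [e]; unfold pd at *
  rw [fderiv_const_mul ((smo_coord i).diff x)]
  simp only [ContinuousLinearMap.smul_apply, smul_eq_mul]; rw [h1]; simp only [eq_comm]; ring
lemma pd_chv (c : Ctx P) {v : EF} (hv : Smo v) (i : Fin 3) : pd i (fun x => ch c x * v x) = fun x => -2 * (x i / Tc c ^ 2) * v x + ch c x * pd i v x := by
  funext x
  rw [pd_mul (ch_smo c) hv, pd_ch]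
lemma pd_chv2 (c : Ctx P) {v : EF} (hv : Smo v) (i j : Fin 3) : pd j (pd i (fun x => ch c x * v x)) = fun x => (if i = j then 1 else 0) * (-2 / Tc c ^ 2) * v x
    + -2 * (x i / Tc c ^ 2) * pd j v x + (-2 * (x j / Tc c ^ 2) * pd i v x + ch c x * pd j (pd i v) x) := by
  have s1 : Smo (fun x : E3 => -2 * (x i / Tc c ^ 2)) := by
    have := smo_coord i; unfold Smo at *; exact contDiff_const.mul (this.div_const _)
  rw [pd_chv c hv]
  funext x
  have s2 : Smo (fun x : E3 => -2 * (x i / Tc c ^ 2) * v x) := ContDiff.mul s1 hv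
  have s3 : Smo (fun x : E3 => ch c x * pd i v x) := ContDiff.mul (ch_smo c) (hv.pd i)
  rw [pd_add s2 s3, pd_mul s1 hv, pd_xT, pd_chv c (hv.pd i)]
lemma Sb4' {k : ℕ} (hk : k + 4 ≤ P.N) {A : Op} (hA : A ∈ Sg k) : SU (fun (c : Ctx P) x => ch c x * sl A c x) BB := by
  have hgd := gd_Sg (P := P) k A hA
  have h0 : NF (sl (P := P) A) DD := Sb1 bo hA
  obtain ⟨α, β, l, hl, rfl⟩ := hA
  have h1 : ∀ i : Fin 3, NF (sl (P := P) (G (cs i.succ :: cs α :: cs β :: l))) DD := fun i => nf_appD (m := [cs i.succ, cs α]) β (by simp; omega)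
  have cd : ∀ i, ∀ ψ, Adm P ψ → SF P.M (G (cs i :: cs α :: cs β :: l) ψ) := fun i ψ h => h.g _
  refine suSob BB_nn (fun c => TF.mul_left (ch_smo c) (sl_g _ c)) (fun i => ?_) (fun i j => ?_)
  · simp only [pd_chv _ (sl_g _ _).1, pd_slg]
    refine NF.add ?_ ((nf_Y (by simp; omega) _ _).le (Le.of Y_BB))
    simpa only [mul_assoc] using (nf_xB hgd h0 i).smul (-2)
  · simp only [pd_chv2 _ (sl_g _ _).1, pd_slg]
    refine NF.add (NF.add ?_ ?_) (NF.add ?_ ((nf_Y (by simp; omega) _ _).le (Le.of Y_BB)))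
    · have := (nf_TB h0).smul ((if i = j then 1 else 0) * (-2))
      simpa only [mul_assoc, div_eq_mul_inv] using this
    · simpa only [mul_assoc] using (nf_xB (cd j.succ) (h1 j) i).smul (-2)
    · simpa only [mul_assoc] using (nf_xB (cd i.succ) (h1 i) j).smul (-2)
lemma Sb4 {k : ℕ} (hk : k + 4 ≤ P.N) {A : Op} (hA : A ∈ Sg k) : SU (sl (P := P) A) BB := by
  obtain ⟨C, hC, h⟩ := Sb4' hk hA
  obtain ⟨C', hC', h'⟩ := Sb2 hk hA
  refine ⟨4 / 3 * C + 2 * C', by positivity, fun c x => ?_⟩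
  have hB := BB_nn c
  rcases ch_dich c x with h1 | h1
  · have := h c x
    rw [abs_mul] at this
    have h2 := mlr h1 (abn (sl A c x))
    nlinarith [mnn hC' hB]
  · have := h' c x
    rw [abs_mul, abs_of_pos (om0 x)] at this
    have hT := Tc0 c
    have h2 := mlr h1 (abn (sl A c x))
    have h3 : |sl A c x| ≤ 2 * C' * ((Tc c)⁻¹ * DD c) := by
      rw [← mul_le_mul_iff_right₀ hT]
      calc _ ≤ _ := h2
        _ ≤ 2 * (C' * DD c) := by linarith
        _ = _ := by field_simp
    have := mll (TD_BB c) (by positivity : 0 ≤ 2 * C')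
    nlinarith [mnn hC hB]
lemma Sb5 {k : ℕ} (hk : k < P.N) {A : Op} (hA : A ∈ Sg k) : NF (fun (c : Ctx P) x => (om x)⁻¹ * sl A c x) BB := by
  have h1 := ((Sb3 hk hA).le (Le.of Y_BB)).abs
  have h2 := ((NF.tmul (fun c : Ctx P => (Tc c)⁻¹) (fun c => (inv_pos.2 (Tc0 c)).le) (Sb1 hk hA)).le (Le.of TD_BB)).abs
  refine NF.dom (fun c => (sl_tf (gd_Sg k A hA c.ψ c.adm)).cc.mulL omi_cont) 2 (fun c x => ?_) (h1.add h2)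
  have hT := Tc0 c; have ho := om0 x
  rw [abs_of_nonneg (a := |_| + |_|) bp, abs_mul, abs_mul, abs_mul, abs_of_pos (inv_pos.2 hT), abs_of_pos (inv_pos.2 ho), ← add_mul, ← mul_assoc]
  refine mlr ?_ (abn _)
  have i1 := inv_pos.2 hT
  rcases ch_dich c x with h | h
  · have : (om x)⁻¹ ≤ 1 := inv_le_one_of_one_le₀ (om1 x)
    linarith
  · have : (om x)⁻¹ ≤ 2 * (Tc c)⁻¹ := by
      rw [← div_eq_mul_inv, le_div_iff₀ hT, inv_mul_le_iff₀ ho]; linarith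
    linarith [abn (ch c x)]
end
section
variable {P : Prm}
lemma e_nn (c : Ctx P) : 0 ≤ c.e := c.he0.le
lemma su1 {F : Ctx P → EF} (h : SU F (fun c => c.e)) : ∃ C : ℝ, 0 ≤ C ∧ ∀ c x, |F c x| ≤ C := by
  obtain ⟨C, hC, h⟩ := h
  exact ⟨C, hC, fun c x => (h c x).trans (by nlinarith [c.he1])⟩
lemma qa {b k : ℕ} (hb : b + k ≤ P.N) (hk : k < P.N) {A B : Op} (hA : A ∈ Fg P b) (hB : B ∈ Sg k) :
    NF (fun (c : Ctx P) x => om x * (sl A c x * sl B c x)) (fun c => c.e * DD c) := by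
  have hcc : ∀ c : Ctx P, CC (fun x => om x * (sl A c x * sl B c x)) := fun c =>
    CC.mulL om_cont (CC.mulL (sl_tf (gd_Fg b A hA c.ψ c.adm)).cc.1 (sl_tf (gd_Sg k B hB c.ψ c.adm)).cc)
  have := P.hN
  by_cases h : b + 3 ≤ P.N
  · exact SU.nf e_nn hcc (F1 h hA) (Sb1 hk hB) 1 (fun c x => by rw [one_mul, mul_assoc])
  · have := SU.nf DD_nn hcc (Sb2 bo hB) (F2 bo hA) 1 (fun c x => by rw [one_mul]; apply le_of_eq; congr 1; ring)
    simpa only [mul_comm] using this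
lemma qb {b k : ℕ} (hb : b + k ≤ P.N) (hk : k < P.N) {A B : Op} (hA : A ∈ Fg P b) (hB : B ∈ Sg k) :
    NF (fun (c : Ctx P) x => sl A c x * sl B c x) (fun c => c.e * BB c) := by
  have hcc : ∀ c : Ctx P, CC (fun x => (sl A c x * sl B c x)) := fun c =>
    (CC.mulL (sl_tf (gd_Fg b A hA c.ψ c.adm)).cc.1 (sl_tf (gd_Sg k B hB c.ψ c.adm)).cc)
  have := P.hN
  by_cases h : b + 3 ≤ P.N
  · exact SU.nf e_nn hcc (F1 h hA) (Sb5 hk hB) 1 (fun c x => by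
      rw [one_mul]; apply le_of_eq; congr 1; have := (om0 x).ne'; field_simp)
  · have := SU.nf BB_nn hcc (Sb4 bo hB) (F2 bo hA) 1 (fun c x => by rw [one_mul]; apply le_of_eq; congr 1; ring)
    simpa only [mul_comm] using this
lemma cub {b b' k : ℕ} (hb : b + b' + k ≤ P.N) {A A' B : Op} (hA : A ∈ Fg P b) (hA' : A' ∈ Fg P b') (hB : B ∈ Sg k) {ω : EF} (hω : Continuous ω) {d : Ctx P → ℝ}
    (H : ∀ b A, b + k ≤ P.N → A ∈ Fg P b → NF (fun (c : Ctx P) x => ω x * (sl A c x * sl B c x)) d) :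
    NF (fun (c : Ctx P) x => ω x * (sl A c x * sl A' c x * sl B c x)) d := by
  have hcc : ∀ c : Ctx P, CC (fun x => ω x * (sl A c x * sl A' c x * sl B c x)) := fun c =>
    CC.mulL hω (CC.mulL ((sl_tf (gd_Fg b A hA c.ψ c.adm)).cc.1.mul (sl_tf (gd_Fg b' A' hA' c.ψ c.adm)).cc.1) (sl_tf (gd_Sg k B hB c.ψ c.adm)).cc)
  have := P.hN
  by_cases h : b + 3 ≤ P.N
  · obtain ⟨C, hC, h1⟩ := su1 (om_drop (F1 h hA))
    refine NF.dom hcc C (fun c x => ?_) (H b' A' bo hA')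
    calc _ = |sl A c x| * |ω x * (sl A' c x * sl B c x)| := by rw [← abs_mul]; congr 1; ring
      _ ≤ _ := mlr (h1 c x) (abn _)
  · obtain ⟨C, hC, h1⟩ := su1 (om_drop (F1 (b := b') bo hA'))
    refine NF.dom hcc C (fun c x => ?_) (H b A bo hA)
    calc _ = |sl A' c x| * |ω x * (sl A c x * sl B c x)| := by rw [← abs_mul]; congr 1; ring
      _ ≤ _ := mlr (h1 c x) (abn _)
lemma third {b k : ℕ} (hb : b + k ≤ P.N) {A B : Op} (hA : A ∈ Wt 0 (DG (b + 1))) (hB : B ∈ DG (k + 1)) :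
    NF (fun (c : Ctx P) x => om x * (sl A c x * sl B c x)) (fun c => DD c * DD c) := by
  have hcc : ∀ c : Ctx P, CC (fun x => om x * (sl A c x * sl B c x)) := fun c =>
    CC.mulL om_cont (CC.mulL (sl_tf ((gd_DG _).wt _ A hA c.ψ c.adm)).cc.1 (sl_tf (gd_DG _ B hB c.ψ c.adm)).cc)
  have := P.hN
  obtain ⟨s, _, hs, ⟨α, l, hl, rfl⟩, rfl⟩ := hA
  obtain ⟨β, m, hm, rfl⟩ := hB
  have e1 : ∀ c : Ctx P, Tc c ^ s ≤ 1 := fun c => by simpa using Tmono c hs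
  have key : ∀ (c : Ctx P) x, |om x * (sl (w s * G (cs α :: l)) c x * sl (G (cs β :: m)) c x)| ≤ 1 * |om x * sl (G (cs α :: l)) c x * sl (G (cs β :: m)) c x| := by
    intro c x
    rw [sl_w]
    calc _ = Tc c ^ s * |om x * sl (G (cs α :: l)) c x * sl (G (cs β :: m)) c x| := by
          rw [← abs_of_pos (Tp c s), ← abs_mul, abs_of_pos (Tp c s)]; congr 1; ring
      _ ≤ _ := mlr (e1 c) (abn _)
  by_cases h : b + 3 ≤ P.N
  · exact SU.nf DD_nn hcc (W bo α) ((nf_DG ⟨β, m, hm, rfl⟩).le (Le.of (DD_le bo))) 1 key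
  · refine SU.nf DD_nn hcc (W (l := m) bo β) ((nf_DG ⟨α, l, hl, rfl⟩).le (Le.of (DD_le bo))) 1 fun c x => (key c x).trans_eq ?_
    congr 2; ring
lemma Ra {n k : ℕ} (hn : n ≤ P.N) (hk : k ≤ P.N) {A : Op} (hA : Sp P (Rm P n k) A) : NF (fun (c : Ctx P) x => om x * sl A c x) (fun c => c.e * DD c) := by
  refine Sp.nfw (fun c => mnn (e_nn c) (DD_nn c)) (fun A hA => ?_) hA
  rcases hA with (⟨b, c', h1, h2, B, C, hB, hC, rfl⟩ | ⟨b, b', c', h1, h2, _, C, ⟨B, B', hB, hB', rfl⟩, hC, rfl⟩) | ⟨b, c', h1, B, C, hB, hC, rfl⟩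
  · exact qa bo bo hB hC
  · exact cub bo hB hB' hC om_cont fun b A hb hA => qa hb bo hA hC
  · refine (third bo hB hC).le (Le.of fun c => mlr (D_le_e c) (DD_nn c))
lemma Rb {n k : ℕ} (hn : n ≤ P.N) (hk : k ≤ P.N) {A : Op} (hA : Sp P (Rm P n k) A) : NF (sl (P := P) A) (fun c => c.e * BB c) := by
  refine Sp.nf (fun c => mnn (e_nn c) (BB_nn c)) (fun A hA => ?_) hA
  have hg := gd_Rm n k A hA
  rcases hA with (⟨b, c', h1, h2, B, C, hB, hC, rfl⟩ | ⟨b, b', c', h1, h2, _, C, ⟨B, B', hB, hB', rfl⟩, hC, rfl⟩) | ⟨b, c', h1, B, C, hB, hC, rfl⟩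
  · exact qb bo bo hB hC
  · have := cub (P := P) (ω := fun _ => 1) (d := fun c => c.e * BB c) bo hB hB' hC continuous_const fun b A hb hA => by simpa only [one_mul] using qb hb bo hA hC
    simp only [one_mul] at this
    exact this
  · have h := (third (P := P) bo hB hC).le (b' := fun c => c.e * BB c) (Le.of fun c => ?_)
    · refine NF.dom (fun c => (sl_tf (hg c.ψ c.adm)).cc) 1 (fun c x => ?_) h
      change |sl B c x * sl C c x| ≤ _
      rw [one_mul, abs_mul (om x), abs_of_pos (om0 x)]
      exact le_mul_of_one_le_left (abn _) (om1 x)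
    · calc DD c * DD c ≤ (Tc c ^ (-P.lam) * c.e) * DD c := mlr (D_e' c) (DD_nn c)
        _ = c.e * (Tc c ^ (-P.lam) * DD c) := by ring
        _ ≤ _ := mll (by unfold BB; linarith [Y_nn c]) (e_nn c)
lemma R2i {n k : ℕ} (hn : n ≤ P.N) (hk : k ≤ P.N) {A : Op} (hA : Sp P (Rm P n k) A) {l : W8} (hl : l.length ≤ P.N) :
    Le (fun c : Ctx P => |∫ x, sl (G l) c x * sl A c x|) (fun c => c.e * DD c ^ 2) := by
  refine Le.trans (Le.of fun c => le_of_eq ?_) ((NF.int DD_nn (Hd (n := P.N + 1) (l := l) bo) (Ra hn hk hA)).trans (Le.of fun c => le_of_eq ?_))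
  · congr 2; funext x; have := (om0 x).ne'; field_simp
  · ring
end
section
variable {P : Prm}
lemma xi_le {M : ℝ} (hM : 0 < M) (k : Fin 8) (β : Fin 4) (p : Pt) (hp : 0 < p.1) (hx : ‖p.2‖ ≤ (1 + M) * (1 + p.1)) : |xi k β p| ≤ (1 + M) * (1 + p.1) := by
  have h : ∀ i : Fin 3, |p.2 i| ≤ (1 + M) * (1 + p.1) := fun i => (PiLp.norm_apply_le p.2 i).trans hx
  have h0 := h 0; have h1 := h 1; have h2 := h 2
  have h3 : 1 ≤ (1 + M) * (1 + p.1) := by nlinarith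
  have h4 : p.1 ≤ (1 + M) * (1 + p.1) := by nlinarith
  have h5 : 0 ≤ (1 + M) * (1 + p.1) := by linarith
  fin_cases k <;> fin_cases β <;> simp [xi, cc, co, Fin.sum_univ_four] <;> first | assumption | (rw [abs_of_pos hp]; assumption)
/-- bounded multiplication on the support -/
lemma nf_bd {F : Ctx P → EF} {b : Ctx P → ℝ} (hz : ∀ c x, (1 + P.M) * Tc c < ‖x‖ → F c x = 0) (h : NF F b) (K : Ctx P → EF) (hK : ∀ c, Continuous (K c)) (C : ℝ)
    (hC : ∀ c x, ‖x‖ ≤ (1 + P.M) * Tc c → |K c x| ≤ C) : NF (fun c x => K c x * F c x) b := by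
  refine NF.dom (fun c => (h.1 c).mulL (hK c)) C (fun c x => ?_) h
  by_cases hx : (1 + P.M) * Tc c < ‖x‖
  · rw [hz c x hx]; simp
  · rw [abs_mul]; exact mlr (hC c x (not_lt.1 hx)) (abn _)
lemma hzA {A : Op} (hA : ∀ ψ, Adm P ψ → SF P.M (A ψ)) : ∀ (c : Ctx P) x, (1 + P.M) * Tc c < ‖x‖ → sl A c x = 0 := fun c _ hx => sl_supp (hA c.ψ c.adm) hx
lemma hzg (l : W8) : ∀ (c : Ctx P) x, (1 + P.M) * Tc c < ‖x‖ → sl (G l) c x = 0 := hzA fun _ h => h.g l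
lemma nf_gam {n : ℕ} {m : W8} (k : Fin 8) (hm : m.length < n) : NF (sl (P := P) (G (k :: m))) (fun c => Tc c * Dm n c) := by
  have h1 : ∀ β, NF (fun (c : Ctx P) x => (xi k β (c.t, x) / Tc c) * sl (G (cs β :: m)) c x) (Dm n) := by
    intro β
    refine nf_bd (hzg _) (nf_DG ⟨β, m, hm, rfl⟩) _ (fun c => ?_) (1 + P.M) (fun c x hx => ?_)
    · refine Continuous.div_const ?_ _
      fin_cases k <;> fin_cases β <;> simp [xi, cc, co, Fin.sum_univ_four] <;> fun_prop
    · rw [abs_div, abs_of_pos (Tc0 c), div_le_iff₀ (Tc0 c)]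
      exact xi_le P.hM k β (c.t, x) c.ht hx
  have h2 := NF.tmul Tc (fun c => (Tc0 c).le) (NF.sum Finset.univ (Dm_nn n) fun β _ => h1 β)
  have e : sl (P := P) (G (k :: m)) = fun c x => Tc c * ∑ β, (xi k β (c.t, x) / Tc c) * sl (G (cs β :: m)) c x := by
    funext c x
    change Gam k (G m c.ψ) (c.t, x) = _
    rw [gam_eq, Finset.mul_sum]
    refine fsc fun β _ => ?_
    unfold sl; rw [G_cs, ← mul_assoc, mul_div_cancel₀ _ (Tc0 c).ne']
  rw [e]; exact h2
lemma Sp.box {S : Set Op} (h : ∀ A ∈ S, SO P A) {A : Op} (hA : Sp P S A) : Sp P {B | ∃ A ∈ S, B = boxO A} (boxO A) := by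
  induction hA with
  | of A hA => exact .of _ ⟨A, hA, rfl⟩
  | zero =>
    refine .congr 0 _ (fun ψ _ p _ => ?_) .zero
    change 0 = _root_.box (fun _ => 0) p
    have z : ∀ α, Dop α (fun _ : Pt => (0 : ℝ)) = fun _ => 0 := fun α => funext fun p => D_const 0 α p
    rw [box_eq]; simp [z]
  | add A B hA hB h1 h2 => exact .congr _ _ (fun ψ hψ p hp => (box_add (hA.so h ψ hψ) (hB.so h ψ hψ) p hp).symm) (.add _ _ h1 h2)
  | smul c A hA ih => exact .congr _ _ (fun ψ hψ p hp => (box_smul c (hA.so h ψ hψ) p hp).symm) (.smul c _ ih)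
  | congr A B e hA ih => exact .congr _ _ (fun ψ hψ p hp => box_congr (e ψ hψ) p hp) ih
lemma nf_w {A : Op} {b : Ctx P → ℝ} {s : ℝ} (h : NF (sl (P := P) A) b) : NF (sl (w s * A)) (fun c => Tc c ^ s * b c) := NF.tmul (fun c => Tc c ^ s) (fun c => (Tp c s).le) h
lemma nf_EE {n : ℕ} {A : Op} (hA : Sp P (EE n) A) : NF (sl (P := P) A) (fun c => (Tc c)⁻¹ * Dm n c) := by
  refine Sp.nf (fun c => mnn (inv_pos.2 (Tc0 c)).le (Dm_nn n c)) (fun A hA => ?_) hA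
  rcases hA with ⟨s, B, hs, hB, rfl⟩ | ⟨s, _, hs, ⟨l, hl, rfl⟩, rfl⟩
  · refine (nf_w (nf_DG hB)).le (Le.of fun c => mlr ?_ (Dm_nn n c))
    rw [← rpow_neg_one]; exact Tmono c hs
  · refine (nf_w (Po hl)).le (Le.of fun c => ?_)
    rw [← mul_assoc]
    refine mlr ?_ (Dm_nn n c)
    have h := Tmono c hs
    rw [show (-2 : ℝ) = -1 + -1 by norm_num, rpow_add (Tc0 c), rpow_neg_one] at h
    have hT := Tc0 c
    calc Tc c ^ s * Tc c ≤ ((Tc c)⁻¹ * (Tc c)⁻¹) * Tc c := mlr h hT.le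
      _ = _ := by field_simp
def bx (n : ℕ) (c : Ctx P) : ℝ := Tc c ^ (-P.lam) * Dm n c + c.e * BB c
lemma bx_nn (n : ℕ) (c : Ctx P) : 0 ≤ bx n c := add_nonneg (mnn (Tp c _).le (Dm_nn n c)) (mnn (e_nn c) (BB_nn c))
lemma bx1 (n : ℕ) (c : Ctx P) : Tc c ^ (-P.lam) * Dm n c ≤ bx n c := by unfold bx; linarith [mnn (e_nn c) (BB_nn c)]
lemma bx2 (n : ℕ) (c : Ctx P) : c.e * BB c ≤ bx n c := by unfold bx; linarith [mnn (Tp c (-P.lam)).le (Dm_nn n c)]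
lemma bx3 (n : ℕ) (c : Ctx P) : (Tc c)⁻¹ * Dm n c ≤ bx n c := (mlr (Ti c) (Dm_nn n c)).trans (bx1 n c)
lemma Box {n : ℕ} (hn : n ≤ P.N) : ∀ k (l : W8), l.length = k → l.length < n → NF (sl (P := P) (boxO (G l))) (bx n) := by
  intro k
  induction k using Nat.strong_induction_on with
  | _ k ih =>
  intro l hlk hln
  obtain ⟨R, V, E, hR, hV, hE, hs⟩ := star (P := P) l
  have h1 := (Rb bo bo (PO_mem (P := P) l)).le (Le.of (bx2 n))
  have h2 := (Rb bo bo hR).le (Le.of (bx2 n))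
  have h3 : NF (sl (P := P) (boxO V)) (bx n) := by
    refine Sp.nf (bx_nn n) ?_ (Sp.box (gd_GG _).so hV)
    rintro _ ⟨_, ⟨m, hm, rfl⟩, rfl⟩
    exact ih m.length bo m rfl bo
  have h4 := ((nf_EE (hE.mono (EE_mono (by omega : l.length ≤ n)))).le (Le.of (bx3 n)))
  have hd := nf_DG (P := P) (n := n) ⟨0, l, hln, rfl⟩
  have h5 := ((nf_w (s := -P.lam) hd).le (Le.of (bx1 n))).smul (-P.μ)
  have h6 := ((nf_w (s := -1) hd).le (Le.of (b := bx n) fun c => by rw [rpow_neg_one]; exact bx3 n c)).smul (-(2 * P.lam))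
  have hG : Sp P (EE n) (w (-2) * G l) := .of _ (.inr ⟨-2, _, le_rfl, ⟨l, hln, rfl⟩, rfl⟩)
  have h7 := ((nf_EE hG).le (Le.of (bx3 n))).smul (P.lam * (1 - P.lam))
  have := (((h1.add h2).add h3).add h4).add ((h5.add h6).add h7)
  convert this using 2 with c
  funext x
  have h := hs c.ψ c.adm (c.t, x) c.ht
  change LO P (G l) c.ψ (c.t, x) = sl (PO P l) c x + sl R c x + sl (boxO V) c x + sl E c x at h
  rw [← h]
  change sl (boxO (G l)) c x = (sl (boxO (G l)) c x + P.μ * sl (w (-P.lam) * G (cs 0 :: l)) c x + (2 * P.lam) * sl (w (-1) * G (cs 0 :: l)) c x + (-(P.lam * (1 - P.lam))) * sl (w (-2) * G l) c x) + _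
  ring
lemma Box' {n : ℕ} (hn : n ≤ P.N) {V : Op} (hV : Sp P (GG n) V) : NF (sl (P := P) (boxO V)) (bx n) := by
  refine Sp.nf (bx_nn n) ?_ (Sp.box (gd_GG _).so hV)
  rintro _ ⟨_, ⟨m, hm, rfl⟩, rfl⟩
  exact Box hn _ m rfl hm
end
section
variable {P : Prm}
def bY (c : Ctx P) : ℝ := Tc c ^ (-P.lam) * DD c + c.e * BB c
lemma bY_nn (c : Ctx P) : 0 ≤ bY c := bx_nn (P.N + 1) c
lemma bY3 (c : Ctx P) : (Tc c)⁻¹ * DD c ≤ bY c := bx3 (P.N + 1) c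
lemma bx_bY {n : ℕ} (hn : n ≤ P.N) (c : Ctx P) : bx n c ≤ bY c := by
  unfold bx bY; have := mll (DD_le (by omega : n ≤ P.N + 1) c) (Tp c (-P.lam)).le; linarith
lemma nfTi {F : Ctx P → EF} (h : NF F DD) : NF (fun c x => (Tc c)⁻¹ * F c x) bY := (NF.tmul (fun c => (Tc c)⁻¹) (fun c => (inv_pos.2 (Tc0 c)).le) h).le (Le.of bY3)
lemma nfx {l : W8} (h : NF (sl (P := P) (G l)) DD) (i : Fin 3) : NF (fun (c : Ctx P) x => x i / Tc c ^ 2 * sl (G l) c x) bY := (nf_x (fun _ h => h.g l) h i).le (Le.of bY3)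
lemma nfBox {l : W8} (hl : l.length < P.N) : NF (sl (P := P) (boxO (G l))) bY := (Box le_rfl _ l rfl hl).le (Le.of (bx_bY le_rfl))
lemma hzB (l : W8) : ∀ (c : Ctx P) x, (1 + P.M) * Tc c < ‖x‖ → sl (boxO (G l)) c x = 0 := hzA fun ψ h => (h.g l).box
lemma nr_le (c : Ctx P) (x : E3) (hx : ‖x‖ ≤ (1 + P.M) * Tc c) : |‖x‖ ^ 2 / Tc c ^ 2| ≤ (1 + P.M) ^ 2 := by
  have hT := Tc0 c
  rw [abs_of_nonneg bp, div_le_iff₀ bp, ← mul_pow]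
  exact pow_le_pow_left₀ (norm_nonneg x) hx 2
lemma ch_le (c : Ctx P) (x : E3) (hx : ‖x‖ ≤ (1 + P.M) * Tc c) : |ch c x| ≤ 1 + (1 + P.M) ^ 2 := by
  unfold ch; exact (abs_sub _ _).trans (by simpa using nr_le c x hx)
lemma Ytt {l : W8} (hl : l.length < P.N) : NF (fun (c : Ctx P) x => ch c x * sl (G (cs 0 :: cs 0 :: l)) c x) bY := by
  have a1 : NF (sl (G (cs 0 :: 7 :: l))) DD := nf_appD (m := []) 0 (by simp; omega)
  have a2 : NF (sl (P := P) (G (cs 0 :: cs 0 :: l))) DD := nf_appD (m := [cs 0]) 0 (by simp; omega)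
  have a3 : ∀ i : Fin 3, NF (sl (G (cs i.succ :: 7 :: l))) DD := fun i => nf_appD (m := []) _ (by simp; omega)
  have a4 : ∀ i : Fin 3, NF (sl (P := P) (G (cs i.succ :: cs 0 :: l))) DD := fun i => nf_appD (m := [cs i.succ]) _ (by simp; omega)
  have a5 : NF (sl (P := P) (G (cs 0 :: l))) DD := nf_appD (m := []) _ (by simp; omega)
  have a6 : ∀ i : Fin 3, NF (sl (P := P) (G (cs i.succ :: l))) DD := fun i => nf_appD (m := []) _ (by simp; omega)
  have a7 : ∀ k : Fin 8, NF (fun (c : Ctx P) x => (Tc c ^ 2)⁻¹ * sl (G (k :: k :: l)) c x) bY := fun k => by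
    refine (NF.tmul (fun c : Ctx P => (Tc c ^ 2)⁻¹) (fun c => by have := Tc0 c; positivity) (nf_gam (n := P.N + 1) k (by simp; omega))).le (Le.of fun c => ?_)
    refine le_trans (le_of_eq ?_) (bY3 c)
    have := Tc0 c; unfold DD; field_simp
  have a8 := nf_bd (hzB l) (nfBox hl) (fun c x => ‖x‖ ^ 2 / Tc c ^ 2) (fun c => by fun_prop) _ nr_le
  have b1 := (nfTi a1).add (nfTi a2)
  have b2 := NF.sum Finset.univ bY_nn fun i _ => (nfx (a3 i) i).add (nfx (a4 i) i)
  have b3 := ((a7 4).add (a7 5)).add (a7 6)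
  have b4 := NF.sum Finset.univ bY_nn fun i _ => (nfx (a6 i) i)
  have := b1.add ((((b2.add b3).add (nfTi a5)).add b4).add a8 |>.smul (-1))
  convert this using 2 with c
  funext x
  have h := ks (c.adm.g l).1 (c.t, x) c.ht
  have hT := Tc0 c
  change (Tc c ^ 2 - ‖x‖ ^ 2) * _ = Tc c * _ - _ - _ - Tc c * _ - _ - ‖x‖ ^ 2 * _ at h
  have s7 : Gam 7 (G l c.ψ) = G (7 :: l) c.ψ := rfl
  have s4 : ∀ k, Gam k (Gam k (G l c.ψ)) (c.t, x) = sl (G (k :: k :: l)) c x := fun k => rfl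
  simp only [s7, s4, ← G_cs] at h
  change (Tc c ^ 2 - ‖x‖ ^ 2) * sl (G (cs 0 :: cs 0 :: l)) c x = Tc c * (sl (G (cs 0 :: 7 :: l)) c x + sl (G (cs 0 :: cs 0 :: l)) c x) - (∑ i : Fin 3, x i * (sl (G (cs i.succ :: 7 :: l)) c x + sl (G (cs i.succ :: cs 0 :: l)) c x))
     - _ - Tc c * sl (G (cs 0 :: l)) c x - (∑ i : Fin 3, x i * sl (G (cs i.succ :: l)) c x) - ‖x‖ ^ 2 * sl (boxO (G l)) c x at h
  have e : ch c x = (Tc c ^ 2 - ‖x‖ ^ 2) / Tc c ^ 2 := by unfold ch; field_simp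
  rw [e, div_mul_eq_mul_div, h]
  simp only [fs3]
  field_simp
  ring
lemma Yij {l : W8} (hl : l.length < P.N) (i j : Fin 3) : NF (fun (c : Ctx P) x => ch c x * sl (G (cs j.succ :: cs i.succ :: l)) c x) bY := by
  have a6 : ∀ i : Fin 3, NF (sl (P := P) (G (cs i.succ :: l))) DD := fun i => nf_appD (m := []) _ (by simp; omega)
  have a0 : NF (fun (c : Ctx P) x => (Tc c ^ 2)⁻¹ * sl (G l) c x) bY := by
    refine (NF.tmul (fun c : Ctx P => (Tc c ^ 2)⁻¹) (fun c => by have := Tc0 c; positivity) (Po (n := P.N + 1) (l := l) bo)).le (Le.of fun c => ?_)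
    refine le_trans (le_of_eq ?_) (bY3 c)
    have := Tc0 c; unfold DD; field_simp
  have hL : NF (fun (c : Ctx P) x => ∑ i, pd i (pd i (fun x => ch c x * sl (G l) c x)) x) bY := by
    have b1 := Ytt hl
    have b2 := nf_bd (hzB l) (nfBox hl) ch ch_cont _ ch_le
    have b3 := NF.sum Finset.univ bY_nn fun i _ => (nfx (a6 i) i)
    have := ((b1.add (b2.smul (-1))).add (b3.smul (-4))).add (a0.smul (-6))
    convert this using 2 with c
    funext x
    simp only [pd_chv2 _ (sl_g _ _).1, pd_slg, fs3]
    have hb : sl (boxO (G l)) c x = sl (G (cs 0 :: cs 0 :: l)) c x - sl (G (cs 1 :: cs 1 :: l)) c x - sl (G (cs 2 :: cs 2 :: l)) c x - sl (G (cs 3 :: cs 3 :: l)) c x := by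
      unfold sl; simp only [G_cs]; exact box_eq _ _
    rw [hb]
    simp only [show (Fin.succ 0 : Fin 4) = 1 from rfl, show (Fin.succ 1 : Fin 4) = 2 from rfl, show (Fin.succ 2 : Fin 4) = 3 from rfl]
    simp only [if_true]
    ring
  have hv : NF (fun (c : Ctx P) => pd j (pd i (fun x => ch c x * sl (G l) c x))) bY := by
    have tf : ∀ c : Ctx P, TF (fun x => ch c x * sl (G l) c x) := fun c => TF.mul_left (ch_smo c) (sl_g l c)
    refine ⟨fun c => ((tf c).pd i |>.pd j).cc, (Le.of fun c => ?_).trans hL.2⟩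
    refine nm_le (nm_nn _) ?_
    rw [nm_sq]
    set v := fun x => ch c x * sl (G l) c x with hv
    have cc : ∀ i j, CC (pd i (pd j v)) := fun i j => ((tf c).pd j |>.pd i).cc
    have h1 : ∫ x, (∑ i, pd i (pd i v) x) ^ 2 = ∑ i, ∑ j, ∫ x, pd i (pd j v) x ^ 2 := by
      have tv : TF v := tf c
      simp only [ell tv]
      have : ∀ x, (∑ i, pd i (pd i v) x) ^ 2 = ∑ i, ∑ j, pd i (pd i v) x * pd j (pd j v) x := fun x => by rw [sq, Finset.sum_mul_sum]
      simp only [this]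
      rw [integral_finsetSum _ fun i _ => (CC.sum _ fun j _ => (cc j j).mulL (cc i i).1).int]
      refine fsc fun i _ => ?_
      rw [integral_finsetSum _ fun j _ => ((cc j j).mulL (cc i i).1).int]
    rw [h1]
    refine le_trans ?_ (Finset.single_le_sum (f := fun i => ∑ j, ∫ x, pd i (pd j v) x ^ 2) (fun _ _ => fsn fun _ _ => integral_nonneg fun _ => sqn _) (Finset.mem_univ j))
    exact Finset.single_le_sum (f := fun i => ∫ x, pd j (pd i v) x ^ 2) (fun _ _ => integral_nonneg fun _ => sqn _) (Finset.mem_univ i)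
  have := (hv.add (((nfx (a6 j) i).add (nfx (a6 i) j)).smul 2)).add (a0.smul (2 * if i = j then 1 else 0))
  convert this using 2 with c
  funext x
  simp only [pd_chv2 _ (sl_g _ _).1, pd_slg]
  ring
lemma Yti {l : W8} (hl : l.length < P.N) (i : Fin 3) : NF (fun (c : Ctx P) x => ch c x * sl (G (cs 0 :: cs i.succ :: l)) c x) bY := by
  have a1 : NF (sl (P := P) (G (7 :: cs i.succ :: l))) DD := nf_appD (m := [7]) _ (by simp; omega)
  have a2 : NF (sl (P := P) (G (cs 0 :: cs i.succ :: l))) DD := nf_appD (m := [cs 0]) _ (by simp; omega)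
  have b1 := (nfTi (nf_bd (hzg _) a1 ch ch_cont _ ch_le)).add (nfTi (nf_bd (hzg _) a2 ch ch_cont _ ch_le))
  have b2 := NF.sum Finset.univ bY_nn fun (j : Fin 3) _ => nf_bd (F := fun (c : Ctx P) x => ch c x * sl (G (cs j.succ :: cs i.succ :: l)) c x) (fun c x hx => by rw [hzg _ c x hx, mul_zero]) (Yij hl i j)
    (fun c x => x j / Tc c) (fun c => by fun_prop) (1 + P.M) (fun c x hx => by
      rw [abs_div, abs_of_pos (Tc0 c), div_le_iff₀ (Tc0 c)]; exact (PiLp.norm_apply_le x j).trans hx)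
  convert b1.add (b2.smul (-1)) using 2 with c
  funext x
  have h : sl (G (7 :: cs i.succ :: l)) c x = c.t * sl (G (cs 0 :: cs i.succ :: l)) c x + ∑ j : Fin 3, x j * sl (G (cs j.succ :: cs i.succ :: l)) c x := by
    unfold sl; simp only [G_cs _ (cs i.succ :: l)]
    simp [G, GamWord, Gam, Dop, fs3]
  rw [h]
  have hT := Tc0 c
  have ht : c.t = Tc c - 1 := by unfold Tc; ring
  simp only [fs3, ht]
  field_simp
  ring
lemma Yall {l : W8} (hl : l.length < P.N) (α β : Fin 4) : NF (fun (c : Ctx P) x => ch c x * sl (G (cs α :: cs β :: l)) c x) bY := by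
  rcases Fin.eq_zero_or_eq_succ α with rfl | ⟨i, rfl⟩ <;> rcases Fin.eq_zero_or_eq_succ β with rfl | ⟨j, rfl⟩
  · exact Ytt hl
  · exact Yti hl j
  · convert Yti hl i using 2 with c
    funext x; congr 1; unfold sl; rw [G_cs, G_cs, G_cs, G_cs]
    change Dop _ (Dop _ _) _ = _
    have e1 : G (cs 0 :: l) c.ψ = Dop 0 (G l c.ψ) := G_cs _ _ _
    have e2 : G (cs i.succ :: l) c.ψ = Dx i (G l c.ψ) := G_cs _ _ _
    exact D_comm (c.adm.g l).1 _ _ (c.t, x) c.ht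
  · exact Yij hl j i
lemma Y_le : Le (Y (P := P)) bY :=
  Le.sum _ bY_nn fun m hm => Le.sum _ bY_nn fun a _ => Le.sum _ bY_nn fun α _ => Le.sum _ bY_nn fun β _ => (Yall (by simpa using hm) α β).2
lemma Y_small : ∃ δ C : ℝ, 0 < δ ∧ 0 ≤ C ∧ ∀ c : Ctx P, c.e ≤ δ → Y c ≤ C * (Tc c ^ (-P.lam) * DD c) := by
  obtain ⟨C, hC, h⟩ := Y_le (P := P)
  refine ⟨1 / (2 * (C + 1)), 4 * C, by positivity, by positivity, fun c hc => ?_⟩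
  have h1 := h c
  unfold bY BB at h1
  have hx : 0 ≤ Tc c ^ (-P.lam) * DD c := mnn (Tp c _).le (DD_nn c)
  set X := Tc c ^ (-P.lam) * DD c
  rw [le_div_iff₀ bp] at hc
  have hY := Y_nn c
  have he := c.he1
  have he0 := c.he0
  have h2 : C * c.e * Y c ≤ 1 / 2 * Y c := mlr (by nlinarith) hY
  have h3 : C * c.e * X ≤ C * X := mlr (by nlinarith) hx
  nlinarith
end
section
variable {P : Prm}
lemma b3 : (0:ℕ) + 3 ≤ P.N := by have := P.hN; omega
lemma c0 {A : Op} (hA : Sp P (CF P) A) : SU (fun (c : Ctx P) x => om x * sl A c x) (fun c => c.e) := by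
  refine Sp.suw (ω := fun _ x => om x) e_nn (fun A hA => ?_) hA
  rcases hA with hA | ⟨B, C, hB, hC, rfl⟩
  · exact F1 b3 hA
  · obtain ⟨K, hK, h⟩ := su1 (om_drop (F1 b3 hB))
    refine SU.dom K hK (fun c x => ?_) (F1 b3 hC)
    calc |om x * (sl B c x * sl C c x)| = |sl B c x| * |om x * sl C c x| := by rw [← abs_mul]; congr 1; ring
      _ ≤ _ := mlr (h c x) (abn _)
lemma cgen {ω : EF} {b : Ctx P → ℝ} (hb : ∀ c, 0 ≤ b c) (k : Fin 8) (h : ∀ A ∈ Fg P 0, SU (fun (c : Ctx P) x => ω x * sl (gO k A) c x) b)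
    {A : Op} (hA : Sp P (CF P) A) : SU (fun (c : Ctx P) x => ω x * sl (gO k A) c x) b := by
  refine Sp.suw (S := {B | SU (fun (c : Ctx P) x => ω x * sl B c x) b}) (ω := fun _ x => ω x) hb (fun A hA => hA) (Sp.gam k gd_CF.so (fun A hA => ?_) hA)
  rcases hA with hA | ⟨B, C, hB, hC, rfl⟩
  · exact .of _ (h A hA)
  · refine .congr (gO k B * C + B * gO k C) _ (fun ψ hψ p hp => (gam_mul (gd_Fg 0 B hB ψ hψ).1 (gd_Fg 0 C hC ψ hψ).1 k p hp).symm) (.add _ _ (.of _ ?_) (.of _ ?_))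
    · obtain ⟨K, hK, h'⟩ := su1 (om_drop (F1 b3 hC))
      refine SU.dom K hK (fun c x => ?_) (h B hB)
      calc |ω x * (sl (gO k B) c x * sl C c x)| = |sl C c x| * |ω x * sl (gO k B) c x| := by rw [← abs_mul]; congr 1; ring
        _ ≤ _ := mlr (h' c x) (abn _)
    · obtain ⟨K, hK, h'⟩ := su1 (om_drop (F1 b3 hB))
      refine SU.dom K hK (fun c x => ?_) (h C hC)
      calc |ω x * (sl B c x * sl (gO k C) c x)| = |sl B c x| * |ω x * sl (gO k C) c x| := by rw [← abs_mul]; congr 1; ring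
        _ ≤ _ := mlr (h' c x) (abn _)
lemma c1 (k : Fin 8) {A : Op} (hA : Sp P (CF P) A) : SU (fun (c : Ctx P) x => om x * sl (gO k A) c x) (fun c => c.e) := by
  refine cgen e_nn k (fun A hA => ?_) hA
  exact Sp.suw (ω := fun _ x => om x) e_nn (fun A hA => F1 (b := 1) (by have := P.hN; omega) hA) (cl_Fg k 0 A hA)
lemma wD (s : ℝ) {B : Op} (hB : SO P B) (α : Fin 4) (c : Ctx P) (x : E3) : sl (gO (cs α) (w s * B)) c x =
    (if α = 0 then s * Tc c ^ (s - 1) else 0) * sl B c x + Tc c ^ s * sl (gO (cs α) B) c x := by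
  have h := gam_mul (sm_w s) (hB c.ψ c.adm) (cs α) (c.t, x) c.ht
  have h2 := D_w s (c.t, x) c.ht α
  rw [← gam_cs] at h2
  change Gam (cs α) (fun p => (1 + p.1) ^ s * B c.ψ p) (c.t, x) = _
  rw [h, h2]; rfl
lemma DDT (c : Ctx P) : DD c ≤ Tc c ^ P.lam * BB c := by
  have h : Tc c ^ P.lam * (Tc c ^ (-P.lam) * DD c) = DD c := by
    rw [← mul_assoc, ← rpow_add (Tc0 c), add_neg_cancel, rpow_zero, one_mul]
  rw [← h]; exact mll (by unfold BB; linarith [Y_nn c]) (Tp c _).le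
lemma c2 (α : Fin 4) {A : Op} (hA : Sp P (CF P) A) : SU (sl (P := P) (gO (cs α) A)) (fun c => Tc c ^ P.lam * BB c) := by
  have hN := P.hN
  have hb : ∀ c : Ctx P, 0 ≤ Tc c ^ P.lam * BB c := fun c => mnn (Tp c _).le (BB_nn c)
  suffices h : ∀ A ∈ Fg P 0, SU (fun (c : Ctx P) x => (1:ℝ) * sl (gO (cs α) A) c x) (fun c => Tc c ^ P.lam * BB c) by
    simpa using cgen (ω := fun _ => 1) hb (cs α) h hA
  intro A hA
  simp only [one_mul]
  have key : ∀ (s : ℝ) (B : Op), SO P B → s ≤ 1 → SU (sl (P := P) B) DD → SU (fun (c : Ctx P) x => Tc c ^ s * sl (gO (cs α) B) c x) (fun c => Tc c ^ P.lam * BB c) →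
      SU (sl (P := P) (gO (cs α) (w s * B))) (fun c => Tc c ^ P.lam * BB c) := by
    intro s B hB hs h1 h2
    have e : sl (P := P) (gO (cs α) (w s * B)) = fun c x => (if α = 0 then s * Tc c ^ (s - 1) else 0) * sl B c x + Tc c ^ s * sl (gO (cs α) B) c x := by
      funext c x; exact wD s hB α c x
    rw [e]
    refine SU.add (SU.dom |s| (abn s) (fun c x => ?_) (h1.le (Le.of DDT))) h2
    rw [abs_mul]; refine mlr ?_ (abn _)
    split_ifs
    · rw [abs_mul, abs_of_pos (Tp c _)]
      have : Tc c ^ (s - 1) ≤ 1 := by simpa using Tmono c (show s - 1 ≤ 0 by linarith)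
      nlinarith [abn s]
    · simp
  rcases hA with ⟨s, _, hs, ⟨l, hl, rfl⟩, rfl⟩ | ⟨s, _, hs, ⟨β, l, hl, rfl⟩, rfl⟩
  · obtain rfl : l = [] := by simpa using hl
    refine key s _ (fun ψ hψ => (hψ.g []).1) bl (su_Z DD_nn (fun i => nf_appD (m := []) i.succ bs) (fun i j => nf_appD (m := [cs j.succ]) i.succ (by simp; omega))) ?_
    have := om_drop (W (P := P) (l := []) (by simp; omega) α)
    refine SU.dom 1 zero_le_one (fun c x => ?_) (this.le (Le.of DDT))
    rw [abs_mul, abs_of_pos (Tp c s)]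
    refine mlr ?_ (abn _)
    simpa using Tmono c hs
  · obtain rfl : l = [] := by simpa using hl
    refine key s _ (fun ψ hψ => (hψ.g _).1) (by linarith [P.hlam1]) (om_drop (W (l := []) (by simp; omega) β)) ?_
    have := (Sb4 (P := P) (k := 0) bo ⟨α, β, [], by simp, rfl⟩).tmul (fun c => Tc c ^ P.lam) (fun c => (Tp c _).le)
    refine SU.dom 1 zero_le_one (fun c x => ?_) this
    rw [abs_mul, abs_of_pos (Tp c s), abs_mul, abs_of_pos (Tp c _), one_mul]
    exact mlr (Tmono c hs) (abn _)
end
def ip (f g : PF) (t : ℝ) : ℝ := ∫ x, f (t, x) * g (t, x)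
section
variable {M : ℝ} {t : ℝ}
lemma ip_int {f g : PF} (hf : Sm f) (hg : SF M g) (ht : 0 < t) : Integrable (fun x => f (t, x) * g (t, x)) :=
  ((SF.mulL hf hg).slice ht).cc.int
lemma ip_comm (f g : PF) : ip f g t = ip g f t := by unfold ip; simp only [mul_comm]
lemma ip_congr {f g f' g' : PF} (h : ∀ x, f (t, x) * g (t, x) = f' (t, x) * g' (t, x)) : ip f g t = ip f' g' t := by unfold ip; simp only [h]
lemma ip_add {f g h : PF} (hf : Sm f) (hg : SF M g) (hh : SF M h) (ht : 0 < t) : ip f (fun p => g p + h p) t = ip f g t + ip f h t := by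
  unfold ip; simp only [mul_add]; exact integral_add (ip_int hf hg ht) (ip_int hf hh ht)
lemma ip_smul (k : ℝ) (f g : PF) : ip f (fun p => k * g p) t = k * ip f g t := by
  unfold ip; simp only [mul_left_comm _ k]; exact integral_const_mul _ _
lemma ip_sum {ι : Type} (s : Finset ι) {f : PF} {g : ι → PF} (hf : Sm f) (hg : ∀ i ∈ s, SF M (g i)) (ht : 0 < t) : ip f (fun p => ∑ i ∈ s, g i p) t = ∑ i ∈ s, ip f (g i) t := by
  unfold ip; simp only [Finset.mul_sum]; exact integral_finsetSum _ fun i hi => ip_int hf (hg i hi) ht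
lemma ip_der {f g : PF} (hf : Sm f) (hg : SF M g) (ht : 0 < t) : HasDerivAt (ip f g) (ip (Dop 0 f) g t + ip f (Dop 0 g) t) t := by
  have h := dInt (SF.mulL hf hg) ht
  refine HasDerivAt.congr_deriv h ?_
  unfold ip
  rw [← integral_add (ip_int (hf.D 0) hg ht) (ip_int hf (hg.D 0) ht)]
  exact integral_congr_ae (.of_forall fun x => D_mul hf hg.1 0 (t, x) ht)
lemma ip_ibp {f g : PF} (hf : Sm f) (hg : SF M g) (ht : 0 < t) (i : Fin 3) : ip f (Dx i g) t = - ip (Dx i f) g t := ibpS hf hg ht i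
lemma ip_tri {f g h : PF} (hf : Sm f) (hg : Sm g) (hh : SF M h) (ht : 0 < t) (i : Fin 3) :
    ip f (fun p => g p * Dx i h p) t = - ip (Dx i f) (fun p => g p * h p) t - ip f (fun p => Dx i g p * h p) t := by
  have h1 := ip_ibp hf (SF.mulL hg hh) ht i
  have h2 : ip f (Dx i fun p => g p * h p) t = ip f (fun p => Dx i g p * h p + g p * Dx i h p) t :=
    ip_congr fun x => by rw [D_mul hg hh.1 i.succ (t, x) ht]
  rw [h2, ip_add hf (SF.mulL (hg.D _) hh) (SF.mulL hg (hh.D _)) ht] at h1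
  linarith
lemma ip_box {f g : PF} (hf : SF M f) (hg : SF M g) (ht : 0 < t) : ip f (Dop 0 (Dop 0 g)) t = ip f (box g) t - ∑ i : Fin 3, ip (Dx i f) (Dx i g) t := by
  have h : ip f (Dop 0 (Dop 0 g)) t = ip f (fun p => box g p + ∑ i : Fin 3, Dx i (Dx i g) p) t := ip_congr fun x => by
    rw [box_eq]; simp only [fs3]; simp; try ring_nf
  rw [h, ip_add hf.1 hg.box (SF.sum _ fun i _ => (hg.D _).D _) ht, ip_sum _ hf.1 (fun i _ => (hg.D _).D _) ht]
  simp only [ip_ibp hf.1 (hg.D _) ht, Finset.sum_neg_distrib]; ring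
end
section
variable (P : Prm)
def tw (t : ℝ) : ℝ := (1 + t) ^ P.lam
def kp (t : ℝ) : ℝ := P.μ / 2 + P.lam * (tw P t * (1 + t)⁻¹)
def hf (H : Fin 3 → Fin 3 → PF) (u : PF) (t : ℝ) : ℝ := ∑ i : Fin 3, ∑ j : Fin 3, ip (Dx i u) (fun p => H i j p * Dx j u p) t
def ee1 (u : PF) (t : ℝ) : ℝ := ip (Dop 0 u) (Dop 0 u) t + ∑ i : Fin 3, ip (Dx i u) (Dx i u) t
def X0 (u : PF) (t : ℝ) : ℝ := tw P t ^ 2 * ee1 u t + kp P t * (2 * tw P t * ip u (Dop 0 u) t + (P.μ + P.lam * (tw P t * (1 + t)⁻¹)) * ip u u t)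
def XX (H : Fin 3 → Fin 3 → PF) (u V : PF) (t : ℝ) : ℝ := X0 P u t - 2 * (kp P t * tw P t) * ip u (Dop 0 V) t + tw P t ^ 2 * hf H u t
def Err (H : Fin 3 → Fin 3 → PF) (q : Fin 3 → PF) (u V Q R E : PF) (t : ℝ) : ℝ :=
  2 * tw P t ^ 2 * (ip (Dop 0 u) R t + ip (Dop 0 u) (box V) t + ip (Dop 0 u) E t) + 2 * (kp P t * tw P t) * (ip u Q t + ip u R t + ip u E t)
  - 2 * ((P.lam * (tw P t * (1 + t)⁻¹)) * (kp P t - (1 - P.lam) * (tw P t * (1 + t)⁻¹))) * ip u (Dop 0 V) t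
  - 2 * (kp P t * tw P t) * (ip (Dop 0 u) (Dop 0 V) t - ∑ i : Fin 3, ip (Dx i u) (Dx i V) t)
  + 2 * (P.lam * (tw P t * (1 + t)⁻¹)) * tw P t * hf H u t
  + tw P t ^ 2 * ((∑ i : Fin 3, ∑ j : Fin 3, ip (Dx i u) (fun p => Dop 0 (H i j) p * Dx j u p) t)
    - 2 * (∑ i : Fin 3, ∑ j : Fin 3, ip (Dop 0 u) (fun p => Dx j (H i j) p * Dx i u p) t) + 2 * ∑ i : Fin 3, ip (Dop 0 u) (fun p => Dx i (q i) p * Dop 0 u p) t)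
variable {P}
lemma tw_der {t : ℝ} (ht : 0 < t) : HasDerivAt (tw P) (P.lam * (tw P t * (1 + t)⁻¹)) t := by
  have h0 : (0:ℝ) < 1 + t := by linarith
  have h1 : HasDerivAt (fun s : ℝ => 1 + s) 1 t := (hasDerivAt_id t).const_add 1
  have := h1.rpow_const (p := P.lam) (Or.inl h0.ne')
  refine HasDerivAt.congr_deriv this ?_
  rw [rpow_sub_one h0.ne', tw]; ring
lemma io_der {t : ℝ} (ht : 0 < t) : HasDerivAt (fun s : ℝ => (1 + s)⁻¹) (-((1 + t)⁻¹) ^ 2) t := by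
  have h0 : (0:ℝ) < 1 + t := by linarith
  have h1 : HasDerivAt (fun s : ℝ => 1 + s) 1 t := (hasDerivAt_id t).const_add 1
  refine (h1.inv h0.ne').congr_deriv ?_
  field_simp
lemma XX_der {u V Q R E : PF} {H : Fin 3 → Fin 3 → PF} {q : Fin 3 → PF} (hu : SF P.M u) (hV : SF P.M V) (hR : SF P.M R) (hE : SF P.M E)
    (hH : ∀ i j, Sm (H i j)) (hs : ∀ i j, H i j = H j i) (hq : ∀ i, Sm (q i))
    (hQ : ∀ p : Pt, 0 < p.1 → Q p = ∑ i : Fin 3, ∑ j : Fin 3, H i j p * Dx j (Dx i u) p + (-2) * ∑ i : Fin 3, q i p * Dx i (Dop 0 u) p)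
    (hF : ∀ p : Pt, 0 < p.1 → Lf P u p = Q p + R p + box V p + E p) {t : ℝ} (ht : 0 < t) :
    HasDerivAt (XX P H u V) (-(P.μ * (tw P t * ee1 u t)) - P.μ / 2 * P.lam * (1 - P.lam) * (tw P t * (1 + t)⁻¹ ^ 2) * ip u u t + Err P H q u V Q R E t) t := by
  have h0 : (0:ℝ) < 1 + t := by linarith
  have dτ := tw_der (P := P) ht
  have di := io_der ht
  have d0 := ip_der (hu.D 0).1 (hu.D 0) ht
  have d1 : HasDerivAt (fun t => ∑ i : Fin 3, ip (Dx i u) (Dx i u) t) _ t := HasDerivAt.fun_sum fun i _ => ip_der (hu.D (Fin.succ i)).1 (hu.D i.succ) ht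
  have d2 := ip_der hu.1 (hu.D 0) ht
  have d3 := ip_der hu.1 hu ht
  have d4 := ip_der hu.1 (hV.D 0) ht
  have d5 : HasDerivAt (hf H u) _ t := HasDerivAt.fun_sum fun i _ => HasDerivAt.fun_sum fun j _ => ip_der (hu.D (Fin.succ i)).1 (SF.mulL (hH i j) (hu.D j.succ)) ht
  have dk : HasDerivAt (kp P) _ t := ((dτ.mul di).const_mul P.lam).const_add (P.μ / 2)
  have D := (((dτ.pow 2).mul (d0.add d1)).add (dk.mul (((dτ.const_mul 2).mul d2).add ((((dτ.mul di).const_mul P.lam).const_add P.μ).mul d3)))).sub (((dk.mul dτ).const_mul 2).mul d4) |>.add ((dτ.pow 2).mul d5)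
  refine HasDerivAt.congr_deriv (f := XX P H u V) D ?_
  have sQ : SF P.M (fun p => ∑ i : Fin 3, ∑ j : Fin 3, H i j p * Dx j (Dx i u) p + (-2) * ∑ i : Fin 3, q i p * Dx i (Dop 0 u) p) :=
    (SF.sum _ fun i _ => SF.sum _ fun j _ => SF.mulL (hH i j) ((hu.D _).D _)).add ((SF.sum _ fun i _ => SF.mulL (hq i) ((hu.D _).D _)).smul _)
  have sQ' : SF P.M Q := sQ.congr fun p hp => (hQ p hp).symm
  have ibox : ∀ f, SF P.M f → ip f (box u) t = ip f Q t + ip f R t + ip f (box V) t + ip f E t - (P.μ * (tw P t)⁻¹ + 2 * P.lam * (1 + t)⁻¹) * ip f (Dop 0 u) t + P.lam * (1 - P.lam) * (1 + t)⁻¹ ^ 2 * ip f u t := by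
    intro f hf'
    have : ip f (box u) t = ip f (fun p => ((((Q p + R p) + box V p) + E p) + (-(P.μ * (tw P t)⁻¹ + 2 * P.lam * (1 + t)⁻¹)) * Dop 0 u p) + (P.lam * (1 - P.lam) * (1 + t)⁻¹ ^ 2) * u p) t := by
      refine ip_congr fun x => ?_
      have := hF (t, x) ht
      unfold Lf at this
      dsimp only at this
      rw [← this, tw, rpow_neg h0.le, rpow_neg h0.le, rpow_neg h0.le, rpow_one, rpow_two, ← inv_pow]; ring
    rw [this, ip_add hf'.1 ((((sQ'.add hR).add hV.box).add hE).add ((hu.D 0).smul _)) (hu.smul _) ht, ip_add hf'.1 (((sQ'.add hR).add hV.box).add hE) ((hu.D 0).smul _) ht,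
      ip_add hf'.1 ((sQ'.add hR).add hV.box) hE ht, ip_add hf'.1 (sQ'.add hR) hV.box ht, ip_add hf'.1 sQ' hR ht, ip_smul, ip_smul]; ring
  have b1 := ip_box (hu.D 0) hu ht
  have b2 := ip_box hu hu ht
  have b3 := ip_box hu hV ht
  have i1 := ibox _ (hu.D 0)
  have i2 := ibox _ hu
  have cm : ∀ α β : Fin 4, ∀ x, Dop α (Dop β u) (t, x) = Dop β (Dop α u) (t, x) := fun α β x => D_comm hu.1 α β (t, x) ht
  have q1 : ip (Dop 0 u) Q t = ∑ i : Fin 3, ∑ j : Fin 3, ip (Dop 0 u) (fun p => H i j p * Dx j (Dx i u) p) t + ∑ i : Fin 3, ip (Dop 0 u) (fun p => Dx i (q i) p * Dop 0 u p) t := by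
    have e : ip (Dop 0 u) Q t = ip (Dop 0 u) (fun p => ∑ i : Fin 3, ∑ j : Fin 3, H i j p * Dx j (Dx i u) p + (-2) * ∑ i : Fin 3, q i p * Dx i (Dop 0 u) p) t :=
      ip_congr fun x => by rw [hQ (t, x) ht]
    rw [e, ip_add (hu.D 0).1 (SF.sum _ fun i _ => SF.sum _ fun j _ => SF.mulL (hH i j) ((hu.D _).D _)) ((SF.sum _ fun i _ => SF.mulL (hq i) ((hu.D _).D _)).smul _) ht, ip_smul,
      ip_sum _ (hu.D 0).1 (fun i _ => SF.sum _ fun j _ => SF.mulL (hH i j) ((hu.D _).D _)) ht, ip_sum _ (hu.D 0).1 (fun i _ => SF.mulL (hq i) ((hu.D _).D _)) ht]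
    congr 1
    · exact fsc fun i _ => ip_sum _ (hu.D 0).1 (fun j _ => SF.mulL (hH i j) ((hu.D _).D _)) ht
    · rw [Finset.mul_sum]; refine fsc fun i _ => ?_
      have h1 := ip_tri (hu.D 0).1 (hq i) (hu.D 0) ht i
      have h2 : ip (Dx i (Dop 0 u)) (fun p => q i p * Dop 0 u p) t = ip (Dop 0 u) (fun p => q i p * Dx i (Dop 0 u) p) t := ip_congr fun x => by ring
      linarith
  have hd : ∀ i j : Fin 3, ip (Dop 0 (Dx i u)) (fun p => H i j p * Dx j u p) t = - ip (Dop 0 u) (fun p => H i j p * Dx j (Dx i u) p) t - ip (Dop 0 u) (fun p => Dx i (H i j) p * Dx j u p) t := by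
    intro i j
    have h1 := ip_tri (hu.D 0).1 (hH i j) (hu.D j.succ) ht i
    have h2 : ip (Dop 0 (Dx i u)) (fun p => H i j p * Dx j u p) t = ip (Dx i (Dop 0 u)) (fun p => H i j p * Dx j u p) t := ip_congr fun x => by rw [cm]
    have h3 : ip (Dop 0 u) (fun p => H i j p * Dx i (Dx j u) p) t = ip (Dop 0 u) (fun p => H i j p * Dx j (Dx i u) p) t := ip_congr fun x => by rw [cm i.succ j.succ]
    rw [h2, ← h3]; linarith
  have hd2 : ∀ i j : Fin 3, ip (Dx i u) (Dop 0 fun p => H i j p * Dx j u p) t = ip (Dx i u) (fun p => Dop 0 (H i j) p * Dx j u p) t + ip (Dop 0 (Dx j u)) (fun p => H j i p * Dx i u p) t := by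
    intro i j
    have : ip (Dx i u) (Dop 0 fun p => H i j p * Dx j u p) t = ip (Dx i u) (fun p => Dop 0 (H i j) p * Dx j u p + H i j p * Dop 0 (Dx j u) p) t :=
      ip_congr fun x => by rw [D_mul (hH i j) (hu.D j.succ).1 0 (t, x) ht]
    rw [this, ip_add (hu.D _).1 (SF.mulL ((hH i j).D 0) (hu.D _)) (SF.mulL (hH i j) ((hu.D _).D 0)) ht]
    congr 1; refine ip_congr fun x => ?_
    rw [hs i j]; ring
  have hd3 : ∑ i : Fin 3, ∑ j : Fin 3, (ip (Dop 0 (Dx i u)) (fun p => H i j p * Dx j u p) t + ip (Dx i u) (Dop 0 fun p => H i j p * Dx j u p) t) =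
      (∑ i : Fin 3, ∑ j : Fin 3, ip (Dx i u) (fun p => Dop 0 (H i j) p * Dx j u p) t) - 2 * (∑ i : Fin 3, ∑ j : Fin 3, ip (Dop 0 u) (fun p => Dx j (H i j) p * Dx i u p) t)
        - 2 * ∑ i : Fin 3, ∑ j : Fin 3, ip (Dop 0 u) (fun p => H i j p * Dx j (Dx i u) p) t := by
    have e1 : ∑ i : Fin 3, ∑ j : Fin 3, ip (Dop 0 (Dx j u)) (fun p => H j i p * Dx i u p) t = ∑ i : Fin 3, ∑ j : Fin 3, ip (Dop 0 (Dx i u)) (fun p => H i j p * Dx j u p) t := Finset.sum_comm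
    have e2 : ∑ i : Fin 3, ∑ j : Fin 3, ip (Dop 0 u) (fun p => Dx i (H i j) p * Dx j u p) t = ∑ i : Fin 3, ∑ j : Fin 3, ip (Dop 0 u) (fun p => Dx j (H i j) p * Dx i u p) t := by
      rw [Finset.sum_comm]; simp only [hs]
    simp only [hd2, Finset.sum_add_distrib, e1]
    simp only [hd, Finset.sum_sub_distrib, Finset.sum_neg_distrib, e2]; ring
  have gr : ∀ i : Fin 3, ip (Dop 0 (Dx i u)) (Dx i u) t + ip (Dx i u) (Dop 0 (Dx i u)) t = 2 * ip (Dx i (Dop 0 u)) (Dx i u) t := by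
    intro i
    rw [ip_comm (Dx i u) (Dop 0 (Dx i u)), ← two_mul]; congr 1; exact ip_congr fun x => by rw [cm]
  have c1 := ip_comm (t := t) (Dop 0 (Dop 0 u)) (Dop 0 u)
  have c2 := ip_comm (t := t) (Dop 0 u) u
  have hτ : tw P t * (tw P t)⁻¹ = 1 := mul_inv_cancel₀ (rpow_pos_of_pos h0 _).ne'
  simp only [gr, ← Finset.mul_sum, Pi.mul_apply, Pi.pow_apply, Pi.add_apply]
  rw [hd3, c1, b1, b2, b3, i1, i2, q1, c2]
  unfold Err ee1 kp
  generalize (tw P t)⁻¹ = σ at *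
  generalize tw P t = τ at *
  push_cast
  linear_combination (-1 : ℝ) * (2 * P.μ * τ * ip (Dop 0 u) (Dop 0 u) t + 2 * (P.μ / 2 + P.lam * (τ * (1 + t)⁻¹)) * P.μ * ip u (Dop 0 u) t) * hτ
end
section
variable {P : Prm}
def LI (a b : Ctx P → ℝ) : Prop := Le (fun c => |a c|) b
lemma LI.le {a b b' : Ctx P → ℝ} (h : LI a b) (hb : ∀ c, b c ≤ b' c) : LI a b' := Le.trans h (Le.of hb)
lemma LI.add {a a' b : Ctx P → ℝ} (h : LI a b) (h' : LI a' b) : LI (fun c => a c + a' c) b := by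
  obtain ⟨C, hC, h1⟩ := Le.add h h'
  exact ⟨C, hC, fun c => (abs_add_le _ _).trans (h1 c)⟩
lemma LI.neg {a b : Ctx P → ℝ} (h : LI a b) : LI (fun c => - a c) b := by simpa only [LI, abs_neg] using h
lemma LI.sub {a a' b : Ctx P → ℝ} (h : LI a b) (h' : LI a' b) : LI (fun c => a c - a' c) b := by
  simpa only [sub_eq_add_neg] using h.add h'.neg
lemma LI.sum {a : Fin 3 → Ctx P → ℝ} {b : Ctx P → ℝ} (h : ∀ i, LI (a i) b) : LI (fun c => ∑ i, a i c) b := by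
  simp only [fs3]; exact ((h 0).add (h 1)).add (h 2)
lemma LI.cm {k K a b b' : Ctx P → ℝ} (hk : ∀ c, |k c| ≤ K c) (h : LI a b) (hl : Le (fun c => K c * b c) b') : LI (fun c => k c * a c) b' := by
  obtain ⟨C, hC, h⟩ := h; obtain ⟨C', hC', h'⟩ := hl
  refine ⟨C * C', by positivity, fun c => ?_⟩
  beta_reduce
  rw [abs_mul]
  calc |k c| * |a c| ≤ K c * (C * b c) := mul_le_mul (hk c) (h c) (abn _) ((abn _).trans (hk c))
    _ = C * (K c * b c) := by ring
    _ ≤ C * (C' * b' c) := mll (h' c) hC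
    _ = _ := by ring
def io (A B : Op) (c : Ctx P) : ℝ := ip (A c.ψ) (B c.ψ) c.t
lemma io_li {A B : Op} {b b' : Ctx P → ℝ} (hb : ∀ c, 0 ≤ b c) (h : NF (sl A) b) (h' : NF (sl B) b') : LI (io A B) (fun c => b c * b' c) := NF.int hb h h'
lemma io3 {A B K : Op} {b b' a : Ctx P → ℝ} (hK : SO P K) (hb : ∀ c, 0 ≤ b c) (ha : ∀ c, 0 ≤ a c) (h : NF (sl A) b) (h' : NF (sl B) b') (hs : SU (sl K) a) : LI (io A (K * B)) (fun c => b c * (a c * b' c)) := by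
  refine io_li hb h ?_
  exact SU.nf ha (fun c => CC.mulL ((hK c.ψ c.adm).slice c.ht).continuous (h'.1 c)) hs h' 1 (fun c x => by rw [one_mul]; rfl)
def sE (l : W8) (c : Ctx P) : ℝ := √(e1 c l)
lemma sE_nn (l : W8) (c : Ctx P) : 0 ≤ sE l c := sqrt_nonneg _
lemma sE_sq (l : W8) (c : Ctx P) : sE l c ^ 2 = e1 c l := sq_sqrt (e1_nn _ _)
lemma sE_DD {l : W8} (hl : l.length ≤ P.N) (c : Ctx P) : sE l c ≤ DD c := by
  refine sqrt_le_sqrt (ws_le (fun l => e1_nn c l) bo)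
lemma nf_sE (l : W8) (α : Fin 4) : NF (sl (P := P) (G (cs α :: l))) (sE l) := by
  refine ⟨fun c => (sl_g _ c).cc, Le.of fun c => le_sqrt_of_sq_le ?_⟩
  exact Finset.single_le_sum (f := fun α => nm (sl (G (cs α :: l)) c) ^ 2) (fun _ _ => sqn _) (Finset.mem_univ α)
lemma Dm0 (c : Ctx P) : Dm 0 c = 0 := by simp [Dm, Dq]
lemma uN (l : W8) {B : Op} {b : Ctx P → ℝ} (h : NF (sl B) (fun c => b c * Dm l.length c)) : LI (io (G l) B) (fun c => Tc c * (b c * Dq l.length c)) := by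
  cases l with
  | nil =>
    obtain ⟨C, hC, h1⟩ := io_li (fun c => mnn (Tc0 c).le (Dm_nn 1 c)) (Po (P := P) (l := []) (n := 1) bs) h
    refine ⟨C, hC, fun c => (h1 c).trans_eq ?_⟩
    have : Dq 0 c = 0 := by simp [Dq]
    simp only [List.length_nil, Dm0, this]; ring
  | cons k m =>
    refine (io_li (fun c => mnn (Tc0 c).le (Dm_nn _ c)) (nf_gam k (n := (k :: m).length) (m := m) bs) h).le fun c => ?_
    rw [← Dm_sq]; apply le_of_eq; ring
lemma nfV {n : ℕ} {V : Op} (hV : Sp P (GG n) V) (α : Fin 4) : NF (sl (P := P) (gO (cs α) V)) (Dm n) := by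
  refine Sp.nf (Dm_nn n) (fun _ hA => nf_DG hA) (Sp.gam (cs α) (gd_GG n).so (fun A hA => ?_) hV)
  obtain ⟨l, hl, rfl⟩ := hA
  exact .of _ ⟨α, l, hl, rfl⟩
def tc (c : Ctx P) : ℝ := Tc c ^ P.lam
lemma tc0 (c : Ctx P) : 0 < tc c := Tp c _
lemma tci (c : Ctx P) : tc c * (Tc c)⁻¹ ≤ 1 := by
  have h := mll (Ti c) (tc0 c).le
  rwa [tc, ← rpow_add (Tc0 c), add_neg_cancel, rpow_zero] at h
def ZZ (c : Ctx P) : ℝ := c.e * (tc c * DD c ^ 2 + tc c ^ 2 * (DD c * BB c))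
lemma ZZ_nn (c : Ctx P) : 0 ≤ ZZ c := by have := e_nn c; have := tc0 c; have := DD_nn c; have := BB_nn c; unfold ZZ; positivity
def UU (l : W8) (c : Ctx P) : ℝ := tc c * (sE l c * Dm l.length c) + tc c * Dq l.length c + ZZ c
lemma ioQ {l : W8} (hl : l.length ≤ P.N) {K : Op} (hK : Sp P (CF P) K) (α : Fin 4) (j : Fin 3) : LI (io (P := P) (G l) (K * G (cs j.succ :: cs α :: l))) (fun c => c.e * DD c ^ 2) := by
  have e : io (P := P) (G l) (K * G (cs j.succ :: cs α :: l)) = fun c => - io (G (cs j.succ :: l)) (K * G (cs α :: l)) c - io (G l) (gO (cs j.succ) K * G (cs α :: l)) c := by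
    funext c
    have := ip_tri (c.adm.g l).1 (hK.so gd_CF.so c.ψ c.adm) (c.adm.g (cs α :: l)) c.ht j
    simp only [← gam_cs] at this
    exact this
  rw [e]
  have hD := fun α => nf_appD (P := P) (m := []) (l := l) α (by simpa using hl)
  refine LI.sub (LI.neg ((io3 (hK.so gd_CF.so) DD_nn e_nn (hD j.succ) (hD α) (om_drop (c0 hK))).le fun c => le_of_eq (by ring))) ?_
  have h1 := SU.nf (H := fun c x => om x * (sl (gO (cs j.succ) K) c x * sl (G (cs α :: l)) c x)) e_nn (fun c => CC.mulL om_cont (CC.mulL (((hK.so gd_CF.so c.ψ c.adm).gam (cs j.succ)).slice c.ht).continuous (sl_g _ c).cc)) (c1 (cs j.succ) hK) (hD α) 1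
    (fun c x => by rw [one_mul]; apply le_of_eq; congr 1; simp only [List.nil_append]; ring)
  have h2 := NF.int DD_nn ((Hd (n := P.N + 1) (l := l) bo)) h1
  refine LI.le (b := fun c => DD c * (c.e * DD c)) ?_ fun c => le_of_eq (by ring)
  refine Le.trans (Le.of fun c => le_of_eq ?_) h2
  congr 1; refine integral_congr_ae (.of_forall fun x => ?_)
  have := (om0 x).ne'
  change sl (G l) c x * (sl (gO (cs j.succ) K) c x * sl (G (cs α :: l)) c x) = _
  field_simp
lemma PO_eq (l : W8) {ψ : PF} (hψ : Adm P ψ) (p : Pt) (hp : 0 < p.1) : PO P l ψ p =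
    ∑ i : Fin 3, ∑ j : Fin 3, HO P i j ψ p * Dx j (Dx i (G l ψ)) p + (-2) * ∑ i : Fin 3, qO P i ψ p * Dx i (Dop 0 (G l ψ)) p := by
  have h : PO P l ψ p = ∑ α, ∑ β, cf P α β ψ p * Dop α (Dop β (G l ψ)) p := by
    simp only [PO, Finset.sum_apply, Pi.mul_apply, G_cs]
  have a1 : cf P 0 0 ψ p = 0 := rfl
  have a2 : ∀ j : Fin 3, cf P 0 j.succ ψ p = -1 * qO P j ψ p := fun j => rfl
  have a3 : ∀ j : Fin 3, cf P j.succ 0 ψ p = -1 * qO P j ψ p := fun j => rfl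
  have a4 : ∀ i j : Fin 3, cf P i.succ j.succ ψ p = HO P i j ψ p := fun i j => rfl
  rw [h]
  simp only [Fin.sum_univ_succ (n := 3), a1, a2, a3, a4, Finset.sum_add_distrib, fun i j : Fin 3 => D_comm (hψ.g l).1 i.succ j.succ p hp, fun j : Fin 3 => D_comm (hψ.g l).1 0 j.succ p hp]
  have : ∑ i : Fin 3, -1 * qO P i ψ p * Dx i (Dop 0 (G l ψ)) p = - ∑ i : Fin 3, qO P i ψ p * Dx i (Dop 0 (G l ψ)) p := by
    rw [← Finset.sum_neg_distrib]; exact fsc fun i _ => by ring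
  rw [this]; ring
lemma ioPO {l : W8} (hl : l.length ≤ P.N) : LI (io (P := P) (G l) (PO P l)) (fun c => c.e * DD c ^ 2) := by
  have e : io (P := P) (G l) (PO P l) = fun c => (∑ i : Fin 3, ∑ j : Fin 3, io (G l) (HO P i j * G (cs j.succ :: cs i.succ :: l)) c) - (2 * ∑ i : Fin 3, io (G l) (qO P i * G (cs i.succ :: cs 0 :: l)) c) := by
    funext c
    have hu := c.adm.g l
    have hH := fun i j => (HO_mem (P := P) i j).so gd_CF.so c.ψ c.adm
    have hq := fun i => gd_Fg 0 _ (qO_mem i) c.ψ c.adm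
    unfold io
    rw [ip_congr (f' := G l c.ψ) (g' := fun p => ∑ i : Fin 3, ∑ j : Fin 3, HO P i j c.ψ p * Dx j (Dx i (G l c.ψ)) p + (-2) * ∑ i : Fin 3, qO P i c.ψ p * Dx i (Dop 0 (G l c.ψ)) p) (fun x => by rw [PO_eq l c.adm (c.t, x) c.ht]),
      ip_add hu.1 (SF.sum _ fun i _ => SF.sum _ fun j _ => SF.mulL (hH i j) ((hu.D _).D _)) ((SF.sum _ fun i _ => SF.mulL (hq i).1 ((hu.D _).D _)).smul _) c.ht, ip_smul,
      ip_sum _ hu.1 (fun i _ => SF.sum _ fun j _ => SF.mulL (hH i j) ((hu.D _).D _)) c.ht, ip_sum _ hu.1 (fun i _ => SF.mulL (hq i).1 ((hu.D _).D _)) c.ht]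
    have hin : ∀ i : Fin 3, ip (G l c.ψ) (fun p => ∑ j : Fin 3, HO P i j c.ψ p * Dx j (Dx i (G l c.ψ)) p) c.t = ∑ j : Fin 3, ip (G l c.ψ) (fun p => HO P i j c.ψ p * Dx j (Dx i (G l c.ψ)) p) c.t :=
      fun i => ip_sum _ hu.1 (fun j _ => SF.mulL (hH i j) ((hu.D _).D _)) c.ht
    simp only [hin]
    simp only [neg_mul, ← sub_eq_add_neg, ← gam_cs]
    rfl
  rw [e]
  refine (LI.sum fun i => LI.sum fun j => ioQ hl (HO_mem i j) i.succ j).sub (LI.cm (K := fun _ => 2) (fun c => by norm_num) (LI.sum fun i => ioQ hl (.of _ (Or.inl (qO_mem i))) 0 i) ⟨2, by norm_num, fun c => le_rfl⟩)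
lemma tw_tc (c : Ctx P) : tw P c.t = tc c := rfl
lemma kp_nn (c : Ctx P) : 0 ≤ kp P c.t := by
  have := P.hμ; have := P.hlam0; have := tc0 c; have := inv_pos.2 (Tc0 c); unfold kp; rw [tw_tc, show (1 + c.t)⁻¹ = (Tc c)⁻¹ from rfl]; positivity
lemma kp_le (c : Ctx P) : kp P c.t ≤ P.μ / 2 + 1 := by
  have h := tci c; have := P.hlam0; have := P.hlam1
  unfold kp; rw [tw_tc, show (1 + c.t)⁻¹ = (Tc c)⁻¹ from rfl]
  have : 0 ≤ tc c * (Tc c)⁻¹ := mnn (tc0 c).le (inv_pos.2 (Tc0 c)).le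
  nlinarith
lemma kt_le (c : Ctx P) : |2 * (kp P c.t * tw P c.t)| ≤ (P.μ + 2) * tc c := by
  rw [tw_tc, abs_of_nonneg (mnn zero_le_two (mnn (kp_nn c) (tc0 c).le))]
  nlinarith [kp_le c, tc0 c]
lemma RB {l : W8} (hl : l.length ≤ P.N) {R V E : Op} (hR : Sp P (Rm P l.length l.length) R) (hV : Sp P (GG l.length) V) (hE : Sp P (EE l.length) E) :
    LI (fun c : Ctx P => Err P (fun i j => HO P i j c.ψ) (fun i => qO P i c.ψ) (G l c.ψ) (V c.ψ) (PO P l c.ψ) (R c.ψ) (E c.ψ) c.t) (UU l) := by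
  have hD := fun α => nf_appD (P := P) (m := []) (l := l) α (by simpa using hl)
  have hu := nf_sE (P := P) l
  have hH := fun i j => (HO_mem (P := P) i j)
  have hHs := fun i j => (HO_mem (P := P) i j).so gd_CF.so
  have hq := fun i => Sp.of (P := P) (S := CF P) _ (Or.inl (qO_mem (P := P) i))
  have hqs := fun i => (hq i).so gd_CF.so
  have gs : ∀ (k : Fin 8) {A : Op}, SO P A → SO P (gO k A) := fun k A hA ψ hψ => (hA ψ hψ).gam k
  have s0 := sE_nn (P := P) l
  have hb : ∀ c : Ctx P, 0 ≤ Tc c ^ P.lam * BB c := fun c => mnn (Tp c _).le (BB_nn c)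
  have hh : LI (fun c : Ctx P => hf (fun i j => HO P i j c.ψ) (G l c.ψ) c.t) (fun c => c.e * DD c ^ 2) := by
    unfold hf; simp only [← gam_cs]
    exact LI.sum fun i => LI.sum fun j => (io3 (hHs i j) DD_nn e_nn (hD i.succ) (hD j.succ) (om_drop (c0 (hH i j)))).le fun c => le_of_eq (by ring)
  unfold Err; simp only [← gam_cs]
  have p1 : ∀ c : Ctx P, 0 ≤ tc c * (sE l c * Dm l.length c) := fun c => mnn (tc0 c).le (mnn (s0 c) (Dm_nn _ c))
  have p2 : ∀ c : Ctx P, 0 ≤ tc c * Dq l.length c := fun c => mnn (tc0 c).le (Dq_nn _ c)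
  have p3 : ∀ c : Ctx P, tc c * (c.e * DD c ^ 2) ≤ ZZ c := fun c => by
    unfold ZZ; nlinarith [mnn (e_nn c) (mnn (sqn (tc c)) (mnn (DD_nn c) (BB_nn c)))]
  have p4 : ∀ c : Ctx P, c.e * (tc c ^ 2 * (DD c * BB c)) ≤ ZZ c := fun c => by
    unfold ZZ; nlinarith [mnn (e_nn c) (mnn (tc0 c).le (sqn (DD c)))]
  refine LI.add (LI.add (LI.sub (LI.sub (LI.add ?_ ?_) ?_) ?_) ?_) ?_
  · have t1 : LI (fun c : Ctx P => ip (Gam (cs 0) (G l c.ψ)) (R c.ψ) c.t) (fun c => sE l c * bx l.length c) :=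
      (io_li s0 (hu 0) (Rb hl hl hR)).le fun c => mll (bx2 _ c) (s0 c)
    have t2 : LI (fun c : Ctx P => ip (Gam (cs 0) (G l c.ψ)) (box (V c.ψ)) c.t) (fun c => sE l c * bx l.length c) := io_li s0 (hu 0) (Box' hl hV)
    have t3 : LI (fun c : Ctx P => ip (Gam (cs 0) (G l c.ψ)) (E c.ψ) c.t) (fun c => sE l c * bx l.length c) :=
      (io_li s0 (hu 0) (nf_EE hE)).le fun c => mll (bx3 _ c) (s0 c)
    refine LI.cm (K := fun c => 2 * tc c ^ 2) (fun c => ?_) ((t1.add t2).add t3) ⟨2, by norm_num, fun c => ?_⟩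
    · rw [tw_tc, abs_of_nonneg bp]
    · have e1 : tc c ^ 2 * Tc c ^ (-P.lam) = tc c := by
        rw [rpow_neg (Tc0 c).le, pow_two]; exact mul_inv_cancel_right₀ (tc0 c).ne' _
      have e2 : 2 * tc c ^ 2 * (sE l c * bx l.length c) = 2 * (tc c ^ 2 * Tc c ^ (-P.lam)) * (sE l c * Dm l.length c) + 2 * (c.e * (tc c ^ 2 * (sE l c * BB c))) := by unfold bx; ring
      have e3 : c.e * (tc c ^ 2 * (sE l c * BB c)) ≤ c.e * (tc c ^ 2 * (DD c * BB c)) := by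
        have := sE_DD hl c; have := BB_nn c; have := e_nn c; gcongr
      beta_reduce; rw [e2, e1]; unfold UU; nlinarith [p2 c, p4 c]
  · have t1 : LI (fun c : Ctx P => ip (G l c.ψ) (PO P l c.ψ) c.t) (fun c => c.e * DD c ^ 2 + Dq l.length c) := (ioPO hl).le fun c => by linarith [Dq_nn l.length c]
    have t2 : LI (fun c : Ctx P => ip (G l c.ψ) (R c.ψ) c.t) (fun c => c.e * DD c ^ 2 + Dq l.length c) := LI.le (R2i hl hl hR hl) fun c => by linarith [Dq_nn l.length c]
    have t3 : LI (fun c : Ctx P => ip (G l c.ψ) (E c.ψ) c.t) (fun c => c.e * DD c ^ 2 + Dq l.length c) := LI.le (uN l (nf_EE hE)) fun c => by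
      rw [← mul_assoc, mul_inv_cancel₀ (Tc0 c).ne', one_mul]; linarith [mnn (e_nn c) (sqn (DD c))]
    refine LI.cm kt_le ((t1.add t2).add t3) ⟨P.μ + 2, by linarith [P.hμ], fun c => ?_⟩
    beta_reduce; rw [mul_assoc]; refine mll ?_ (by linarith [P.hμ])
    unfold UU; linarith [p1 c, p3 c]
  · have t1 : LI (fun c : Ctx P => ip (G l c.ψ) (Gam (cs 0) (V c.ψ)) c.t) (fun c => Tc c * (1 * Dq l.length c)) := uN l ((nfV hV 0).le (Le.of fun c => (one_mul _).ge))
    refine LI.cm (K := fun c => (P.μ + 4) * (tc c * (Tc c)⁻¹)) (fun c => ?_) t1 ⟨P.μ + 4, by linarith [P.hμ], fun c => ?_⟩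
    · rw [tw_tc, show (1 + c.t)⁻¹ = (Tc c)⁻¹ from rfl]
      have h0 : 0 ≤ tc c * (Tc c)⁻¹ := mnn (tc0 c).le (inv_pos.2 (Tc0 c)).le
      have h1 := tci c; have h2 := kp_nn c; have h3 := kp_le c; have h4 := P.hlam0; have h5 := P.hlam1
      set ρ := tc c * (Tc c)⁻¹
      have a1 : |kp P c.t - (1 - P.lam) * ρ| ≤ P.μ / 2 + 2 := by
        rw [abs_le]; constructor <;> nlinarith [P.hμ, mnn (by linarith : 0 ≤ 1 - P.lam) h0]
      rw [abs_mul, abs_mul, abs_of_pos two_pos, abs_of_nonneg bp]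
      have a2 : P.lam * ρ ≤ ρ := by nlinarith
      calc 2 * (P.lam * ρ * |kp P c.t - (1 - P.lam) * ρ|) ≤ 2 * (ρ * (P.μ / 2 + 2)) := by gcongr
        _ = _ := by ring
    · have : (P.μ + 4) * (tc c * (Tc c)⁻¹) * (Tc c * (1 * Dq l.length c)) = (P.μ + 4) * (tc c * Dq l.length c) := by have := (Tc0 c).ne'; field_simp
      beta_reduce; rw [this]; refine mll ?_ (by linarith [P.hμ])
      unfold UU; linarith [p1 c, ZZ_nn c]
  · have t1 : LI (fun c : Ctx P => ip (Gam (cs 0) (G l c.ψ)) (Gam (cs 0) (V c.ψ)) c.t) (fun c => sE l c * Dm l.length c) := io_li s0 (hu 0) (nfV hV 0)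
    have t2 : ∀ i : Fin 3, LI (fun c : Ctx P => ip (Gam (cs i.succ) (G l c.ψ)) (Gam (cs i.succ) (V c.ψ)) c.t) (fun c => sE l c * Dm l.length c) := fun i => io_li s0 (hu i.succ) (nfV hV i.succ)
    refine LI.cm kt_le (t1.sub (LI.sum t2)) ⟨P.μ + 2, by linarith [P.hμ], fun c => ?_⟩
    beta_reduce; rw [mul_assoc]; refine mll ?_ (by linarith [P.hμ])
    unfold UU; linarith [p2 c, ZZ_nn c]
  · refine LI.cm (K := fun c => 2 * tc c) (fun c => ?_) hh ⟨2, by norm_num, fun c => ?_⟩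
    · rw [tw_tc, show (1 + c.t)⁻¹ = (Tc c)⁻¹ from rfl]
      have h0 : 0 ≤ tc c * (Tc c)⁻¹ := mnn (tc0 c).le (inv_pos.2 (Tc0 c)).le
      have h1 := tci c; have h4 := P.hlam0; have h5 := P.hlam1; have := tc0 c
      rw [abs_of_nonneg bp]
      have : P.lam * (tc c * (Tc c)⁻¹) ≤ 1 := by nlinarith
      nlinarith
    · beta_reduce; rw [mul_assoc]; refine mll ?_ zero_le_two
      unfold UU; linarith [p1 c, p2 c, p3 c]
  · have t1 : ∀ i j : Fin 3, LI (fun c : Ctx P => ip (Gam (cs i.succ) (G l c.ψ)) (fun p => Gam (cs 0) (HO P i j c.ψ) p * Gam (cs j.succ) (G l c.ψ) p) c.t) (fun c => DD c * ((Tc c ^ P.lam * BB c) * DD c)) :=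
      fun i j => io3 (gs _ (hHs i j)) DD_nn hb (hD i.succ) (hD j.succ) (c2 0 (hH i j))
    have t2 : ∀ i j : Fin 3, LI (fun c : Ctx P => ip (Gam (cs 0) (G l c.ψ)) (fun p => Gam (cs j.succ) (HO P i j c.ψ) p * Gam (cs i.succ) (G l c.ψ) p) c.t) (fun c => DD c * ((Tc c ^ P.lam * BB c) * DD c)) :=
      fun i j => io3 (gs _ (hHs i j)) DD_nn hb (hD 0) (hD i.succ) (c2 j.succ (hH i j))
    have t3 : ∀ i : Fin 3, LI (fun c : Ctx P => ip (Gam (cs 0) (G l c.ψ)) (fun p => Gam (cs i.succ) (qO P i c.ψ) p * Gam (cs 0) (G l c.ψ) p) c.t) (fun c => DD c * ((Tc c ^ P.lam * BB c) * DD c)) :=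
      fun i => io3 (gs _ (hqs i)) DD_nn hb (hD 0) (hD 0) (c2 i.succ (hq i))
    have tt : ∀ {a b : Ctx P → ℝ}, LI a b → LI (fun c => 2 * a c) b := fun h => LI.cm (K := fun _ => 2) (fun c => by norm_num) h ⟨2, by norm_num, fun c => le_rfl⟩
    refine LI.cm (K := fun c => tc c ^ 2) (fun c => ?_) (((LI.sum fun i => LI.sum (t1 i)).sub (tt (LI.sum fun i => LI.sum (t2 i)))).add (tt (LI.sum t3))) ⟨1, zero_le_one, fun c => ?_⟩
    · rw [tw_tc, abs_of_nonneg bp]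
    · have e1 : tc c ^ 2 * (DD c * ((Tc c ^ P.lam * BB c) * DD c)) = (Tc c ^ P.lam * DD c) * (tc c ^ 2 * (DD c * BB c)) := by ring
      beta_reduce; rw [e1, one_mul]
      have := mlr (D_e c) (mnn (sqn (tc c)) (mnn (DD_nn c) (BB_nn c)))
      unfold UU; linarith [p1 c, p2 c, p4 c]
end
lemma coer {μ κ τ b z p : ℝ} (hμ : 0 < μ) (h1 : μ / 2 ≤ κ) (h2 : κ ≤ μ / 2 + 1) (hτ : 0 ≤ τ) (hp : |p| ≤ z * b) :
    μ / (3 * μ + 4) * (τ ^ 2 * b ^ 2) + μ ^ 2 / 8 * z ^ 2 ≤ τ ^ 2 * b ^ 2 + κ * (2 * τ * p + (κ + μ / 2) * z ^ 2) := by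
  have hm : 0 < κ + μ / 4 := by linarith
  have hk : 0 < κ := by linarith
  have h3 : κ / (κ + μ / 4) ≤ 1 - μ / (3 * μ + 4) := by
    rw [div_le_iff₀ hm, one_sub_div bp, div_mul_eq_mul_div, le_div_iff₀ bp]
    nlinarith
  have h4 : 0 ≤ κ / (κ + μ / 4) * (τ * b - (κ + μ / 4) * z) ^ 2 := by positivity
  have h5 : κ / (κ + μ / 4) * (τ * b - (κ + μ / 4) * z) ^ 2 = κ / (κ + μ / 4) * (τ ^ 2 * b ^ 2) - 2 * κ * τ * (z * b) + κ * (κ + μ / 4) * z ^ 2 := by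
    field_simp; ring
  have h6 : κ / (κ + μ / 4) * (τ ^ 2 * b ^ 2) ≤ (1 - μ / (3 * μ + 4)) * (τ ^ 2 * b ^ 2) := mlr h3 bp
  have h7 : κ * τ * (-(z * b)) ≤ κ * τ * p := mll (abs_le.1 hp).1 bp
  have h8 : μ / 2 * (μ / 4 * z ^ 2) ≤ κ * (μ / 4 * z ^ 2) := mlr h1 bp
  nlinarith
section
variable {P : Prm}
lemma ip_nm (l : W8) (c : Ctx P) : ip (G l c.ψ) (G l c.ψ) c.t = nm (sl (G l) c) ^ 2 := by
  rw [nm_sq]; unfold ip sl; simp only [pow_two]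
lemma ee1_e1 (l : W8) (c : Ctx P) : ee1 (G l c.ψ) c.t = e1 c l := by
  unfold ee1 e1
  rw [Fin.sum_univ_succ (n := 3)]
  simp only [← G_cs, ip_nm]
lemma HO_sym (i j : Fin 3) : HO P i j = HO P j i := by
  unfold HO; rw [mul_comm (qO P i)]; simp only [eq_comm]
set_option maxHeartbeats 1600000 in
lemma step {l : W8} (hl : l.length ≤ P.N) : ∃ (δ C : ℝ) (X : (PF) → ℝ → ℝ), 0 < δ ∧ 0 < C ∧ ∀ c : Ctx P, c.e ≤ δ →
    (∃ X', HasDerivAt (X c.ψ) X' c.t ∧ X' ≤ -(P.μ / 2 * (tc c * e1 c l)) + C * (tc c * Dq l.length c + c.e * (tc c * Dq (P.N + 1) c))) ∧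
    tc c ^ 2 * e1 c l + nm (sl (G l) c) ^ 2 ≤ C * (X c.ψ c.t + C * (tc c ^ 2 * Dq l.length c)) ∧
    X c.ψ c.t ≤ C * (tc c ^ 2 * e1 c l + nm (sl (G l) c) ^ 2 + tc c ^ 2 * Dq l.length c) := by
  obtain ⟨R, V, E, hR, hV, hE, hS⟩ := star (P := P) l
  obtain ⟨CU, hCU, hU⟩ := RB hl hR hV hE
  obtain ⟨δY, CY, hδY, hCY, hY⟩ := Y_small (P := P)
  have hH := fun i j => (HO_mem (P := P) i j)
  have hHs := fun i j => (HO_mem (P := P) i j).so gd_CF.so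
  have hh : LI (fun c : Ctx P => hf (fun i j => HO P i j c.ψ) (G l c.ψ) c.t) (fun c => c.e * e1 c l) := by
    unfold hf; simp only [← gam_cs]
    exact LI.sum fun i => LI.sum fun j => (io3 (hHs i j) (sE_nn l) e_nn (nf_sE l i.succ) (nf_sE l j.succ) (om_drop (c0 (hH i j)))).le fun c => by
      rw [← sE_sq]; exact le_of_eq (by ring)
  obtain ⟨CH, hCH, hh⟩ := hh
  have hv : LI (fun c : Ctx P => ip (G l c.ψ) (Dop 0 (V c.ψ)) c.t) (fun c => nm (sl (G l) c) * Dm l.length c) := by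
    simp only [← gam_cs]
    exact io_li (fun c => nm_nn _) ⟨fun c => (sl_g l c).cc, Le.rfl⟩ (nfV hV 0)
  obtain ⟨CV, hCV, hv⟩ := hv
  have hμ := P.hμ
  -- constants
  set c0 := min (P.μ / (3 * P.μ + 4)) (P.μ ^ 2 / 8) with hc0
  have hc0p : 0 < c0 := lt_min bp bp
  set B := ((P.μ + 2) * CV) ^ 2 / (2 * c0) with hB
  have hB0 : 0 ≤ B := by positivity
  set CX := 3 * (P.μ + 3) ^ 2 + c0 + CH + B with hCX
  set C1 := CU ^ 2 / (2 * P.μ) + CU + CU * (CY + 2) with hC1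
  refine ⟨min δY (c0 / (2 * (CH + 1))), 2 / c0 + B + CX + C1, fun ψ => XX P (fun i j => HO P i j ψ) (G l ψ) (V ψ), lt_min hδY bp, by positivity, fun c hc => ?_⟩
  have hτ := tc0 c
  have hq := Dq_nn l.length c
  have he := e1_nn c l
  have hz := nm_nn (sl (G l) c)
  have hk1 : P.μ / 2 ≤ kp P c.t := by
    have := P.hlam0; have := inv_pos.2 (Tc0 c)
    unfold kp; rw [tw_tc, show (1 + c.t)⁻¹ = (Tc c)⁻¹ from rfl]
    have : 0 ≤ P.lam * (tc c * (Tc c)⁻¹) := by positivity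
    linarith
  have hk2 := kp_le c
  set z := nm (sl (G l) c)
  set τ := tc c
  -- the perturbation terms
  have b1 : |2 * (kp P c.t * tw P c.t) * ip (G l c.ψ) (Dop 0 (V c.ψ)) c.t| ≤ c0 / 2 * z ^ 2 + B * (τ ^ 2 * Dq l.length c) := by
    rw [abs_mul]
    have h1 := mul_le_mul (kt_le c) (hv c) (abn _) (mnn bl hτ.le)
    refine h1.trans ?_
    rw [← Dm_sq, hB]
    have h2 := sqn (c0 * z - ((P.μ + 2) * CV) * (τ * Dm l.length c))
    have h3 : c0 / 2 * z ^ 2 + ((P.μ + 2) * CV) ^ 2 / (2 * c0) * (τ ^ 2 * Dm l.length c ^ 2) - (P.μ + 2) * tc c * (CV * (z * Dm l.length c))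
      = (c0 * z - ((P.μ + 2) * CV) * (τ * Dm l.length c)) ^ 2 / (2 * c0) := by field_simp; ring
    have h4 : 0 ≤ (c0 * z - ((P.μ + 2) * CV) * (τ * Dm l.length c)) ^ 2 / (2 * c0) := by positivity
    linarith
  have b2 : |tw P c.t ^ 2 * hf (fun i j => HO P i j c.ψ) (G l c.ψ) c.t| ≤ CH * c.e * (τ ^ 2 * e1 c l) := by
    rw [abs_mul, tw_tc, abs_of_nonneg bp]
    refine (mll (hh c) bp).trans_eq (by ring)
  have b2' : CH * c.e ≤ c0 / 2 := by
    have : c.e ≤ c0 / (2 * (CH + 1)) := hc.trans (min_le_right _ _)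
    rw [le_div_iff₀ bp] at this
    nlinarith [e_nn c]
  -- X0
  have hp : |ip (G l c.ψ) (Dop 0 (G l c.ψ)) c.t| ≤ z * nm (sl (G (cs 0 :: l)) c) := by
    rw [← G_cs]; exact cs_abs (sl_g l c).cc (sl_g _ c).cc
  have hbb : nm (sl (G (cs 0 :: l)) c) ^ 2 ≤ e1 c l := Finset.single_le_sum (f := fun α => nm (sl (G (cs α :: l)) c) ^ 2) (fun _ _ => sqn _) (Finset.mem_univ 0)
  set b := nm (sl (G (cs 0 :: l)) c)
  have hb0 : 0 ≤ b := nm_nn _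
  set p := ip (G l c.ψ) (Dop 0 (G l c.ψ)) c.t
  have x0 : X0 P (G l c.ψ) c.t = τ ^ 2 * e1 c l + kp P c.t * (2 * τ * p + (kp P c.t + P.μ / 2) * z ^ 2) := by
    unfold X0; rw [ee1_e1, ip_nm, tw_tc]
    have : P.μ + P.lam * (τ * (1 + c.t)⁻¹) = kp P c.t + P.μ / 2 := by unfold kp; rw [tw_tc]; ring
    rw [this]
  have l1 : c0 * (τ ^ 2 * e1 c l + z ^ 2) ≤ X0 P (G l c.ψ) c.t := by
    have h := coer (τ := τ) hμ hk1 hk2 hτ.le hp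
    have h1 : c0 ≤ P.μ / (3 * P.μ + 4) := min_le_left _ _
    have h2 : c0 ≤ P.μ ^ 2 / 8 := min_le_right _ _
    have h3 : c0 ≤ 1 := h1.trans (by rw [div_le_one bp]; linarith)
    have h4 := mlr h1 (by positivity : 0 ≤ τ ^ 2 * b ^ 2)
    have h5 := mlr h2 (sqn z)
    have h6 := mlr h3 (mnn (sqn τ) (sub_nonneg.2 hbb))
    rw [x0]; nlinarith
  have l2 : X0 P (G l c.ψ) c.t ≤ 3 * (P.μ + 3) ^ 2 * (τ ^ 2 * e1 c l + z ^ 2) := by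
    have h1 : 2 * τ * p ≤ τ ^ 2 * b ^ 2 + z ^ 2 := by
      have := mll ((le_abs_self p).trans hp) hτ.le
      nlinarith [sqn (τ * b - z)]
    have h2 : 2 * τ * p ≤ τ ^ 2 * e1 c l + z ^ 2 := h1.trans (by gcongr)
    have h3 : 0 ≤ τ ^ 2 * e1 c l := by positivity
    set Q := τ ^ 2 * e1 c l
    have h4 : kp P c.t + P.μ / 2 ≤ P.μ + 3 := by linarith
    have h5 : 2 * τ * p + (kp P c.t + P.μ / 2) * z ^ 2 ≤ (Q + z ^ 2) + (P.μ + 3) * (Q + z ^ 2) := by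
      have := mlr h4 (sqn z); nlinarith
    rw [x0]
    have g : 0 ≤ Q + z ^ 2 := by positivity
    have h6 := mll h5 (by linarith : 0 ≤ kp P c.t)
    have h7 : kp P c.t * ((Q + z ^ 2) + (P.μ + 3) * (Q + z ^ 2)) ≤ (P.μ + 3) * ((Q + z ^ 2) + (P.μ + 3) * (Q + z ^ 2)) :=
      mlr bl bp
    have h8 : (1 + (P.μ + 3) * (P.μ + 4)) * (Q + z ^ 2) ≤ 3 * (P.μ + 3) ^ 2 * (Q + z ^ 2) := mlr (by nlinarith) g
    linarith [sqn z]
  refine ⟨⟨_, XX_der (Q := PO P l c.ψ) (R := R c.ψ) (E := E c.ψ) (q := fun i => qO P i c.ψ) (c.adm.g l) (hV.sf (gd_GG _) c.ψ c.adm) (hR.sf (gd_Rm _ _) c.ψ c.adm) (hE.sf (gd_EE _) c.ψ c.adm) (fun i j => hHs i j c.ψ c.adm) (fun i j => by rw [HO_sym])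
    (fun i => (gd_Fg 0 _ (qO_mem (P := P) i) c.ψ c.adm).1) (fun p hp => PO_eq l c.adm p hp) (fun p hp => hS c.ψ c.adm p hp) c.ht, ?_⟩, ?_, ?_⟩
  · have h1 := (le_abs_self _).trans (hU c)
    rw [ee1_e1, tw_tc, ip_nm]
    have h2 : 0 ≤ P.μ / 2 * P.lam * (1 - P.lam) * (tc c * (1 + c.t)⁻¹ ^ 2) * nm (sl (G l) c) ^ 2 := by
      have := P.hlam0; have := sub_nonneg.2 P.hlam1; positivity
    have h3 : CU * (τ * (sE l c * Dm l.length c)) ≤ P.μ / 2 * (τ * e1 c l) + CU ^ 2 / (2 * P.μ) * (τ * Dq l.length c) := by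
      rw [← Dm_sq, ← sE_sq]
      have : P.μ / 2 * (τ * sE l c ^ 2) + CU ^ 2 / (2 * P.μ) * (τ * Dm l.length c ^ 2) - CU * (τ * (sE l c * Dm l.length c)) = τ * (P.μ * sE l c - CU * Dm l.length c) ^ 2 / (2 * P.μ) := by field_simp; ring
      have h4 : 0 ≤ τ * (P.μ * sE l c - CU * Dm l.length c) ^ 2 / (2 * P.μ) := by positivity
      linarith
    have h4 : ZZ c ≤ (CY + 2) * (c.e * (τ * Dq (P.N + 1) c)) := by
      have hy := hY c (hc.trans (min_le_left _ _))
      have e1 : τ * Tc c ^ (-P.lam) = 1 := by rw [rpow_neg (Tc0 c).le]; exact mul_inv_cancel₀ hτ.ne'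
      have e2 : τ * BB c ≤ (CY + 1) * DD c := by
        have : τ * BB c ≤ τ * (CY * (Tc c ^ (-P.lam) * DD c) + Tc c ^ (-P.lam) * DD c) := mll (by unfold BB; linarith) hτ.le
        refine this.trans_eq ?_
        rw [show τ * (CY * (Tc c ^ (-P.lam) * DD c) + Tc c ^ (-P.lam) * DD c) = (τ * Tc c ^ (-P.lam)) * ((CY + 1) * DD c) by ring, e1, one_mul]
      have e3 := mll e2 (mnn hτ.le (DD_nn c))
      have e4 : Dq (P.N + 1) c = DD c ^ 2 := (Dm_sq _ c).symm
      unfold ZZ; rw [e4]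
      refine (mll ?_ (e_nn c)).trans_eq (mul_left_comm _ _ _)
      change τ * DD c ^ 2 + τ ^ 2 * (DD c * BB c) ≤ _
      nlinarith
    unfold UU at h1
    have h5 := mll h4 hCU
    have g1 : 0 ≤ τ * Dq l.length c := by positivity
    have g2 : 0 ≤ c.e * (τ * Dq (P.N + 1) c) := mnn (e_nn c) (mnn hτ.le (Dq_nn _ c))
    have g3 : 0 ≤ 2 / c0 + B + CX := by positivity
    have g4 : 0 ≤ CU ^ 2 / (2 * P.μ) := by positivity
    have g5 : 0 ≤ CU * (CY + 2) := by positivity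
    rw [hC1]
    have h6 : CU * (τ * (sE l c * Dm l.length c) + τ * Dq l.length c + ZZ c) = CU * (τ * (sE l c * Dm l.length c)) + CU * (τ * Dq l.length c) + CU * ZZ c := by ring
    have h7 := h1.trans_eq h6
    linarith [mnn g3 g1, mnn g3 g2, mnn g4 g2, mnn hCU g2, mnn g5 g1]
  · have h1 := (abs_le.1 b1); have h2 := abs_le.1 b2
    have h3 := mlr b2' (by positivity : 0 ≤ τ ^ 2 * e1 c l)
    have hx : c0 / 2 * (τ ^ 2 * e1 c l + z ^ 2) ≤ XX P (fun i j => HO P i j c.ψ) (G l c.ψ) (V c.ψ) c.t + B * (τ ^ 2 * Dq l.length c) := by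
      unfold XX; linarith
    have g2 : 0 ≤ τ ^ 2 * Dq l.length c := by positivity
    have g3 : 0 ≤ 2 / c0 + CX + C1 := by positivity
    have g4 : 0 ≤ B + CX + C1 := by positivity
    set X := XX P (fun i j => HO P i j c.ψ) (G l c.ψ) (V c.ψ) c.t
    have hx0 : 0 ≤ X + B * (τ ^ 2 * Dq l.length c) := hx.trans' bp
    calc τ ^ 2 * e1 c l + z ^ 2 = 2 / c0 * (c0 / 2 * (τ ^ 2 * e1 c l + z ^ 2)) := by field_simp
      _ ≤ 2 / c0 * (X + B * (τ ^ 2 * Dq l.length c)) := mll hx bp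
      _ ≤ (2 / c0 + B + CX + C1) * (X + B * (τ ^ 2 * Dq l.length c)) := mlr bl hx0
      _ ≤ _ := mll (add_le_add le_rfl (mlr bl g2)) bp
  · have h1 := (abs_le.1 b1); have h2 := abs_le.1 b2
    have h3 := mlr b2' (by positivity : 0 ≤ τ ^ 2 * e1 c l)
    have g1 : 0 ≤ τ ^ 2 * e1 c l := by positivity
    have g2 : 0 ≤ τ ^ 2 * Dq l.length c := by positivity
    have g0 : 0 ≤ z ^ 2 := by positivity
    have hx : XX P (fun i j => HO P i j c.ψ) (G l c.ψ) (V c.ψ) c.t ≤ CX * (τ ^ 2 * e1 c l + z ^ 2 + τ ^ 2 * Dq l.length c) := by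
      have u1 : XX P (fun i j => HO P i j c.ψ) (G l c.ψ) (V c.ψ) c.t ≤ 3 * (P.μ + 3) ^ 2 * (τ ^ 2 * e1 c l + z ^ 2) + (c0 / 2 * z ^ 2 + B * (τ ^ 2 * Dq l.length c)) + c0 / 2 * (τ ^ 2 * e1 c l) := by
        unfold XX; linarith
      refine u1.trans ?_
      rw [hCX]
      have v1 : 0 ≤ 3 * (P.μ + 3) ^ 2 := by positivity
      linarith [mnn hc0p.le g0, mnn hc0p.le g1, mnn hc0p.le g2, mnn hCH g0, mnn hCH g1, mnn hCH g2, mnn hB0 g0, mnn hB0 g1, mnn v1 g2]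
    refine hx.trans (mlr ?_ bp)
    have : 0 ≤ 2 / c0 + B + C1 := by positivity
    linarith
end
section
variable {P : Prm}
structure Good (P : Prm) (ψ : PF) (e : ℝ) : Prop where
  adm : Adm P ψ
  e0 : 0 < e
  e1 : e ≤ 1
  en : ∀ t : ℝ, 0 < t → energy P.lam P.N ψ t ≤ e ^ 2
def Good.cx {ψ : PF} {e : ℝ} (h : Good P ψ e) {t : ℝ} (ht : 0 < t) : Ctx P := ⟨ψ, e, t, h.adm, h.e0, h.e1, h.en t ht, ht⟩
def jl (P : Prm) (l : W8) (ψ : PF) (t : ℝ) : ℝ := tw P t ^ 2 * ee1 (G l ψ) t + ip (G l ψ) (G l ψ) t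
def wd (P : Prm) (l : W8) (ψ : PF) (t : ℝ) : ℝ := tw P t * ee1 (G l ψ) t
def sm (n : ℕ) (f : W8 → ℝ) : ℝ := ∑ m ∈ Finset.range n, ∑ a : Fin m → Fin 8, f (List.ofFn a)
lemma sm_le {n : ℕ} {f g : W8 → ℝ} (h : ∀ l, f l ≤ g l) : sm n f ≤ sm n g := Finset.sum_le_sum fun _ _ => Finset.sum_le_sum fun _ _ => h _
lemma sm_nn {n : ℕ} {f : W8 → ℝ} (h : ∀ l, 0 ≤ f l) : 0 ≤ sm n f := fsn fun _ _ => fsn fun _ _ => h _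
lemma sm_add (n : ℕ) (f g : W8 → ℝ) : sm n (fun l => f l + g l) = sm n f + sm n g := by unfold sm; simp only [Finset.sum_add_distrib]
lemma sm_mul (n : ℕ) (k : ℝ) (f : W8 → ℝ) : sm n (fun l => k * f l) = k * sm n f := by unfold sm; simp only [Finset.mul_sum]
lemma sm_mono {n m : ℕ} (h : n ≤ m) {f : W8 → ℝ} (hf : ∀ l, 0 ≤ f l) : sm n f ≤ sm m f :=
  Finset.sum_le_sum_of_subset_of_nonneg (Finset.range_subset_range.2 h) fun _ _ _ => fsn fun _ _ => hf _
def En (P : Prm) (ψ : PF) (t : ℝ) : ℝ := sm (P.N + 1) fun l => jl P l ψ t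
def Wd (P : Prm) (n : ℕ) (ψ : PF) (t : ℝ) : ℝ := sm n fun l => wd P l ψ t
def RH (P : Prm) (ψ : PF) (e s t : ℝ) : ℝ := En P ψ s + e * ∫ τ in s..t, Wd P (P.N + 1) ψ τ
def Ff (P : Prm) (l : W8) (ψ : PF) (s t : ℝ) : ℝ := jl P l ψ t + ∫ τ in s..t, wd P l ψ τ
def Bd (P : Prm) (F : (PF) → ℝ → ℝ → ℝ) : Prop := ∃ δ C : ℝ, 0 < δ ∧ 0 ≤ C ∧ ∀ ψ e s t, Good P ψ e → e ≤ δ → 0 < s → s ≤ t → F ψ s t ≤ C * RH P ψ e s t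
lemma ip_self_nn (u : PF) (t : ℝ) : 0 ≤ ip u u t := integral_nonneg fun x => mul_self_nonneg _
lemma ee1_nn (u : PF) (t : ℝ) : 0 ≤ ee1 u t := add_nonneg (ip_self_nn _ _) (fsn fun _ _ => ip_self_nn _ _)
lemma tw_pos {t : ℝ} (ht : 0 ≤ t) : 0 < tw P t := rpow_pos_of_pos bl _
lemma jl_nn (l : W8) (ψ : PF) (t : ℝ) : 0 ≤ jl P l ψ t := add_nonneg (mnn (sqn _) (ee1_nn _ _)) (ip_self_nn _ _)
lemma wd_nn (l : W8) (ψ : PF) {t : ℝ} (ht : 0 ≤ t) : 0 ≤ wd P l ψ t := mnn (tw_pos ht).le (ee1_nn _ _)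
lemma En_nn (ψ : PF) (t : ℝ) : 0 ≤ En P ψ t := sm_nn fun l => jl_nn l ψ t
lemma Wd_nn (n : ℕ) (ψ : PF) {t : ℝ} (ht : 0 ≤ t) : 0 ≤ Wd P n ψ t := sm_nn fun l => wd_nn l ψ ht
lemma iwd_nn (l : W8) (ψ : PF) {s t : ℝ} (hs : 0 ≤ s) (hst : s ≤ t) : 0 ≤ ∫ τ in s..t, wd P l ψ τ :=
  intervalIntegral.integral_nonneg hst fun τ h => wd_nn l ψ (hs.trans h.1)
lemma iWd_nn (n : ℕ) (ψ : PF) {s t : ℝ} (hs : 0 ≤ s) (hst : s ≤ t) : 0 ≤ ∫ τ in s..t, Wd P n ψ τ :=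
  intervalIntegral.integral_nonneg hst fun τ h => Wd_nn n ψ (hs.trans h.1)
lemma ip_ct {u : PF} (hu : SF P.M u) : ContinuousOn (ip u u) (Ioi 0) := fun _ ht => (ip_der hu.1 hu ht).continuousAt.continuousWithinAt
lemma tw_ct : ContinuousOn (tw P) (Ioi 0) := fun _ ht => (tw_der ht).continuousAt.continuousWithinAt
lemma ee1_ct {u : PF} (hu : SF P.M u) : ContinuousOn (ee1 u) (Ioi 0) := (ip_ct (hu.D 0)).add (continuousOn_finsetSum _ fun i _ => ip_ct (hu.D _))
lemma wd_ct {ψ : PF} (h : Adm P ψ) (l : W8) : ContinuousOn (wd P l ψ) (Ioi 0) := tw_ct.mul (ee1_ct (h.g l))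
lemma Wd_ct {ψ : PF} (h : Adm P ψ) (n : ℕ) : ContinuousOn (Wd P n ψ) (Ioi 0) := by
  unfold Wd sm; exact continuousOn_finsetSum _ fun _ _ => continuousOn_finsetSum _ fun _ _ => wd_ct h _
lemma uIcc_sub {s t : ℝ} (hs : 0 < s) (hst : s ≤ t) : uIcc s t ⊆ Ioi 0 := by rw [uIcc_of_le hst]; exact fun x hx => hs.trans_le hx.1
lemma wd_ii {ψ : PF} (h : Adm P ψ) (l : W8) {s t : ℝ} (hs : 0 < s) (hst : s ≤ t) : IntervalIntegrable (wd P l ψ) volume s t := ((wd_ct h l).mono (uIcc_sub hs hst)).intervalIntegrable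
lemma Wd_ii {ψ : PF} (h : Adm P ψ) (n : ℕ) {s t : ℝ} (hs : 0 < s) (hst : s ≤ t) : IntervalIntegrable (Wd P n ψ) volume s t := ((Wd_ct h n).mono (uIcc_sub hs hst)).intervalIntegrable
lemma iWd_eq {ψ : PF} (h : Adm P ψ) (n : ℕ) {s t : ℝ} (hs : 0 < s) (hst : s ≤ t) : ∫ τ in s..t, Wd P n ψ τ = sm n fun l => ∫ τ in s..t, wd P l ψ τ := by
  unfold Wd sm
  rw [intervalIntegral.integral_finsetSum]
  · refine fsc fun m _ => intervalIntegral.integral_finsetSum fun a _ => wd_ii h _ hs hst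
  · intro m _; exact ((continuousOn_finsetSum _ fun a _ => wd_ct h (List.ofFn a)).mono (uIcc_sub hs hst)).intervalIntegrable
lemma RH_nn {ψ : PF} {e s t : ℝ} (he : 0 < e) (hs : 0 < s) (hst : s ≤ t) : 0 ≤ RH P ψ e s t :=
  add_nonneg (En_nn _ _) (mnn he.le (iWd_nn _ _ hs.le hst))
lemma Bd.sum {ι : Type} (S : Finset ι) {F : ι → (PF) → ℝ → ℝ → ℝ} (h : ∀ i ∈ S, Bd P (F i)) : Bd P (fun ψ s t => ∑ i ∈ S, F i ψ s t) := by
  classical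
  induction S using Finset.induction_on with
  | empty => exact ⟨1, 0, one_pos, le_rfl, fun ψ e s t _ _ _ _ => by simp⟩
  | insert a S ha ih =>
    obtain ⟨δ, C, h1, h2, h3⟩ := ih fun i hi => h i (Finset.mem_insert_of_mem hi)
    obtain ⟨δ', C', h1', h2', h3'⟩ := h a (Finset.mem_insert_self a S)
    refine ⟨min δ δ', C' + C, lt_min h1 h1', by positivity, fun ψ e s t hg he hs hst => ?_⟩
    beta_reduce; rw [Finset.sum_insert ha, add_mul]
    exact add_le_add (h3' ψ e s t hg (he.trans (min_le_right _ _)) hs hst) (h3 ψ e s t hg (he.trans (min_le_left _ _)) hs hst)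
lemma Bd.smm {n : ℕ} (h : ∀ l : W8, l.length < n → Bd P (Ff P l)) : Bd P (fun ψ s t => sm n fun l => Ff P l ψ s t) :=
  Bd.sum _ fun m hm => Bd.sum _ fun a _ => h _ (by simpa using hm)
lemma Dq_cx {ψ : PF} {e : ℝ} (h : Good P ψ e) {t : ℝ} (ht : 0 < t) (n : ℕ) : Dq n (h.cx ht) = sm n fun l => ee1 (G l ψ) t := by
  unfold Dq sm; simp only [← ee1_e1]; rfl
lemma Bdl (l : W8) (hl : l.length ≤ P.N) : Bd P (Ff P l) := by
  obtain ⟨n, hn⟩ : ∃ n, l.length = n := ⟨_, rfl⟩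
  induction n using Nat.strong_induction_on generalizing l with
  | _ n ih =>
  obtain ⟨δ1, C1, hδ1, hC1, h1⟩ := Bd.smm (n := l.length) fun l' h' => ih l'.length (hn ▸ h') l' (h'.le.trans hl) rfl
  obtain ⟨δ2, C2, X, hδ2, hC2, h2⟩ := step hl
  have hμ := P.hμ
  refine ⟨min δ1 δ2, (C2 + 2 / P.μ) * (2 * C2 + 2 * C2 * C1 + C2), lt_min hδ1 hδ2, by positivity, fun ψ e s t hg he hs hst => ?_⟩
  have ht : 0 < t := hs.trans_le hst
  have S1 := h1 ψ e s t hg (he.trans (min_le_left _ _)) hs hst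
  have st := fun (τ : ℝ) (hτ : 0 < τ) => h2 (hg.cx hτ) (he.trans (min_le_right _ _))
  have hS : (sm l.length fun l => Ff P l ψ s t) = (sm l.length fun l => jl P l ψ t) + ∫ τ in s..t, Wd P l.length ψ τ := by
    rw [iWd_eq hg.adm _ hs hst, ← sm_add]; rfl
  have hd : ∀ τ, 0 < τ → HasDerivAt (X ψ) (deriv (X ψ) τ) τ := fun τ hτ => by
    obtain ⟨⟨X', hX, _⟩, _⟩ := st τ hτ; exact hX.differentiableAt.hasDerivAt
  have hW : ∀ τ, ∀ hτ : 0 < τ, ∀ n, tw P τ * Dq n (hg.cx hτ) = Wd P n ψ τ := fun τ hτ n => by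
    rw [Dq_cx, ← sm_mul]; rfl
  have key := intervalIntegral.sub_le_integral_of_hasDeriv_right_of_le (g := X ψ) (g' := deriv (X ψ)) (φ := fun τ => -(P.μ / 2) * wd P l ψ τ + (C2 * Wd P l.length ψ τ + C2 * e * Wd P (P.N + 1) ψ τ)) hst
    (fun τ hτ => (hd τ (hs.trans_le hτ.1)).continuousAt.continuousWithinAt) (fun τ hτ => (hd τ (hs.trans_le hτ.1.le)).hasDerivWithinAt)
    (by
      have c1 := ((wd_ct hg.adm l).const_mul (-(P.μ / 2))).add (((Wd_ct hg.adm l.length).const_mul C2).add ((Wd_ct hg.adm (P.N + 1)).const_mul (C2 * e)))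
      refine ContinuousOn.integrableOn_Icc (c1.mono fun τ hτ => hs.trans_le hτ.1))
    (fun τ hτ => by
      have hτ0 : 0 < τ := hs.trans_le hτ.1.le
      obtain ⟨⟨X', hX, hX2⟩, _⟩ := st τ hτ0
      have e0 : deriv (X ψ) τ = X' := hX.deriv
      have e1' : tc (hg.cx hτ0) * e1 (hg.cx hτ0) l = wd P l ψ τ := by rw [← ee1_e1]; rfl
      have e2 := hW τ hτ0 l.length
      have e3 := hW τ hτ0 (P.N + 1)
      rw [← tw_tc] at e1' hX2
      rw [e0]; refine hX2.trans_eq ?_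
      change -(P.μ / 2 * (tw P τ * _)) + C2 * (tw P τ * _ + e * (tw P τ * _)) = _
      rw [e2, e3]; change tw P τ * _ = _ at e1'
      rw [e1']; ring)
  have ii1 := wd_ii hg.adm l hs hst
  have ii2 := Wd_ii hg.adm l.length hs hst
  have ii3 := Wd_ii hg.adm (P.N + 1) hs hst
  rw [intervalIntegral.integral_add (ii1.const_mul _) ((ii2.const_mul _).add (ii3.const_mul _)), intervalIntegral.integral_add (ii2.const_mul _) (ii3.const_mul _),
    intervalIntegral.integral_const_mul, intervalIntegral.integral_const_mul, intervalIntegral.integral_const_mul] at key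
  have hj : ∀ τ (hτ : 0 < τ), jl P l ψ τ ≤ C2 * (X ψ τ + C2 * (sm l.length fun l => jl P l ψ τ)) ∧ X ψ τ ≤ C2 * (2 * En P ψ τ) := by
    intro τ hτ
    obtain ⟨_, a1, a2⟩ := st τ hτ
    have e1' : tc (hg.cx hτ) ^ 2 * e1 (hg.cx hτ) l + nm (sl (G l) (hg.cx hτ)) ^ 2 = jl P l ψ τ := by rw [← ee1_e1, ← ip_nm]; rfl
    have e2 : tc (hg.cx hτ) ^ 2 * Dq l.length (hg.cx hτ) ≤ sm l.length fun l => jl P l ψ τ := by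
      rw [Dq_cx, ← sm_mul]; exact sm_le fun l => le_add_of_nonneg_right (ip_self_nn _ _)
    rw [e1'] at a1 a2
    refine ⟨a1.trans (mll (add_le_add le_rfl (mll e2 hC2.le)) hC2.le), a2.trans (mll ?_ hC2.le)⟩
    have e3 : jl P l ψ τ ≤ En P ψ τ := ws_le (fun l => jl_nn l ψ τ) bo
    have e4 : (sm l.length fun l => jl P l ψ τ) ≤ En P ψ τ := sm_mono bo fun l => jl_nn l ψ τ
    linarith
  have j1 := (hj t ht).1
  have j2 := (hj s hs).2
  have q1 := jl_nn (P := P) l ψ t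
  have q2 := iwd_nn (P := P) l ψ hs.le hst
  have q3 := iWd_nn (P := P) l.length ψ hs.le hst
  have q4 : 0 ≤ sm l.length fun l => jl P l ψ t := sm_nn fun l => jl_nn l ψ t
  have q5 := iWd_nn (P := P) (P.N + 1) ψ hs.le hst
  have q6 := En_nn (P := P) ψ s
  have q7 := hg.e0
  have r0 := RH_nn (P := P) (ψ := ψ) hg.e0 hs hst
  have r1 : En P ψ s ≤ RH P ψ e s t := le_add_of_nonneg_right bp
  have r2 : e * (∫ τ in s..t, Wd P (P.N + 1) ψ τ) ≤ RH P ψ e s t := le_add_of_nonneg_left q6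
  beta_reduce at S1
  rw [hS] at S1
  unfold Ff
  set I1 := ∫ τ in s..t, wd P l ψ τ
  set I2 := ∫ τ in s..t, Wd P l.length ψ τ
  set I3 := ∫ τ in s..t, Wd P (P.N + 1) ψ τ
  set Jn := sm l.length fun l => jl P l ψ t
  set RR := RH P ψ e s t
  have z1 : X ψ t + C2 * Jn ≤ (2 * C2 + 2 * C2 * C1 + C2) * RR - P.μ / 2 * I1 := by
    have a1 := mll r1 hC2.le
    have a2 := mll r2 hC2.le
    have a3 := mll (by linarith : Jn ≤ C1 * RR) hC2.le
    have a4 := mll (by linarith : I2 ≤ C1 * RR) hC2.le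
    linarith
  set ZZ := (2 * C2 + 2 * C2 * C1 + C2) * RR
  have z2 : jl P l ψ t ≤ C2 * ZZ := j1.trans (mll (by nlinarith) hC2.le)
  have z3 : P.μ / 2 * I1 ≤ ZZ := by
    have : 0 ≤ X ψ t + C2 * Jn := nonneg_of_mul_nonneg_right (q1.trans j1) hC2
    linarith
  have z4 : I1 ≤ 2 / P.μ * ZZ := by rw [div_mul_eq_mul_div, le_div_iff₀ hμ]; linarith
  rw [mul_assoc]; change _ ≤ (C2 + 2 / P.μ) * ZZ
  linarith
lemma fin_en : ∃ δ C : ℝ, 0 < δ ∧ 0 < C ∧ ∀ ψ e s t, Good P ψ e → e ≤ δ → 0 < s → s ≤ t → En P ψ t + ∫ τ in s..t, Wd P (P.N + 1) ψ τ ≤ C * En P ψ s := by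
  obtain ⟨δ, C, hδ, hC, h⟩ := Bd.smm (P := P) (n := P.N + 1) fun l hl => Bdl l bo
  refine ⟨min δ (1 / (2 * C + 1)), 2 * C + 1, lt_min hδ bp, by positivity, fun ψ e s t hg he hs hst => ?_⟩
  have h1 := h ψ e s t hg (he.trans (min_le_left _ _)) hs hst
  have hS : (sm (P.N + 1) fun l => Ff P l ψ s t) = En P ψ t + ∫ τ in s..t, Wd P (P.N + 1) ψ τ := by
    rw [iWd_eq hg.adm _ hs hst, En, ← sm_add]; rfl
  beta_reduce at h1
  rw [hS] at h1
  have he2 : e * (2 * C + 1) ≤ 1 := by rw [← le_div_iff₀ bp]; exact he.trans (min_le_right _ _)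
  have q5 := iWd_nn (P := P) (P.N + 1) ψ hs.le hst
  have q6 := En_nn (P := P) ψ s
  have q8 := En_nn (P := P) ψ t
  have q7 := hg.e0
  unfold RH at h1
  set I3 := ∫ τ in s..t, Wd P (P.N + 1) ψ τ
  have := mlr he2 q5
  nlinarith
end
section
variable {P : Prm}
lemma cd_gam {f : PF} (hf : ContDiff ℝ (⊤ : ℕ∞) f) (k : Fin 8) : ContDiff ℝ (⊤ : ℕ∞) (Gam k f) := by
  have h1 : ∀ v : Pt, ContDiff ℝ (⊤ : ℕ∞) (fun p => fderiv ℝ f p v) := fun v => (hf.fderiv_right (m := (⊤ : ℕ∞)) (by norm_cast)).clm_apply contDiff_const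
  have hx : ∀ i : Fin 3, ContDiff ℝ (⊤ : ℕ∞) (fun p : Pt => p.2 i) := fun i => by fun_prop
  have ht : ContDiff ℝ (⊤ : ℕ∞) (fun p : Pt => p.1) := contDiff_fst
  fin_cases k
  · exact h1 _
  · exact h1 _
  · exact h1 _
  · exact h1 _
  · exact ((hx 1).mul (h1 _)).sub ((hx 2).mul (h1 _))
  · exact ((hx 2).mul (h1 _)).sub ((hx 0).mul (h1 _))
  · exact ((hx 0).mul (h1 _)).sub ((hx 1).mul (h1 _))
  · exact (ht.mul (h1 _)).add (ContDiff.sum fun i _ => (hx i).mul (h1 _))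
lemma cd_g {ψ : PF} (h : Adm P ψ) (l : W8) : Continuous (G l ψ) := by
  suffices ContDiff ℝ (⊤ : ℕ∞) (G l ψ) from this.continuous
  induction l with
  | nil => exact h.sm
  | cons k l ih => exact cd_gam ih k
lemma g_supp {ψ : PF} (h : Adm P ψ) (l : W8) {t : ℝ} (ht : 0 ≤ t) {x : E3} (hx : t + P.M < ‖x‖) : G l ψ (t, x) = 0 := by
  rcases ht.lt_or_eq with h0 | rfl
  · exact (h.g l).2 (t, x) h0 hx
  · have c : Continuous fun s : ℝ => G l ψ (s, x) := (cd_g h l).comp (by fun_prop)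
    have c1 : Filter.Tendsto (fun s : ℝ => G l ψ (s, x)) (nhdsWithin 0 (Ioi 0)) (nhds (G l ψ (0, x))) := c.continuousAt.tendsto.mono_left nhdsWithin_le_nhds
    refine tendsto_nhds_unique c1 (tendsto_const_nhds.congr' ?_)
    have : ∀ᶠ s : ℝ in nhdsWithin 0 (Ioi 0), s + P.M < ‖x‖ := nhdsWithin_le_nhds ((continuous_id.add continuous_const).continuousAt.eventually_lt continuousAt_const hx)
    filter_upwards [this, self_mem_nhdsWithin] with s hs hs0
    exact ((h.g l).2 (s, x) hs0 hs).symm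
lemma g_cc {ψ : PF} (h : Adm P ψ) (l : W8) {t : ℝ} (ht : 0 ≤ t) : CC (fun x => G l ψ (t, x)) := by
  refine ⟨(cd_g h l).comp (by fun_prop), HasCompactSupport.intro (isCompact_closedBall (0 : E3) (t + P.M)) fun x hx => g_supp h l ht ?_⟩
  simpa using hx
lemma ip_ct0 {ψ : PF} (h : Adm P ψ) (l : W8) : ContinuousOn (ip (G l ψ) (G l ψ)) (Ici 0) := by
  intro t ht
  have h1 : ContinuousOn (fun t => ∫ x, G l ψ (t, x) * G l ψ (t, x)) (Ico 0 (t + 1)) := by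
    refine continuousOn_integral_of_compact_support (isCompact_closedBall (0 : E3) (t + 1 + P.M)) ?_ ?_
    · exact ((cd_g h l).mul (cd_g h l)).continuousOn
    · intro p x hp hx
      have : G l ψ (p, x) = 0 := g_supp h l hp.1 (by
        have : t + 1 + P.M < ‖x‖ := by simpa using hx
        linarith [hp.2])
      rw [this, mul_zero]
  have h2 : Ico 0 (t + 1) ∈ nhdsWithin t (Ici 0) := by
    rw [← Ici_inter_Iio]; exact Filter.inter_mem self_mem_nhdsWithin (nhdsWithin_le_nhds (Iio_mem_nhds bl))
  exact (h1 t ⟨ht, by linarith⟩).mono_of_mem_nhdsWithin h2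
lemma ee1_g (l : W8) (ψ : PF) : ee1 (G l ψ) = fun t => ∑ α : Fin 4, ip (G (cs α :: l) ψ) (G (cs α :: l) ψ) t := by
  funext t; unfold ee1; rw [Fin.sum_univ_succ (n := 3)]; simp only [← G_cs]
lemma ee1_ct0 {ψ : PF} (h : Adm P ψ) (l : W8) : ContinuousOn (ee1 (G l ψ)) (Ici 0) := by
  rw [ee1_g]; exact continuousOn_finsetSum _ fun α _ => ip_ct0 h _
lemma tw_ct0 : ContinuousOn (tw P) (Ici 0) := fun t (ht : 0 ≤ t) => by
  have : ContinuousAt (fun t : ℝ => (1 + t) ^ P.lam) t := (continuousAt_const.add continuousAt_id).rpow_const (Or.inl (by simp; linarith))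
  exact this.continuousWithinAt
def FF (P : Prm) (ψ : PF) (t : ℝ) : ℝ := sm (P.N + 1) fun l => tw P t ^ 2 * ee1 (G l ψ) t + ip (G [] ψ) (G [] ψ) t
lemma sm_ct {n : ℕ} {f : W8 → ℝ → ℝ} (h : ∀ l, ContinuousOn (f l) (Ici 0)) : ContinuousOn (fun t => sm n fun l => f l t) (Ici 0) := by
  unfold sm; exact continuousOn_finsetSum _ fun _ _ => continuousOn_finsetSum _ fun _ _ => h _
lemma En_ct0 {ψ : PF} (h : Adm P ψ) : ContinuousOn (En P ψ) (Ici 0) := sm_ct fun l => ((tw_ct0.pow 2).mul (ee1_ct0 h l)).add (ip_ct0 h l)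
lemma FF_ct0 {ψ : PF} (h : Adm P ψ) : ContinuousOn (FF P ψ) (Ici 0) := sm_ct fun l => ((tw_ct0.pow 2).mul (ee1_ct0 h l)).add (ip_ct0 h [])
lemma wd_ct0 {ψ : PF} (h : Adm P ψ) (l : W8) : ContinuousOn (wd P l ψ) (Ici 0) := tw_ct0.mul (ee1_ct0 h l)
lemma Wd_ct0 {ψ : PF} (h : Adm P ψ) (n : ℕ) : ContinuousOn (Wd P n ψ) (Ici 0) := sm_ct fun l => wd_ct0 h l
lemma FF_nn (ψ : PF) (t : ℝ) : 0 ≤ FF P ψ t := sm_nn fun l => add_nonneg (mnn (sqn _) (ee1_nn _ _)) (ip_self_nn _ _)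
lemma tw1 {t : ℝ} (ht : 0 ≤ t) : 1 ≤ tw P t := one_le_rpow bl P.hlam0.le
lemma tw2 {t : ℝ} (ht : 0 ≤ t) : (1 + t) ^ (2 * P.lam) = tw P t ^ 2 := by
  rw [mul_comm, rpow_mul bl, rpow_two]; rfl
lemma int_id {ψ : PF} (h : Adm P ψ) (l : W8) {t : ℝ} (ht : 0 ≤ t) : ∫ x, ∑ α : Fin 4, (Dop α (GamWord l ψ) (t, x)) ^ 2 = ee1 (G l ψ) t := by
  have e : ∀ (α : Fin 4) x, Dop α (GamWord l ψ) (t, x) = G (cs α :: l) ψ (t, x) := fun α x => by rw [G_cs]; rfl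
  simp only [e, ee1_g]
  rw [integral_finsetSum _ fun α _ => (g_cc h (cs α :: l) ht).sq.int]
  unfold ip; simp only [pow_two]
lemma int_ii {ψ : PF} (h : Adm P ψ) (l : W8) {t : ℝ} (ht : 0 ≤ t) : Integrable fun x => ∑ α : Fin 4, (Dop α (GamWord l ψ) (t, x)) ^ 2 := by
  have e : ∀ (α : Fin 4) x, Dop α (GamWord l ψ) (t, x) = G (cs α :: l) ψ (t, x) := fun α x => by rw [G_cs]; rfl
  simp only [e]
  exact (CC.sum _ fun α _ => (g_cc h (cs α :: l) ht).sq).int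
lemma int_id2 {ψ : PF} (h : Adm P ψ) (l l' : W8) {t : ℝ} (ht : 0 ≤ t) :
    ∫ x, ((1 + t) ^ (2 * P.lam) * (∑ α : Fin 4, (Dop α (GamWord l ψ) (t, x)) ^ 2) + (GamWord l' ψ (t, x)) ^ 2) = tw P t ^ 2 * ee1 (G l ψ) t + ip (G l' ψ) (G l' ψ) t := by
  change ∫ x, ((1 + t) ^ (2 * P.lam) * (∑ α : Fin 4, (Dop α (GamWord l ψ) (t, x)) ^ 2) + (G l' ψ (t, x)) ^ 2) = _
  rw [integral_add ((int_ii h l ht).const_mul _) (g_cc h l' ht).sq.int, integral_const_mul, int_id h l ht, tw2 ht]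
  unfold ip; simp only [pow_two]
lemma en_En {ψ : PF} (h : Adm P ψ) {t : ℝ} (ht : 0 ≤ t) : energy P.lam P.N ψ t = En P ψ t :=
  fsc fun _ _ => fsc fun _ _ => int_id2 h _ _ ht
lemma En_FF : ∃ C : ℝ, 0 ≤ C ∧ ∀ ψ e t, Good P ψ e → 0 < t → t ≤ 1 → En P ψ t ≤ C * FF P ψ t := by
  have key : ∀ l : W8, l.length ≤ P.N → Le (fun c : Ctx P => nm (sl (G l) c) ^ 2) (fun c => Tc c ^ 2 * FF P c.ψ c.t) := by
    intro l hl
    have hF : ∀ c : Ctx P, FF P c.ψ c.t ≤ Tc c ^ 2 * FF P c.ψ c.t := fun c => le_mul_of_one_le_left (FF_nn _ _) (one_le_pow₀ (Tc1 c))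
    cases l with
    | nil =>
      refine Le.of fun c => le_trans ?_ (hF c)
      rw [← ip_nm]
      exact le_trans (le_add_of_nonneg_left (mnn (sqn _) (ee1_nn _ _))) (ws_le (f := fun l => tw P c.t ^ 2 * ee1 (G l c.ψ) c.t + ip (G [] c.ψ) (G [] c.ψ) c.t) (l := []) (fun l => add_nonneg (mnn (sqn _) (ee1_nn _ _)) (ip_self_nn _ _)) bs)
    | cons k m =>
      obtain ⟨C, hC, h⟩ := (nf_gam (P := P) k (n := P.N + 1) (m := m) (by simp at hl; omega)).2
      refine ⟨C ^ 2, by positivity, fun c => ?_⟩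
      have h1 := pow_le_pow_left₀ (nm_nn _) (h c) 2
      refine h1.trans ?_
      have h2 : Dq (P.N + 1) c ≤ FF P c.ψ c.t := by
        unfold Dq; simp only [← ee1_e1]
        refine sm_le (f := fun l => ee1 (G l c.ψ) c.t) fun l => ?_
        have := one_le_pow₀ (n := 2) (tw1 (P := P) c.ht.le)
        nlinarith [ee1_nn (G l c.ψ) c.t, ip_self_nn (G [] c.ψ) c.t]
      calc (C * (Tc c * Dm (P.N + 1) c)) ^ 2 = C ^ 2 * (Tc c ^ 2 * Dq (P.N + 1) c) := by rw [← Dm_sq]; ring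
        _ ≤ _ := by beta_reduce; gcongr
  have hn : ∀ c : Ctx P, 0 ≤ Tc c ^ 2 * FF P c.ψ c.t := fun c => mnn (sqn _) (FF_nn _ _)
  obtain ⟨C, hC, h⟩ := Le.sum (Finset.range (P.N + 1)) hn fun m hm => Le.sum (Finset.univ : Finset (Fin m → Fin 8)) hn fun a _ => key (List.ofFn a) (by simp at hm ⊢; omega)
  refine ⟨1 + 4 * C, by positivity, fun ψ e t hg ht ht1 => ?_⟩
  have h1 := h (hg.cx ht)
  have h2 : Tc (hg.cx ht) ^ 2 ≤ 4 := by
    have : Tc (hg.cx ht) ≤ 2 := by change 1 + t ≤ 2; linarith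
    nlinarith [Tc0 (hg.cx ht)]
  simp only [← ip_nm] at h1
  change sm (P.N + 1) (fun l => ip (G l ψ) (G l ψ) t) ≤ C * (Tc (hg.cx ht) ^ 2 * FF P ψ t) at h1
  have h3 : En P ψ t = sm (P.N + 1) (fun l => tw P t ^ 2 * ee1 (G l ψ) t) + sm (P.N + 1) (fun l => ip (G l ψ) (G l ψ) t) := by rw [← sm_add]; rfl
  have h4 : sm (P.N + 1) (fun l => tw P t ^ 2 * ee1 (G l ψ) t) ≤ FF P ψ t := sm_le fun l => le_add_of_nonneg_right (ip_self_nn _ _)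
  have h5 := mll (mlr h2 (FF_nn (P := P) ψ t)) hC
  linarith
lemma ii0 {f : ℝ → ℝ} (hf : ContinuousOn f (Ici 0)) {s t : ℝ} (hs : 0 ≤ s) (ht : 0 ≤ t) : IntervalIntegrable f volume s t :=
  (hf.mono fun x hx => (le_min hs ht).trans hx.1).intervalIntegrable
lemma final (P : Prm) : ∃ C > 0, ∃ δ > 0, ∃ A0 > 0, ∀ ψ ε e, Good P ψ e → e ≤ δ → En P ψ 0 ≤ ε ^ 2 → ∀ t, 0 < t →
    En P ψ t + C * ∫ τ in (0 : ℝ)..t, Wd P (P.N + 1) ψ τ ≤ C * ε ^ 2 + C * (A0 * ∫ τ in (0 : ℝ)..(min t 1), FF P ψ τ) := by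
  obtain ⟨δ, C0, hδ, hC0, h⟩ := fin_en (P := P)
  obtain ⟨C1, hC1, h1⟩ := En_FF
  refine ⟨C0 + 1, by positivity, δ, hδ, 1 + C0 ^ 2 * C1, by positivity, fun ψ ε e hg he h0 t ht => ?_⟩
  have hF := FF_ct0 hg.adm
  have hW := Wd_ct0 hg.adm (P.N + 1)
  have hWF : ∀ τ, 0 ≤ τ → Wd P (P.N + 1) ψ τ ≤ FF P ψ τ := fun τ hτ => sm_le fun l => by
    have h2 : tw P τ ≤ tw P τ ^ 2 := by nlinarith [tw1 (P := P) hτ]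
    exact (mlr h2 (ee1_nn _ _)).trans (le_add_of_nonneg_right (ip_self_nn _ _))
  have hI : ∀ t, 0 ≤ t → ∫ τ in (0 : ℝ)..t, Wd P (P.N + 1) ψ τ ≤ ∫ τ in (0 : ℝ)..t, FF P ψ τ := fun t ht =>
    intervalIntegral.integral_mono_on ht (ii0 hW le_rfl ht) (ii0 hF le_rfl ht) fun τ hτ => hWF τ hτ.1
  have hFn : ∀ t, 0 ≤ t → 0 ≤ ∫ τ in (0 : ℝ)..t, FF P ψ τ := fun t ht => intervalIntegral.integral_nonneg ht fun τ _ => FF_nn ψ τ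
  have hCC : 0 ≤ C0 ^ 2 * C1 := by positivity
  rcases le_total t 1 with ht1 | ht1
  · rw [min_eq_left ht1]
    have hE : En P ψ t ≤ C0 * En P ψ 0 := by
      have c1 : Filter.Tendsto (fun s => C0 * En P ψ s) (nhdsWithin 0 (Ioi 0)) (nhds (C0 * En P ψ 0)) :=
        (((En_ct0 hg.adm) 0 self_mem_Ici).mono_left (nhdsWithin_mono _ Ioi_subset_Ici_self)).const_mul C0
      refine ge_of_tendsto c1 ?_
      filter_upwards [Ioc_mem_nhdsGT ht] with s hs
      have := h ψ e s t hg he hs.1 hs.2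
      linarith [iWd_nn (P := P) (P.N + 1) ψ hs.1.le hs.2]
    have a1 := hI t ht.le
    have a2 := hFn t ht.le
    have a3 := mll h0 hC0.le
    have a4 := mnn hCC a2
    have a5 := sqn ε
    nlinarith
  · rw [min_eq_right ht1]
    have a1 := hI 1 zero_le_one
    have a2 := hFn 1 zero_le_one
    have sp : ∫ τ in (0 : ℝ)..t, Wd P (P.N + 1) ψ τ = (∫ τ in (0 : ℝ)..1, Wd P (P.N + 1) ψ τ) + ∫ τ in (1 : ℝ)..t, Wd P (P.N + 1) ψ τ :=
      (intervalIntegral.integral_add_adjacent_intervals (ii0 hW le_rfl zero_le_one) (ii0 hW zero_le_one ht.le)).symm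
    have b1 := h ψ e 1 t hg he one_pos ht1
    have b2 : En P ψ 1 ≤ C0 * C1 * ∫ τ in (0 : ℝ)..1, FF P ψ τ := by
      have m := intervalIntegral.integral_mono_on_of_le_Ioo (f := fun _ => En P ψ 1) (g := fun s => C0 * C1 * FF P ψ s) zero_le_one bs ((ii0 hF le_rfl zero_le_one).const_mul _) fun s hs => by
        have u1 := h ψ e s 1 hg he hs.1 hs.2.le
        have u2 := mll (h1 ψ e s hg hs.1 hs.2.le) hC0.le
        linarith [iWd_nn (P := P) (P.N + 1) ψ hs.1.le hs.2.le]
      rw [intervalIntegral.integral_const_mul] at m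
      simpa using m
    have b3 := mll b2 hC0.le
    have q := En_nn (P := P) ψ t
    have q2 := iWd_nn (P := P) (P.N + 1) ψ zero_le_one ht1
    rw [sp]
    set I1 := ∫ τ in (1 : ℝ)..t, Wd P (P.N + 1) ψ τ
    set I0 := ∫ τ in (0 : ℝ)..1, Wd P (P.N + 1) ψ τ
    set J := ∫ τ in (0 : ℝ)..1, FF P ψ τ
    have d1 : En P ψ t + (C0 + 1) * I1 ≤ (C0 + 1) * (En P ψ t + I1) := by nlinarith
    have d2 : (C0 + 1) * (En P ψ t + I1) ≤ (C0 + 1) * (C0 ^ 2 * C1 * J) := mll bl bp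
    have d3 : (C0 + 1) * I0 ≤ (C0 + 1) * J := mll a1 bp
    have d4 : 0 ≤ (C0 + 1) * ε ^ 2 := by positivity
    linarith
end
/-- **Time-weighted energy estimate for the full vector fields** (Lemma 2.5): for `μ > 0`
and `λ ∈ (0,1]` there are `C, δ > 0` and a nonnegative `A ∈ L¹((0,∞))` such that under
the bootstrap assumption, for all `t > 0`,
`Σ_{|a|≤N} ∫ ((1+t)^{2λ}|∂Γ^aψ|² + |Γ^aψ|²) dx + C Σ_{|a|≤N} ∫₀ᵗ∫ (1+τ)^λ|∂Γ^aψ|² dx dτ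
≤ Cε² + C(1+Kε) ∫₀ᵗ A(τ) Σ_{|a|≤N} ∫ ((1+τ)^{2λ}|∂Γ^aψ|² + ψ²) dx dτ`. -/
theorem energy_estimate_vector_fields
    (μ lam γ M : ℝ) (N : ℕ) (hμ : 0 < μ) (hlam0 : 0 < lam) (hlam1 : lam ≤ 1)
    (hγ : 1 < γ) (hM : 0 < M) (hN : 8 ≤ N) :
    ∃ C > 0, ∃ δ > 0, ∃ A : ℝ → ℝ,
      (∀ s : ℝ, 0 ≤ A s) ∧ IntegrableOn A (Ioi 0) ∧
      ∀ (ψ : Pt → ℝ) (K ε : ℝ),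
        ContDiff ℝ (⊤ : ℕ∞) ψ →
        (∀ t : ℝ, 0 ≤ t → ∀ x : E3, t + M < ‖x‖ → ψ (t, x) = 0) →
        psiEq μ lam γ ψ →
        0 < K → 0 < ε →
        energy lam N ψ 0 ≤ ε ^ 2 →
        (∀ t : ℝ, 0 ≤ t → energy lam N ψ t ≤ K ^ 2 * ε ^ 2) →
        K * ε ≤ δ →
        ∀ t : ℝ, 0 < t →
          energy lam N ψ t
          + C * ∑ n ∈ Finset.range (N + 1), ∑ a : Fin n → Fin 8,
              ∫ τ in (0 : ℝ)..t, ∫ x : E3, (1 + τ) ^ lam *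
                ∑ α : Fin 4, (Dop α (GamWord (List.ofFn a) ψ) (τ, x)) ^ 2
          ≤ C * ε ^ 2 + C * (1 + K * ε) *
              ∫ τ in (0 : ℝ)..t, A τ *
                ∑ n ∈ Finset.range (N + 1), ∑ a : Fin n → Fin 8,
                  ∫ x : E3, ((1 + τ) ^ (2 * lam) *
                      (∑ α : Fin 4, (Dop α (GamWord (List.ofFn a) ψ) (τ, x)) ^ 2)
                    + (ψ (τ, x)) ^ 2) := by
  let P : Prm := ⟨μ, lam, γ, M, N, hμ, hlam0, hlam1, hγ, hM, hN⟩
  obtain ⟨C, hC, δ, hδ, A0, hA0, h⟩ := final P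
  refine ⟨C, hC, min δ 1, lt_min hδ one_pos, indicator (Iic 1) fun _ => A0, fun s => indicator_nonneg (fun _ _ => hA0.le) s, ?_, ?_⟩
  · rw [IntegrableOn, integrable_indicator_iff measurableSet_Iic, IntegrableOn, Measure.restrict_restrict measurableSet_Iic]
    refine (integrableOn_const (s := Iic 1 ∩ Ioi 0) (C := A0) ?_)
    rw [inter_comm, Ioi_inter_Iic]; simp
  intro ψ K ε hψ hsupp heq hK hε h0 hb hKe t ht
  have ha : Adm P ψ := ⟨hψ, hsupp, heq⟩
  have hg : Good P ψ (K * ε) := ⟨ha, by positivity, hKe.trans (min_le_right _ _), fun t ht => (hb t ht.le).trans_eq (by ring)⟩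
  have key := h ψ ε (K * ε) hg (hKe.trans (min_le_left _ _)) ((en_En ha le_rfl).symm.trans_le h0) t ht
  have e1 : ∑ n ∈ Finset.range (N + 1), ∑ a : Fin n → Fin 8, ∫ τ in (0 : ℝ)..t, ∫ x : E3, (1 + τ) ^ lam * ∑ α : Fin 4, (Dop α (GamWord (List.ofFn a) ψ) (τ, x)) ^ 2 = ∫ τ in (0 : ℝ)..t, Wd P (P.N + 1) ψ τ := by
    unfold Wd sm
    rw [intervalIntegral.integral_finsetSum fun m _ => ii0 (continuousOn_finsetSum _ fun a _ => wd_ct0 ha (List.ofFn a)) le_rfl ht.le]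
    refine fsc fun m _ => ?_
    rw [intervalIntegral.integral_finsetSum fun a _ => ii0 (wd_ct0 ha (List.ofFn a)) le_rfl ht.le]
    refine fsc fun a _ => intervalIntegral.integral_congr fun τ hτ => ?_
    rw [uIcc_of_le ht.le] at hτ
    beta_reduce
    rw [integral_const_mul, int_id ha _ hτ.1]; rfl
  have hF := FF_ct0 ha
  have hm : 0 ≤ min t 1 := le_min ht.le zero_le_one
  have e2 : ∫ τ in (0 : ℝ)..t, (indicator (Iic (1 : ℝ)) (fun _ => A0) τ) * ∑ n ∈ Finset.range (N + 1), ∑ a : Fin n → Fin 8,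
                  ∫ x : E3, ((1 + τ) ^ (2 * lam) * (∑ α : Fin 4, (Dop α (GamWord (List.ofFn a) ψ) (τ, x)) ^ 2) + (ψ (τ, x)) ^ 2) = A0 * ∫ τ in (0 : ℝ)..(min t 1), FF P ψ τ := by
    have f1 : ∀ τ ∈ uIoc 0 t, (indicator (Iic (1 : ℝ)) (fun _ => A0) τ) * ∑ n ∈ Finset.range (N + 1), ∑ a : Fin n → Fin 8,
                  ∫ x : E3, ((1 + τ) ^ (2 * lam) * (∑ α : Fin 4, (Dop α (GamWord (List.ofFn a) ψ) (τ, x)) ^ 2) + (ψ (τ, x)) ^ 2) = indicator (Iic (1 : ℝ)) (fun τ => A0 * FF P ψ τ) τ := by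
      intro τ hτ
      rw [uIoc_of_le ht.le] at hτ
      have : ∑ n ∈ Finset.range (N + 1), ∑ a : Fin n → Fin 8, ∫ x : E3, ((1 + τ) ^ (2 * lam) * (∑ α : Fin 4, (Dop α (GamWord (List.ofFn a) ψ) (τ, x)) ^ 2) + (ψ (τ, x)) ^ 2) = FF P ψ τ :=
        fsc fun _ _ => fsc fun _ _ => int_id2 ha _ [] hτ.1.le
      rw [this]; by_cases h1 : τ ∈ Iic (1 : ℝ) <;> simp [indicator, h1]
    rw [intervalIntegral.integral_congr_ae (.of_forall f1), intervalIntegral.integral_of_le ht.le, setIntegral_indicator measurableSet_Iic, Ioc_inter_Iic, ← intervalIntegral.integral_of_le hm, intervalIntegral.integral_const_mul]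
  rw [e1, e2, ← en_En ha ht.le |>.symm]
  have hpos : 0 ≤ A0 * ∫ τ in (0 : ℝ)..(min t 1), FF P ψ τ := mnn hA0.le (intervalIntegral.integral_nonneg hm fun τ _ => FF_nn ψ τ)
  have hke : 0 ≤ K * ε := by positivity
  have := mnn (mnn hC.le hke) hpos
  linarith
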